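/- Let a, r, N be positive integers with 2rN < a, let z₀ ∈ {1, e^{iπ/N}}, p ∈ {0,1}, and set i₀ = 1 if z₀ = e^{iπ/N} and i₀ = 2 if z₀ = 1. There exists a positive constant c₂, depending only on a and N, such that for every sufficiently large multiple n of N there exist integers 1 ≤ k_{i₀} < k_{i₀+1} < … < k_{a+N} ≤ c₂ for which the square matrix [s_{k_j,i}]_{i₀ ≤ i,j ≤ a+N} is invertible (its determinant is non-zero). -/

import Mathlib

noncomputable def Frat (a r N n : ℕ) (t : ℚ) : ℚ :=
  ((n / N).factorial : ℚ) ^ (a - 2 * r * N) *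
    (ascPochhammer ℚ (r * n)).eval (t - r * n) *
    (ascPochhammer ℚ (r * n)).eval (t + n + 1) /
    ∏ h ∈ Finset.range (n / N + 1), (t + N * h) ^ a

def IsPartialFractionCoeffs (a r N n : ℕ) (p : ℕ → ℕ → ℚ) : Prop :=
  ∀ t : ℚ, (∀ h ∈ Finset.range (n / N + 1), t + N * h ≠ 0) →
    Frat a r N n t =
      ∑ h ∈ Finset.range (n / N + 1), ∑ j ∈ Finset.Icc 1 a, p j h / (t + N * h) ^ j

/-- `P_j(z) = ∑_{h=0}^{n/N} p_{j,h} z^{Nh}` for `1 ≤ j ≤ a`, and `0` otherwise. -/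
noncomputable def Ppoly (a N n : ℕ) (p : ℕ → ℕ → ℚ) (j : ℕ) : Polynomial ℚ :=
  if 1 ≤ j ∧ j ≤ a then
    ∑ h ∈ Finset.range (n / N + 1), Polynomial.C (p j h) * Polynomial.X ^ (N * h)
  else 0

noncomputable def Upoly (a N n : ℕ) (p : ℕ → ℕ → ℚ) : Polynomial ℚ :=
  -∑ t ∈ Finset.Icc 1 n,
    Polynomial.C (∑ j ∈ Finset.Icc 1 a, ∑ h ∈ Finset.range ((t - 1) / N + 1),
      p j h / ((t : ℚ) - N * h) ^ j) * Polynomial.X ^ t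

noncomputable def Vpoly (a N n : ℕ) (p : ℕ → ℕ → ℚ) : Polynomial ℚ :=
  -∑ t ∈ Finset.range n,
    Polynomial.C (∑ j ∈ Finset.Icc 1 a, ∑ h ∈ Finset.Icc ((t + N) / N) (n / N),
      p j h / ((N * h : ℚ) - t) ^ j) * Polynomial.X ^ t

/-- Derivative of a rational function. -/
noncomputable def ratDeriv (f : RatFunc ℚ) : RatFunc ℚ :=
  RatFunc.mk (Polynomial.derivative f.num * f.denom - f.num * Polynomial.derivative f.denom)
    (f.denom ^ 2)

/-- `P_{k,j}` (with `k` shifted: `PPk k j = P_{k+1,j}`), defined by `P_{1,j} = P_j` and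
`P_{k,j} = P'_{k-1,j} - (1/z) P_{k-1,j+1}`, where `P_{k-1,a+1} = 0`. -/
noncomputable def PPk (a N n : ℕ) (p : ℕ → ℕ → ℚ) : ℕ → ℕ → RatFunc ℚ
  | 0, j => algebraMap (Polynomial ℚ) (RatFunc ℚ) (Ppoly a N n p j)
  | k + 1, j => ratDeriv (PPk a N n p k j) - (1 / RatFunc.X) * PPk a N n p k (j + 1)

/-- `U_k` (with `k` shifted: `UkF k = U_{k+1}`): `U₁ = U`, `U_k = U'_{k-1} - P_{k-1,1}/(1-z)`. -/
noncomputable def UkF (a N n : ℕ) (p : ℕ → ℕ → ℚ) : ℕ → RatFunc ℚ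
  | 0 => algebraMap (Polynomial ℚ) (RatFunc ℚ) (Upoly a N n p)
  | k + 1 => ratDeriv (UkF a N n p k) - (1 / (1 - RatFunc.X)) * PPk a N n p k 1

/-- `V_k` (with `k` shifted: `VkF k = V_{k+1}`): `V₁ = V`, `V_k = V'_{k-1} + P_{k-1,1}/(z(1-z))`. -/
noncomputable def VkF (a N n : ℕ) (p : ℕ → ℕ → ℚ) : ℕ → RatFunc ℚ
  | 0 => algebraMap (Polynomial ℚ) (RatFunc ℚ) (Vpoly a N n p)
  | k + 1 => ratDeriv (VkF a N n p k) + (1 / (RatFunc.X * (1 - RatFunc.X))) * PPk a N n p k 1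

/-- `d_m = lcm(1, 2, …, m)`. -/
def dlcm (m : ℕ) : ℕ := Finset.lcm (Finset.Icc 1 m) id

/-- `δ_n = (N d_n)^a N^{an/N}`. -/
def deltan (a N n : ℕ) : ℕ := (N * dlcm n) ^ a * N ^ (a * (n / N))

/-- `f ∈ ℚ[z^N, z^{-N}]`. -/
def InLaurentN (N : ℕ) (f : RatFunc ℚ) : Prop :=
  ∃ (s : Finset ℤ) (c : ℤ → ℚ), f = ∑ m ∈ s, RatFunc.C (c m) * RatFunc.X ^ ((N : ℤ) * m)


section
open Polynomial

namespace ZE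

/-- Casorati-type lemma. -/
theorem casorati {K : Type*} [Field K] [Algebra ℂ K] (σ : K →+* K)
    (hσc : ∀ c : ℂ, σ (algebraMap ℂ K c) = algebraMap ℂ K c)
    (hfix : ∀ f : K, σ f = f → ∃ c : ℂ, f = algebraMap ℂ K c) :
    ∀ (d : ℕ) (f : ℕ → K),
      (∀ c : ℕ → ℂ, ∑ j ∈ Finset.range d, algebraMap ℂ K (c j) * f j = 0 → ∀ j < d, c j = 0) →
      ∀ O : ℕ → K, (∀ j < d, ∑ i ∈ Finset.range d, O i * (σ^[i]) (f j) = 0) →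
      ∀ i < d, O i = 0 := by
  have hit : ∀ (i : ℕ) (x y : K), (σ^[i]) (x * y) = (σ^[i]) x * (σ^[i]) y := by
    intro i x y
    exact iterate_map_mul σ i x y
  have hit1 : ∀ (i : ℕ), (σ^[i]) (1:K) = 1 := fun i => iterate_map_one σ i
  intro d
  induction d with
  | zero => intro f _ O _ i hi; omega
  | succ d ih =>
    intro f hind O hO
    have hf : f d ≠ 0 := by
      intro h0
      have := hind (fun j => if j = d then 1 else 0) ?_ d (by omega)
      · simp at this
      · rw [Finset.sum_range_succ]
        simp [h0]
    have hfi : ∀ i, (σ^[i]) (f d) ≠ 0 := by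
      intro i h
      have h1 := hit i (f d) (f d)⁻¹
      rw [mul_inv_cancel₀ hf, hit1, h, zero_mul] at h1
      exact one_ne_zero h1
    set h : ℕ → K := fun j => f j / f d with hh
    have hfh : ∀ j, f j = f d * h j := by intro j; simp only [hh]; field_simp
    set O' : ℕ → K := fun i => O i * (σ^[i]) (f d) with hO'
    have hO1 : ∀ j < d + 1, ∑ i ∈ Finset.range (d+1), O' i * (σ^[i]) (h j) = 0 := by
      intro j hj
      rw [← hO j hj]
      apply Finset.sum_congr rfl
      intro i _
      rw [hfh j, hit]; simp only [hO']; ring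
    have hsum : ∑ i ∈ Finset.range (d+1), O' i = 0 := by
      have := hO1 d (by omega)
      have h1 : h d = 1 := by simp [hh, hf]
      rw [h1] at this
      simpa [hit1] using this
    -- partial sums
    set S : ℕ → K := fun i => ∑ k ∈ Finset.range (i+1), O' k with hS
    have habel : ∀ (e : ℕ) (x : ℕ → K), ∑ i ∈ Finset.range (e+1), O' i * x i
        = S e * x e - ∑ i ∈ Finset.range e, S i * (x (i+1) - x i) := by
      intro e x
      induction e with
      | zero => simp [hS]
      | succ e ihe =>
        rw [Finset.sum_range_succ, ihe, Finset.sum_range_succ (n := e)]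
        have : S (e+1) = S e + O' (e+1) := by simp only [hS]; rw [Finset.sum_range_succ]
        rw [this]; ring
    have hT : ∀ i < d, S i = 0 := by
      apply ih (fun j => σ (h j) - h j)
      · intro c hc
        have hfx : σ (∑ j ∈ Finset.range d, algebraMap ℂ K (c j) * h j)
            = ∑ j ∈ Finset.range d, algebraMap ℂ K (c j) * h j := by
          rw [map_sum, ← sub_eq_zero, ← Finset.sum_sub_distrib, ← hc]
          apply Finset.sum_congr rfl
          intro j _
          rw [map_mul, hσc]; ring
        obtain ⟨c0, hc0⟩ := hfix _ hfx
        intro j hj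
        have := hind (fun j => if j = d then -c0 else c j) ?_ j (by omega)
        · simpa [show j ≠ d by omega] using this
        · rw [Finset.sum_range_succ]
          have : ∑ x ∈ Finset.range d, algebraMap ℂ K (if x = d then -c0 else c x) * f x
            = f d * ∑ j ∈ Finset.range d, algebraMap ℂ K (c j) * h j := by
            rw [Finset.mul_sum]
            apply Finset.sum_congr rfl
            intro j hj
            have : j ≠ d := by have := Finset.mem_range.1 hj; omega
            rw [if_neg this, hfh j]; ring
          rw [this, hc0]; simp; ring
      · intro j hj
        have h1 := hO1 j (by omega)
        rw [habel] at h1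
        have h2 : S d = 0 := hsum
        rw [h2, zero_mul, zero_sub, neg_eq_zero] at h1
        rw [← h1]
        apply Finset.sum_congr rfl
        intro i _
        rw [iterate_map_sub, Function.iterate_succ_apply]
    have hS0 : ∀ i < d + 1, S i = 0 := by
      intro i hi
      rcases Nat.lt_succ_iff_lt_or_eq.1 hi with h1 | h1
      · exact hT i h1
      · rw [h1]; exact hsum
    intro i hi
    have hOi : O' i = 0 := by
      cases i with
      | zero => have := hS0 0 hi; simpa [hS] using this
      | succ i =>
        have h1 := hS0 (i+1) hi
        have h2 := hS0 i (by omega)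
        simp only [hS] at h1 h2
        rw [Finset.sum_range_succ, h2, zero_add] at h1
        exact h1
    simp only [hO'] at hOi
    rcases mul_eq_zero.1 hOi with h1 | h1
    · exact h1
    · exact absurd h1 (hfi i)

end ZE
end


section
open Polynomial

namespace ZE

abbrev KK := FractionRing ℂ[X]
abbrev LL := FractionRing (PowerSeries ℂ)

theorem sh_inj (c : ℂ) : Function.Injective (Polynomial.compRingHom (X - C c : ℂ[X])) := by
  intro p q h
  simp only [coe_compRingHom_apply] at h
  have := congrArg (fun f => f.comp (X + C c)) h
  simpa [comp_assoc] using this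

/-- shift `t ↦ t - c` on `ℂ(t)`. -/
noncomputable def sg (c : ℂ) : KK →+* KK :=
  IsFractionRing.lift (K := KK) (g := (algebraMap ℂ[X] KK).comp (Polynomial.compRingHom (X - C c)))
    ((IsFractionRing.injective ℂ[X] KK).comp (sh_inj c))

theorem sg_alg (c : ℂ) (p : ℂ[X]) :
    sg c (algebraMap ℂ[X] KK p) = algebraMap ℂ[X] KK (p.comp (X - C c)) := by
  unfold sg
  rw [IsFractionRing.lift_algebraMap]
  simp

theorem sg_iter_alg (c : ℂ) (p : ℂ[X]) (i : ℕ) :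
    ((sg c)^[i]) (algebraMap ℂ[X] KK p) = algebraMap ℂ[X] KK (p.comp (X - C (i * c))) := by
  induction i generalizing p with
  | zero => simp
  | succ i ih =>
    rw [Function.iterate_succ_apply, sg_alg, ih, comp_assoc]
    congr 2
    simp
    ring

theorem sg_const (c x : ℂ) : sg c (algebraMap ℂ KK x) = algebraMap ℂ KK x := by
  rw [IsScalarTower.algebraMap_apply ℂ ℂ[X] KK, sg_alg]
  simp

theorem sg_fix (N : ℕ) (hN : 0 < N) (f : KK) (hf : sg (N:ℂ) f = f) :
    ∃ c : ℂ, f = algebraMap ℂ KK c := by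
  obtain ⟨p, q, hq, rfl⟩ := IsFractionRing.div_surjective (A := ℂ[X]) f
  have hq0 : q ≠ 0 := nonZeroDivisors.ne_zero hq
  have hinj := IsFractionRing.injective ℂ[X] KK
  have hqK : algebraMap ℂ[X] KK q ≠ 0 := by
    intro h; exact hq0 (hinj (by simpa using h))
  have hq1 : q.comp (X - C (N:ℂ)) ≠ 0 := by
    intro h; exact hq0 (sh_inj (N:ℂ) (by simpa using h))
  have hq1K : algebraMap ℂ[X] KK (q.comp (X - C (N:ℂ))) ≠ 0 := by
    intro h; exact hq1 (hinj (by simpa using h))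
  rw [map_div₀, sg_alg, sg_alg, div_eq_div_iff hq1K hqK, ← map_mul, ← map_mul] at hf
  have hpq := hinj hf
  -- choose a starting point
  have hfin : (q.roots.toFinset : Set ℂ).Finite := Finset.finite_toSet _
  have : ∃ k0 : ℕ, ∀ k : ℕ, k0 ≤ k → q.eval (-(N * k : ℂ)) ≠ 0 := by
    have hinj2 : Function.Injective (fun k : ℕ => (-(N * k : ℂ))) := by
      intro x y h
      have hN' : (N:ℂ) ≠ 0 := by exact_mod_cast hN.ne'
      simpa [hN'] using h
    have h3 := hfin.preimage (hinj2.injOn (s := (fun k : ℕ => (-(N * k : ℂ))) ⁻¹' _))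
    obtain ⟨b, hb⟩ := h3.bddAbove
    refine ⟨b+1, fun k hk h0 => ?_⟩
    have : k ≤ b := hb (by simp [hq0]; simpa using h0)
    omega
  obtain ⟨k0, hk0⟩ := this
  set c := p.eval (-(N * k0 : ℂ)) / q.eval (-(N * k0 : ℂ)) with hc
  have key : ∀ k : ℕ, p.eval (-(N * ((k0 + k : ℕ):ℂ))) = c * q.eval (-(N * ((k0 + k : ℕ):ℂ))) := by
    intro k
    induction k with
    | zero => simp only [hc, add_zero]; rw [div_mul_cancel₀ _ (hk0 k0 le_rfl)]
    | succ k ih =>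
      have h1 := congrArg (eval (-(N * ((k0 + k : ℕ):ℂ)))) hpq
      simp only [eval_mul, eval_comp, eval_sub, eval_X, eval_C] at h1
      have e1 : -(N * ((k0 + k : ℕ):ℂ)) - N = -(N * ((k0 + (k + 1) : ℕ):ℂ)) := by push_cast; ring
      rw [e1, ih] at h1
      have := hk0 (k0+k) (by omega)
      apply mul_right_cancel₀ this
      rw [h1]; ring
  have hpc : p = C c * q := by
    apply Polynomial.eq_of_infinite_eval_eq
    apply Set.infinite_of_injective_forall_mem (f := fun k : ℕ => (-(N * ((k0 + k : ℕ):ℂ))))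
    · intro x y h
      have hN' : (N:ℂ) ≠ 0 := by exact_mod_cast hN.ne'
      simpa [hN'] using h
    · intro k
      simp only [Set.mem_ofPred_eq, eval_mul, eval_C]
      exact key k
  refine ⟨c, ?_⟩
  rw [IsScalarTower.algebraMap_apply ℂ ℂ[X] KK, hpc, map_mul, mul_div_assoc, div_self hqK, mul_one]
  rfl

theorem casK (N : ℕ) (hN : 0 < N) (d : ℕ) (f : ℕ → KK)
    (hind : ∀ c : ℕ → ℂ, ∑ j ∈ Finset.range d, algebraMap ℂ KK (c j) * f j = 0 → ∀ j < d, c j = 0)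
    (O : ℕ → ℂ[X])
    (h : ∀ j < d, ∑ i ∈ Finset.range d, algebraMap ℂ[X] KK (O i) * ((sg (N:ℂ))^[i]) (f j) = 0) :
    ∀ i < d, O i = 0 := by
  intro i hi
  have := casorati (sg (N:ℂ)) (sg_const _) (sg_fix N hN) d f hind
    (fun i => algebraMap ℂ[X] KK (O i)) h i hi
  exact IsFractionRing.injective ℂ[X] KK (by simpa using this)

/-- expansion at `α`: polynomial `p(t) ↦ p(α + s)` as a power series. -/
noncomputable def exS (α : ℂ) : ℂ[X] →+* PowerSeries ℂ :=
  (Polynomial.coeToPowerSeries.ringHom).comp (Polynomial.compRingHom (X - C (-α)))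

theorem exS_inj (α : ℂ) : Function.Injective (exS α) := by
  intro p q h
  apply sh_inj (-α)
  apply Polynomial.coe_injective ℂ
  simpa [exS] using h

noncomputable def exK (α : ℂ) : KK →+* LL :=
  IsFractionRing.lift (K := KK) (g := (algebraMap (PowerSeries ℂ) LL).comp (exS α))
    ((IsFractionRing.injective (PowerSeries ℂ) LL).comp (exS_inj α))

theorem exK_alg (α : ℂ) (p : ℂ[X]) :
    exK α (algebraMap ℂ[X] KK p) = algebraMap (PowerSeries ℂ) LL (exS α p) := by
  unfold exK
  rw [IsFractionRing.lift_algebraMap]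
  simp

theorem exS_const (α : ℂ) (p : ℂ[X]) : PowerSeries.constantCoeff (exS α p) = p.eval α := by
  simp [exS]
  rw [Polynomial.coeff_zero_eq_eval_zero, eval_comp]
  simp

theorem exS_X (α : ℂ) : exS α X = PowerSeries.X + PowerSeries.C α := by
  simp [exS]

theorem exS_C (α c : ℂ) : exS α (C c) = PowerSeries.C c := by
  simp [exS]


/-- embedding `ℂ[t][x] → ℂ(t)⟦x⟧` -/
noncomputable def em : Polynomial ℂ[X] →+* PowerSeries KK :=
  (PowerSeries.map (algebraMap ℂ[X] KK)).comp (Polynomial.coeToPowerSeries.ringHom)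

theorem coeff_em (G : Polynomial ℂ[X]) (e : ℕ) :
    PowerSeries.coeff e (em G) = algebraMap ℂ[X] KK (G.coeff e) := by
  simp [em]

/-- embedding `ℂ[t][x] → ℂ⟦s⟧⟦x⟧`, `t = α + s`. -/
noncomputable def emS (α : ℂ) : Polynomial ℂ[X] →+* PowerSeries (PowerSeries ℂ) :=
  (PowerSeries.map (exS α)).comp (Polynomial.coeToPowerSeries.ringHom)

theorem coeff_emS (α : ℂ) (G : Polynomial ℂ[X]) (e : ℕ) :
    PowerSeries.coeff e (emS α G) = exS α (G.coeff e) := by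
  simp [emS]

theorem map_em (α : ℂ) (G : Polynomial ℂ[X]) :
    PowerSeries.map (exK α) (em G) = PowerSeries.map (algebraMap (PowerSeries ℂ) LL) (emS α G) := by
  ext e
  simp [coeff_em, coeff_emS, exK_alg]

theorem psunit {R : Type*} [CommRing R] (f : PowerSeries (PowerSeries ℂ))
    (h : PowerSeries.constantCoeff (PowerSeries.constantCoeff f) ≠ 0) : IsUnit f := by
  rw [PowerSeries.isUnit_iff_constantCoeff, PowerSeries.isUnit_iff_constantCoeff]
  exact isUnit_iff_ne_zero.2 h

theorem emS_cc (α : ℂ) (G : Polynomial ℂ[X]) :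
    PowerSeries.constantCoeff (PowerSeries.constantCoeff (emS α G)) = (G.coeff 0).eval α := by
  rw [← PowerSeries.coeff_zero_eq_constantCoeff_apply (φ := emS α G), coeff_emS, exS_const]

theorem reg_lemma (α : ℂ) (Φ : PowerSeries KK) (S G : Polynomial ℂ[X])
    (h : Φ * em S = em G) (hS : (S.coeff 0).eval α ≠ 0) (e : ℕ) :
    ∃ ρ : PowerSeries ℂ, exK α (PowerSeries.coeff e Φ) = algebraMap (PowerSeries ℂ) LL ρ := by
  have hu : IsUnit (emS α S) := psunit (R := ℂ) _ (by rwa [emS_cc])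
  obtain ⟨u, hu⟩ := hu
  set Ψ := emS α G * ↑u⁻¹ with hΨ
  have h1 : Ψ * emS α S = emS α G := by rw [hΨ, ← hu, mul_assoc, Units.inv_mul, mul_one]
  have h2 : PowerSeries.map (exK α) Φ = PowerSeries.map (algebraMap (PowerSeries ℂ) LL) Ψ := by
    have h3 := congrArg (PowerSeries.map (exK α)) h
    rw [map_mul, map_em, map_em, ← h1, map_mul] at h3
    have : IsUnit (PowerSeries.map (algebraMap (PowerSeries ℂ) LL) (emS α S)) := by
      rw [← hu]; exact u.isUnit.map _
    exact this.mul_right_cancel h3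
  refine ⟨PowerSeries.coeff e Ψ, ?_⟩
  have := congrArg (PowerSeries.coeff e) h2
  simpa using this

theorem pole_lemma (α : ℂ) (a : ℕ) (ha : 0 < a) (Φ : PowerSeries KK) (S G : Polynomial ℂ[X])
    (h : Φ * em (C (X - C α) - X) ^ a * em S = em G)
    (hS : (S.coeff 0).eval α ≠ 0) (hG : (G.coeff 0).eval α ≠ 0) (e : ℕ) :
    ∃ ρ : PowerSeries ℂ, PowerSeries.constantCoeff ρ ≠ 0 ∧
      exK α (PowerSeries.coeff e Φ) * (algebraMap (PowerSeries ℂ) LL PowerSeries.X) ^ (a + e)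
        = algebraMap (PowerSeries ℂ) LL ρ := by
  set ι := algebraMap (PowerSeries ℂ) LL with hι
  set S' := PowerSeries.rescale (PowerSeries.X : PowerSeries ℂ) (emS α S) with hS'
  set G' := PowerSeries.rescale (PowerSeries.X : PowerSeries ℂ) (emS α G) with hG'
  have hcc : ∀ f : PowerSeries (PowerSeries ℂ),
      PowerSeries.constantCoeff (PowerSeries.rescale (PowerSeries.X : PowerSeries ℂ) f)
        = PowerSeries.constantCoeff f := by
    intro f
    rw [← PowerSeries.coeff_zero_eq_constantCoeff_apply, PowerSeries.coeff_rescale]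
    simp
  have hmr : ∀ f : PowerSeries (PowerSeries ℂ),
      PowerSeries.map ι (PowerSeries.rescale (PowerSeries.X : PowerSeries ℂ) f)
        = PowerSeries.rescale (ι PowerSeries.X) (PowerSeries.map ι f) := by
    intro f; ext e; simp [PowerSeries.coeff_rescale]
  have hres : ∀ f : PowerSeries (PowerSeries ℂ),
      PowerSeries.map (PowerSeries.constantCoeff (R := ℂ))
        (PowerSeries.rescale (PowerSeries.X : PowerSeries ℂ) f)
        = PowerSeries.C (PowerSeries.constantCoeff (PowerSeries.constantCoeff f)) := by
    intro f; ext e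
    simp only [PowerSeries.coeff_map, PowerSeries.coeff_rescale, map_mul, map_pow,
      PowerSeries.constantCoeff_X, PowerSeries.coeff_C]
    rcases Nat.eq_zero_or_pos e with rfl | he
    · simp
    · simp [he.ne']
  have hu : IsUnit ((1 - PowerSeries.X) ^ a * S') := psunit (R := ℂ) _ (by
    simp [hS', hcc]
    rwa [emS_cc])
  obtain ⟨u, hu⟩ := hu
  obtain ⟨Ψ, h1⟩ : ∃ Ψ, Ψ * ((1 - PowerSeries.X) ^ a * S') = G' :=
    ⟨G' * ↑u⁻¹, by rw [← hu, mul_assoc, Units.inv_mul, mul_one]⟩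
  have hXα : PowerSeries.rescale (ι PowerSeries.X) (PowerSeries.map (exK α) (em (C (X - C α) - X)))
      = PowerSeries.C (ι PowerSeries.X) * (PowerSeries.map ι (1 - PowerSeries.X)) := by
    rw [map_em, ← hmr]
    have : emS α (C (X - C α) - X) = PowerSeries.C (PowerSeries.X) - PowerSeries.X := by
      simp [emS, exS_X, exS_C]
    rw [this]
    have : PowerSeries.rescale (PowerSeries.X : PowerSeries ℂ) (PowerSeries.C (PowerSeries.X) - PowerSeries.X)
       = PowerSeries.C (PowerSeries.X) * (1 - PowerSeries.X) := by
      rw [map_sub, PowerSeries.rescale_X, mul_sub, mul_one]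
      congr 1
      ext e : 1
      rw [PowerSeries.coeff_rescale, PowerSeries.coeff_C]
      split_ifs with h <;> simp [h]
    rw [this, map_mul, PowerSeries.map_C]
  have h2 : PowerSeries.rescale (ι PowerSeries.X) (PowerSeries.map (exK α) Φ)
      * PowerSeries.C (ι PowerSeries.X) ^ a = PowerSeries.map ι Ψ := by
    have h3 := congrArg (fun f => PowerSeries.rescale (ι PowerSeries.X) (PowerSeries.map (exK α) f)) h
    simp only [map_mul, map_pow] at h3
    rw [hXα, map_em, map_em, ← hmr, ← hmr] at h3
    change _ * PowerSeries.map ι S' = PowerSeries.map ι G' at h3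
    rw [← h1, map_mul, map_mul, map_pow] at h3
    have : IsUnit (PowerSeries.map ι ((1 - PowerSeries.X) ^ a * S')) := by
      rw [← hu]; exact u.isUnit.map _
    apply this.mul_right_cancel
    rw [map_mul, map_pow, ← h3]; ring
  refine ⟨PowerSeries.coeff e Ψ, ?_, ?_⟩
  · have h4 := congrArg (PowerSeries.map (PowerSeries.constantCoeff (R := ℂ))) h1
    rw [map_mul, map_mul, hS', hG', hres, hres, emS_cc, emS_cc] at h4
    have h5 : PowerSeries.map (PowerSeries.constantCoeff (R := ℂ)) ((1 - PowerSeries.X) ^ a)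
       = (1 - PowerSeries.X : PowerSeries ℂ) ^ a := by simp
    rw [h5] at h4
    have h6 := PowerSeries.invOneSubPow_inv_eq_one_sub_pow ℂ a
    have h7 : (↑(PowerSeries.invOneSubPow ℂ a) : PowerSeries ℂ) * (1 - PowerSeries.X) ^ a = 1 := by
      rw [← h6]; simp
    have h8 : PowerSeries.map (PowerSeries.constantCoeff (R := ℂ)) Ψ
       * PowerSeries.C ((S.coeff 0).eval α) =
        (↑(PowerSeries.invOneSubPow ℂ a) : PowerSeries ℂ) * PowerSeries.C ((G.coeff 0).eval α) := by
      rw [← h4]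
      linear_combination (- PowerSeries.map (PowerSeries.constantCoeff (R := ℂ)) Ψ
       * PowerSeries.C ((S.coeff 0).eval α)) * h7
    have h9 := congrArg (PowerSeries.coeff e) h8
    rw [PowerSeries.coeff_mul_C, PowerSeries.coeff_mul_C, PowerSeries.coeff_map] at h9
    intro h0
    rw [h0, zero_mul] at h9
    have : PowerSeries.coeff e (↑(PowerSeries.invOneSubPow ℂ a) : PowerSeries ℂ) ≠ 0 := by
      obtain ⟨b, rfl⟩ : ∃ b, a = b + 1 := ⟨a - 1, by omega⟩
      rw [PowerSeries.invOneSubPow_val_succ_eq_mk_add_choose]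
      simp only [PowerSeries.coeff_mk]
      have : 0 < (b + e).choose b := Nat.choose_pos (by omega)
      exact_mod_cast this.ne'
    exact (mul_ne_zero this hG) h9.symm
  · have h4 := congrArg (PowerSeries.coeff e) h2
    rw [← map_pow, PowerSeries.coeff_mul_C, PowerSeries.coeff_rescale, PowerSeries.coeff_map,
      PowerSeries.coeff_map] at h4
    rw [← h4]; ring

end ZE
end


section
open Polynomial

namespace ZE

/-- Lemma A: a polynomial linear system with fewer equations than unknowns. -/
theorem lemmaA {ι κ : Type*} [Fintype ι] [Fintype κ]
    (hcard : Fintype.card ι < Fintype.card κ) (δ : ℕ) (G : ι → κ → ℂ[X])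
    (hG : ∀ e i, (G e i).natDegree ≤ δ) :
    ∃ c : κ → ℂ[X], (∃ i, c i ≠ 0) ∧ (∀ i, (c i).natDegree ≤ Fintype.card ι * δ) ∧
      ∀ e, ∑ i, G e i * c i = 0 := by
  classical
  set D := Fintype.card ι * δ with hD
  let mk : (κ × Fin (D + 1) → ℂ) → κ → ℂ[X] := fun c i => ∑ j : Fin (D+1), C (c (i, j)) * X ^ (j:ℕ)
  let f : (κ × Fin (D + 1) → ℂ) →ₗ[ℂ] (ι × Fin (D + δ + 1) → ℂ) :=
    { toFun := fun c ek => (∑ i, G ek.1 i * mk c i).coeff (ek.2 : ℕ)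
      map_add' := by
        intro x y
        ext ek
        simp only [mk, Pi.add_apply, map_add, add_mul, Finset.sum_add_distrib, mul_add, coeff_add]
      map_smul' := by
        intro r x
        ext ek
        have : ∀ i, mk (r • x) i = C r * mk x i := by
          intro i
          simp only [mk, Pi.smul_apply, smul_eq_mul, map_mul, Finset.mul_sum, mul_assoc]
        simp only [this, Pi.smul_apply, smul_eq_mul, RingHom.id_apply]
        rw [← coeff_C_mul, Finset.mul_sum]
        congr 1
        apply Finset.sum_congr rfl
        intro i _; ring }
  have hlt : Module.finrank ℂ (ι × Fin (D + δ + 1) → ℂ) < Module.finrank ℂ (κ × Fin (D + 1) → ℂ) := by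
    simp only [Module.finrank_fintype_fun_eq_card, Fintype.card_prod, Fintype.card_fin]
    have : (Fintype.card ι + 1) * (D + 1) ≤ Fintype.card κ * (D+1) := Nat.mul_le_mul_right _ hcard
    have e1 : Fintype.card ι * (D + δ + 1) = Fintype.card ι * (D+1) + D := by rw [hD]; ring
    have e2 : (Fintype.card ι + 1) * (D + 1) = Fintype.card ι * (D+1) + D + 1 := by ring
    omega
  have hker := LinearMap.ker_ne_bot_of_finrank_lt (f := f) hlt
  obtain ⟨c, hc, hc0⟩ := (Submodule.ne_bot_iff _).1 hker
  have hcoef : ∀ i (j : Fin (D+1)), (mk c i).coeff j = c (i, j) := by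
    intro i j
    simp only [mk, finsetSum_coeff, coeff_C_mul, coeff_X_pow]
    rw [Finset.sum_eq_single j]
    · simp
    · intro b _ hb
      rw [if_neg (fun h => hb (Fin.ext h.symm)), mul_zero]
    · simp
  have hdeg : ∀ i, (mk c i).natDegree ≤ D := by
    intro i
    apply natDegree_sum_le_of_forall_le
    intro j _
    refine (natDegree_C_mul_X_pow_le _ _).trans ?_
    have := j.2; omega
  refine ⟨mk c, ?_, hdeg, ?_⟩
  · by_contra! hcon
    apply hc0
    ext ⟨i, j⟩
    rw [← hcoef, hcon i]; simp
  · intro e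
    have hd : (∑ i, G e i * mk c i).natDegree ≤ D + δ := by
      apply natDegree_sum_le_of_forall_le
      intro i _
      refine natDegree_mul_le.trans ?_
      have := hG e i; have := hdeg i; omega
    ext k
    rw [coeff_zero]
    by_cases hk : k < D + δ + 1
    · have := congrFun (LinearMap.mem_ker.1 hc) (e, ⟨k, hk⟩)
      exact this
    · exact coeff_eq_zero_of_natDegree_lt (by omega)

end ZE
end


section
open Polynomial

namespace ZE

/-- The abstract data of the recurrence. -/
structure Setup (a N m q Kb : ℕ) (A B Nm : ℂ[X]) (g : ℤ → ℂ[X]) : Prop where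
  ha : 0 < a
  hN : 0 < N
  degA : A.natDegree ≤ q
  degB : B.natDegree ≤ q
  hA0 : A ≠ 0
  hB0 : B ≠ 0
  hKm : Kb ≤ m + 1
  g_deg : ∀ h, (g h).natDegree < a
  g_neg : ∀ h, h < 0 → g h = 0
  g_big : ∀ h, (m : ℤ) < h → g h = 0
  g_ne : ∀ h : ℤ, 0 ≤ h → h ≤ m → (g h).coeff 0 ≠ 0
  P1 : ∀ h : ℤ, (X : ℂ[X]) ^ a ∣ A.comp (C ((N : ℂ) * (h - 1 : ℤ)) - X) * g (h - 1)
        - B.comp (C ((N : ℂ) * h) - X) * g h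
  A_ne : ∀ k : ℤ, -(Kb : ℤ) ≤ k → k ≤ m - 1 → A.eval ((N : ℂ) * k) ≠ 0
  B_ne : ∀ k : ℤ, 1 ≤ k → k ≤ m + Kb → B.eval ((N : ℂ) * k) ≠ 0
  recF : A.comp (X - C (N : ℂ)) * Nm.comp (X - C (N : ℂ)) *
      (∏ h ∈ Finset.range (m + 1), (X - C ((N : ℂ) * h)) ^ a) =
      B * Nm * (∏ h ∈ Finset.range (m + 1), (X - C ((N : ℂ) * h)) ^ a).comp (X - C (N : ℂ))
  Nm_ne : ∀ h : ℕ, h ≤ m → Nm.eval ((N : ℂ) * h) ≠ 0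

noncomputable def num (A B : ℂ[X]) (N K i : ℕ) : ℂ[X] :=
  (∏ k ∈ Finset.range i, B.comp (X - C ((N : ℂ) * k))) *
    ∏ k ∈ Finset.Ico i K, A.comp (X - C ((N : ℂ) * (k + 1)))

theorem num_succ (A B : ℂ[X]) (N K i : ℕ) (hi : i < K) :
    num A B N K (i + 1) * A.comp (X - C ((N : ℂ) * (i + 1)))
      = num A B N K i * B.comp (X - C ((N : ℂ) * i)) := by
  unfold num
  rw [Finset.prod_range_succ, Finset.prod_eq_prod_Ico_succ_bot hi]
  ring

theorem natDegree_comp_sub (p : ℂ[X]) (c : ℂ) : (p.comp (X - C c)).natDegree = p.natDegree := by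
  rw [natDegree_comp]; simp

theorem num_deg {A B : ℂ[X]} {q : ℕ} (hA : A.natDegree ≤ q) (hB : B.natDegree ≤ q) (N K i : ℕ)
    (hi : i ≤ K) : (num A B N K i).natDegree ≤ K * q := by
  unfold num
  refine natDegree_mul_le.trans ?_
  have h1 : (∏ k ∈ Finset.range i, B.comp (X - C ((N : ℂ) * k))).natDegree ≤ i * q := by
    refine (natDegree_prod_le _ _).trans ?_
    refine (Finset.sum_le_card_nsmul _ _ q ?_).trans (by simp)
    intro k _; simp only [natDegree_comp_sub]; exact hB
  have h2 : (∏ k ∈ Finset.Ico i K, A.comp (X - C ((N : ℂ) * (k + 1)))).natDegree ≤ (K - i) * q := by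
    refine (natDegree_prod_le _ _).trans ?_
    refine (Finset.sum_le_card_nsmul _ _ q ?_).trans (by simp)
    intro k _; simp only [natDegree_comp_sub]; exact hA
  have : K * q = i * q + (K - i) * q := by rw [← add_mul]; congr 1; omega
  omega

variable {a N m q Kb : ℕ} {A B Nm : ℂ[X]} {g : ℤ → ℂ[X]}

theorem comp_shift (p : ℂ[X]) (c d : ℂ) :
    (p.comp (X - C c)).comp (C d - X) = p.comp (C (d - c) - X) := by
  rw [comp_assoc]; congr 1; simp; ring

theorem step_chain (hS : Setup a N m q Kb A B Nm g) (M : ℤ) (i : ℕ) :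
    ∀ κ : ℕ, i ≤ κ → (X : ℂ[X]) ^ a ∣
      (∏ k ∈ Finset.Ico i κ, A.comp (X - C ((N : ℂ) * (k + 1)))).comp (C ((N:ℂ) * M) - X) * g (M - κ)
      - (∏ k ∈ Finset.Ico i κ, B.comp (X - C ((N : ℂ) * k))).comp (C ((N:ℂ) * M) - X) * g (M - i) := by
  intro κ hκ
  induction κ, hκ using Nat.le_induction with
  | base => simp
  | succ κ hκ ih =>
    rw [Finset.prod_Ico_succ_top hκ, Finset.prod_Ico_succ_top hκ, mul_comp, mul_comp,
      comp_shift, comp_shift]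
    have h1 := hS.P1 (M - κ)
    have e1 : (N:ℂ) * M - N * (κ + 1) = (N:ℂ) * ((M - κ - 1 : ℤ)) := by push_cast; ring
    have e2 : (N:ℂ) * M - N * κ = (N:ℂ) * ((M - κ : ℤ)) := by push_cast; ring
    have e3 : M - ((κ + 1 : ℕ) : ℤ) = M - κ - 1 := by push_cast; ring
    rw [e1, e2, e3]
    have := (h1.mul_left ((∏ k ∈ Finset.Ico i κ, A.comp (X - C ((N : ℂ) * (k + 1)))).comp
      (C ((N:ℂ) * M) - X))).add (ih.mul_left (B.comp (C ((N : ℂ) * (M - κ : ℤ)) - X)))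
    refine this.trans (dvd_of_eq ?_)
    ring

theorem exchange_le (hS : Setup a N m q Kb A B Nm g) (K : ℕ) (M : ℤ) (i κ : ℕ)
    (hi : i ≤ κ) (hκ : κ ≤ K) : (X : ℂ[X]) ^ a ∣
      (num A B N K i).comp (C ((N:ℂ) * M) - X) * g (M - κ)
      - (num A B N K κ).comp (C ((N:ℂ) * M) - X) * g (M - i) := by
  have h1 := step_chain hS M i κ hi
  unfold num
  rw [← Finset.prod_Ico_consecutive _ hi hκ, Finset.range_eq_Ico, Finset.range_eq_Ico,
    ← Finset.prod_Ico_consecutive _ (Nat.zero_le i) hi]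
  simp only [mul_comp]
  set x1 := (∏ k ∈ Finset.Ico 0 i, B.comp (X - C ((N : ℂ) * k))).comp (C ((N:ℂ) * M) - X)
  set x2 := (∏ k ∈ Finset.Ico κ K, A.comp (X - C ((N : ℂ) * (k + 1)))).comp (C ((N:ℂ) * M) - X)
  refine (h1.mul_left (x1 * x2)).trans (dvd_of_eq ?_)
  ring

theorem exchange (hS : Setup a N m q Kb A B Nm g) (K : ℕ) (M : ℤ) (i κ : ℕ)
    (hi : i ≤ K) (hκ : κ ≤ K) : (X : ℂ[X]) ^ a ∣
      (num A B N K i).comp (C ((N:ℂ) * M) - X) * g (M - κ)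
      - (num A B N K κ).comp (C ((N:ℂ) * M) - X) * g (M - i) := by
  rcases le_total i κ with h | h
  · exact exchange_le hS K M i κ h hκ
  · have := exchange_le hS K M κ i h hi
    rw [← dvd_neg]
    refine this.trans (dvd_of_eq ?_)
    ring

theorem exchange_sum (hS : Setup a N m q Kb A B Nm g) (K : ℕ) (M : ℤ) (i : ℕ) (hi : i ≤ K)
    {ι : Type*} (s : Finset ι) (κ : ι → ℕ) (hκ : ∀ τ ∈ s, κ τ ≤ K) (c : ι → ℂ[X]) :
    (X : ℂ[X]) ^ a ∣ (num A B N K i).comp (C ((N:ℂ) * M) - X) * (∑ τ ∈ s, c τ * g (M - κ τ))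
      - (∑ τ ∈ s, c τ * (num A B N K (κ τ)).comp (C ((N:ℂ) * M) - X)) * g (M - i) := by
  rw [Finset.mul_sum, Finset.sum_mul, ← Finset.sum_sub_distrib]
  apply Finset.dvd_sum
  intro τ hτ
  refine ((exchange hS K M i (κ τ) hi (hκ τ hτ)).mul_left (c τ)).trans (dvd_of_eq ?_)
  ring

theorem num_zero_eval (hS : Setup a N m q Kb A B Nm g) (K : ℕ) (hK : K ≤ Kb) (M : ℤ)
    (h0 : 0 ≤ M) (h1 : M ≤ m) : (num A B N K 0).eval ((N:ℂ) * M) ≠ 0 := by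
  unfold num
  simp only [Finset.range_zero, Finset.prod_empty, one_mul, eval_prod, eval_comp, eval_sub, eval_X,
    eval_C]
  rw [Finset.prod_ne_zero_iff]
  intro k hk
  have hk := (Finset.mem_Ico.1 hk).2
  have := hS.A_ne (M - (k+1)) (by omega) (by omega)
  have e1 : (N:ℂ) * M - N * (k + 1) = (N:ℂ) * ((M - (k + 1) : ℤ)) := by push_cast; ring
  rw [e1]; exact this

theorem num_top_eval (hS : Setup a N m q Kb A B Nm g) (K : ℕ) (hK : K ≤ Kb) (M : ℤ)
    (h0 : K ≤ M) (h1 : M ≤ m + K) : (num A B N K K).eval ((N:ℂ) * M) ≠ 0 := by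
  unfold num
  simp only [Finset.Ico_self, Finset.prod_empty, mul_one, eval_prod, eval_comp, eval_sub, eval_X,
    eval_C]
  rw [Finset.prod_ne_zero_iff]
  intro k hk
  have hk := Finset.mem_range.1 hk
  have := hS.B_ne (M - k) (by omega) (by omega)
  have e1 : (N:ℂ) * M - N * k = (N:ℂ) * ((M - k : ℤ)) := by push_cast; ring
  rw [e1]; exact this

theorem transfer (hS : Setup a N m q Kb A B Nm g) (K : ℕ) (hK : K ≤ Kb) (M : ℤ)
    {ι : Type*} (s : Finset ι) (κ : ι → ℕ) (hκ : ∀ τ ∈ s, κ τ ≤ K) (c : ι → ℂ[X]) (e : ℕ)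
    (he : e ≤ a)
    (h : (X : ℂ[X]) ^ e ∣ ∑ τ ∈ s, c τ * (num A B N K (κ τ)).comp (C ((N:ℂ) * M) - X)) :
    (X : ℂ[X]) ^ e ∣ ∑ τ ∈ s, c τ * g (M - κ τ) := by
  have key : ∀ i ≤ K, (num A B N K i).eval ((N:ℂ) * M) ≠ 0 →
      (X : ℂ[X]) ^ e ∣ ∑ τ ∈ s, c τ * g (M - κ τ) := by
    intro i hi hne
    have h1 := (pow_dvd_pow X he).trans (exchange_sum hS K M i hi s κ hκ c)
    have h2 := (dvd_sub_left (h.mul_right (g (M - i)))).1 h1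
    refine Prime.pow_dvd_of_dvd_mul_left prime_X e ?_ h2
    rw [X_dvd_iff, coeff_zero_eq_eval_zero, eval_comp]
    simpa using hne
  by_cases hM0 : M < 0
  · rw [Finset.sum_eq_zero]
    · exact dvd_zero _
    · intro τ hτ; rw [hS.g_neg _ (by omega), mul_zero]
  by_cases hM1 : M ≤ m
  · exact key 0 (Nat.zero_le _) (num_zero_eval hS K hK M (by omega) hM1)
  by_cases hM2 : M ≤ m + K
  · have := hS.hKm
    exact key K le_rfl (num_top_eval hS K hK M (by omega) hM2)
  · rw [Finset.sum_eq_zero]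
    · exact dvd_zero _
    · intro τ hτ
      have := hκ τ hτ
      rw [hS.g_big _ (by omega), mul_zero]

end ZE
end


section
open Polynomial

namespace ZE

/-- `p(t) ↦ p(t - l - y)` in `ℂ[t][y]`. -/
noncomputable def bi (l : ℂ) : ℂ[X] →+* Polynomial ℂ[X] :=
  eval₂RingHom ((C : ℂ[X] →+* Polynomial ℂ[X]).comp (C : ℂ →+* ℂ[X])) (C (X - C l) - X)

theorem bi_apply (l : ℂ) (p : ℂ[X]) : bi l p =
    p.eval₂ ((C : ℂ[X] →+* Polynomial ℂ[X]).comp (C : ℂ →+* ℂ[X])) (C (X - C l) - X) := rfl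

theorem bi_coeff_zero (l : ℂ) (p : ℂ[X]) : (bi l p).coeff 0 = p.comp (X - C l) := by
  rw [coeff_zero_eq_eval_zero, bi_apply, ← coe_evalRingHom, hom_eval₂]
  simp only [comp, coe_evalRingHom, eval_sub, eval_C, eval_X, sub_zero]
  congr 1
  ext x; simp

theorem pow_coeff_deg (l : ℂ) (k : ℕ) : ∀ e : ℕ,
    (((C (X - C l) - X : Polynomial ℂ[X]) ^ k).coeff e).natDegree ≤ k := by
  induction k with
  | zero => intro e; simp only [pow_zero, coeff_one]; split_ifs <;> simp
  | succ k ih =>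
    intro e
    rw [pow_succ, mul_sub, coeff_sub, coeff_mul_C]
    refine (natDegree_sub_le _ _).trans (max_le ?_ ?_)
    · refine natDegree_mul_le.trans ?_
      have := ih e
      have h2 : (X - C l : ℂ[X]).natDegree ≤ 1 := by simp
      omega
    · cases e with
      | zero => simp
      | succ e => rw [coeff_mul_X]; exact (ih e).trans (by omega)

theorem bi_coeff_deg (l : ℂ) (p : ℂ[X]) (e : ℕ) : ((bi l p).coeff e).natDegree ≤ p.natDegree := by
  rw [bi_apply, eval₂_eq_sum_range, finsetSum_coeff]
  apply natDegree_sum_le_of_forall_le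
  intro i hi
  rw [RingHom.comp_apply, coeff_C_mul]
  refine (natDegree_C_mul_le _ _).trans ?_
  refine (pow_coeff_deg l i e).trans ?_
  have := Finset.mem_range.1 hi; omega

/-- substitution `t ↦ u`, `y ↦ v`. -/
noncomputable def sub2 (u v : ℂ[X]) : Polynomial ℂ[X] →+* ℂ[X] :=
  eval₂RingHom (compRingHom u) v

theorem sub2_C (u v p : ℂ[X]) : sub2 u v (C p) = p.comp u := by
  simp [sub2]

theorem sub2_X (u v : ℂ[X]) : sub2 u v X = v := by
  simp [sub2]

theorem sub2_bi (u v : ℂ[X]) (l : ℂ) (p : ℂ[X]) : sub2 u v (bi l p) = p.comp (u - C l - v) := by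
  rw [bi_apply, hom_eval₂, comp]
  congr 1
  · ext x; simp [sub2]
  · simp [sub2]

theorem comp_sub_ne {p : ℂ[X]} (hp : p ≠ 0) (c : ℂ) : p.comp (X - C c) ≠ 0 := by
  intro h
  apply hp
  apply sh_inj c
  rw [coe_compRingHom_apply, coe_compRingHom_apply, h, zero_comp]

/-- the composed operator coefficients. -/
noncomputable def opO (A B : ℂ[X]) (N : ℕ) (c : ℕ → ℂ[X]) : ℕ → ℂ[X]
  | 0 => - (c 0 * B)
  | i + 1 => c i * A.comp (X - C ((N:ℂ) * (i + 1))) - c (i + 1) * B.comp (X - C ((N:ℂ) * (i + 1)))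

theorem opO_sum (A B : ℂ[X]) (N : ℕ) (c : ℕ → ℂ[X]) {S : Type*} [CommRing S] (ρ : ℂ[X] →+* S)
    (F : ℕ → S) (a : ℕ) :
    ∑ i ∈ Finset.range (a + 1), ρ (opO A B N c i) * F i =
      ∑ i ∈ Finset.range a, ρ (c i) * (ρ (A.comp (X - C ((N:ℂ) * (i + 1)))) * F (i+1)
        - ρ (B.comp (X - C ((N:ℂ) * i))) * F i)
      - ρ (c a) * ρ (B.comp (X - C ((N:ℂ) * a))) * F a := by
  induction a with
  | zero => simp [opO]
  | succ a ih =>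
    rw [Finset.sum_range_succ, ih, Finset.sum_range_succ (n := a)]
    simp only [opO, map_sub, map_mul]
    push_cast
    ring

theorem step1 (a N q : ℕ) (ha : 0 < a) (A B : ℂ[X]) (hA0 : A ≠ 0)
    (hA : A.natDegree ≤ q) (hB : B.natDegree ≤ q) :
    ∃ c : ℕ → ℂ[X], (∃ i ≤ a, opO A B N c i ≠ 0) ∧
      (∀ i, (c i).natDegree ≤ (a - 1) * (q + a * q)) ∧ (∀ i, a ≤ i → c i = 0) ∧
      (X : Polynomial ℂ[X]) ^ a ∣ ∑ i ∈ Finset.range (a + 1),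
        C (opO A B N c i) * bi 0 (num A B N a i) ∧
      ∑ i ∈ Finset.range (a + 1), opO A B N c i * num A B N a i = 0 := by
  set E : ℕ → Polynomial ℂ[X] := fun i =>
    C (A.comp (X - C ((N:ℂ) * (i + 1)))) * bi 0 (num A B N a (i+1))
      - C (B.comp (X - C ((N:ℂ) * i))) * bi 0 (num A B N a i) with hE
  have hEd : ∀ i < a, ∀ e, ((E i).coeff e).natDegree ≤ q + a * q := by
    intro i hi e
    simp only [hE, coeff_sub, coeff_C_mul]
    refine (natDegree_sub_le _ _).trans (max_le ?_ ?_)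
    · refine natDegree_mul_le.trans (Nat.add_le_add ?_ ?_)
      · rw [natDegree_comp_sub]; exact hA
      · exact (bi_coeff_deg _ _ _).trans (num_deg hA hB N a (i+1) (by omega))
    · refine natDegree_mul_le.trans (Nat.add_le_add ?_ ?_)
      · rw [natDegree_comp_sub]; exact hB
      · exact (bi_coeff_deg _ _ _).trans (num_deg hA hB N a i (by omega))
  obtain ⟨c, ⟨i0, hi0⟩, hcd, hc⟩ := lemmaA (ι := Fin (a-1)) (κ := Fin a) (by simp; omega)
    (q + a * q) (fun e i => (E i).coeff (e + 1)) (fun e i => hEd i i.2 _)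
  simp only [Fintype.card_fin] at hcd
  set c' : ℕ → ℂ[X] := fun i => if h : i < a then c ⟨i, h⟩ else 0 with hc'
  have hbig : ∀ i, a ≤ i → c' i = 0 := by
    intro i hi; simp [hc', show ¬ i < a by omega]
  have hsum : ∀ F : ℕ → ℂ[X], ∑ i : Fin a, F i * c i = ∑ i ∈ Finset.range a, F i * c' i := by
    intro F
    rw [Finset.sum_range]
    apply Finset.sum_congr rfl
    intro i _
    simp [hc']
  refine ⟨c', ?_, ?_, hbig, ?_, ?_⟩
  · -- top nonzero
    classical
    have hne : c' i0 ≠ 0 := by simpa [hc'] using hi0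
    set i1 := Nat.findGreatest (fun i => c' i ≠ 0) a with hi1
    have h1 : c' i1 ≠ 0 := Nat.findGreatest_spec (P := fun i => c' i ≠ 0) (n := a)
      (m := (i0 : ℕ)) (by have := i0.2; omega) hne
    have h1a : i1 < a := by
      by_contra hcon; exact h1 (hbig _ (by omega))
    have h2 : c' (i1 + 1) = 0 := by
      by_contra hcon
      by_cases hle : i1 + 1 ≤ a
      · have := Nat.le_findGreatest (P := fun i => c' i ≠ 0) hle hcon
        omega
      · exact hcon (hbig _ (by omega))
    refine ⟨i1 + 1, by omega, ?_⟩
    simp only [opO, h2, zero_mul, sub_zero]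
    refine mul_ne_zero h1 ?_
    exact comp_sub_ne hA0 _
  · intro i
    simp only [hc']
    split_ifs with h
    · exact hcd _
    · simp
  · rw [opO_sum A B N c' (C : ℂ[X] →+* Polynomial ℂ[X])]
    rw [hbig a le_rfl]
    simp only [map_zero, zero_mul, sub_zero]
    rw [X_pow_dvd_iff]
    intro d hd
    rw [finsetSum_coeff]
    change ∑ i ∈ Finset.range a, (C (c' i) * E i).coeff d = 0
    simp only [coeff_C_mul]
    cases d with
    | zero =>
      apply Finset.sum_eq_zero
      intro i hi
      have hi := Finset.mem_range.1 hi
      simp only [hE, coeff_sub, coeff_C_mul, bi_coeff_zero, map_zero, sub_zero, comp_X]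
      rw [mul_comm (A.comp _), num_succ A B N a i hi]; ring
    | succ d =>
      have := hc ⟨d, by omega⟩
      rw [hsum (fun i => (E i).coeff (d+1))] at this
      rw [← this]
      apply Finset.sum_congr rfl
      intro i _; ring
  · have := opO_sum A B N c' (RingHom.id ℂ[X]) (num A B N a) a
    simp only [RingHom.id_apply] at this
    rw [this, hbig a le_rfl]
    simp only [zero_mul, sub_zero]
    apply Finset.sum_eq_zero
    intro i hi
    have hi := Finset.mem_range.1 hi
    rw [mul_comm (A.comp _), num_succ A B N a i hi]; ring

end ZE
end


section
open Polynomial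

namespace ZE

noncomputable def Xl (N : ℕ) (lam : ℂ) (l : ℕ) : ℂ := N * l + lam
noncomputable def tM (N : ℕ) (lam : ℂ) (M : ℤ) : ℂ := N * M + lam
noncomputable def opP (a N : ℕ) (lam : ℂ) (O : ℕ → ℂ[X]) (f : ℤ → ℂ) (M : ℤ) : ℂ :=
  ∑ i ∈ Finset.range (a + 1), (O i).eval (tM N lam M) * f (M - i)
noncomputable def opd (δ : ℕ) (f : ℤ → ℂ) (M : ℤ) : ℂ :=
  ∑ i ∈ Finset.range (δ + 1), ((-1) ^ i * (δ.choose i : ℂ)) * f (M - i)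
noncomputable def yS (a N : ℕ) (lam : ℂ) (gb : ℤ → ℂ[X]) (M : ℤ) : ℂ :=
  ∑ l ∈ Finset.range (M + 1).toNat, ((Xl N lam l) ^ a)⁻¹ * (gb (M - l)).eval (Xl N lam l)

theorem yS_eq (a N : ℕ) (lam : ℂ) (gb : ℤ → ℂ[X]) (hneg : ∀ h, h < 0 → gb h = 0) (M : ℤ) (L : ℕ)
    (hL : M + 1 ≤ L) : yS a N lam gb M =
      ∑ l ∈ Finset.range L, ((Xl N lam l) ^ a)⁻¹ * (gb (M - l)).eval (Xl N lam l) := by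
  unfold yS
  apply Finset.sum_subset
  · intro l hl; simp only [Finset.mem_range] at *; omega
  · intro l _ hl
    simp only [Finset.mem_range] at hl
    rw [hneg _ (by omega)]; simp

theorem findiff (P : ℂ[X]) (δ : ℕ) (h : P.natDegree < δ) (x : ℂ) (N : ℕ) :
    ∑ i ∈ Finset.range (δ + 1), ((-1) ^ i * (δ.choose i : ℂ)) * P.eval (x - N * i) = 0 := by
  set R : ℂ[X] := P.comp (C x - C (N:ℂ) * X) with hR
  have hRd : R.natDegree < δ := by
    refine lt_of_le_of_lt natDegree_comp_le ?_
    have : (C x - C (N:ℂ) * X).natDegree ≤ 1 := by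
      refine (natDegree_sub_le _ _).trans (max_le (by simp) ?_)
      exact (natDegree_C_mul_le _ _).trans natDegree_X_le
    calc _ ≤ P.natDegree * 1 := Nat.mul_le_mul_left _ this
      _ < δ := by omega
  have h1 := congrFun (Polynomial.fwdDiff_iter_eq_zero_of_degree_lt hRd) 0
  rw [fwdDiff_iter_eq_sum_shift] at h1
  simp only [Pi.zero_apply] at h1
  have h2 : ((-1:ℂ)^δ) * ∑ i ∈ Finset.range (δ + 1), ((-1:ℂ) ^ i * (δ.choose i : ℂ)) * P.eval (x - N * i) = 0 := by
    rw [← h1, Finset.mul_sum]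
    apply Finset.sum_congr rfl
    intro i hi
    have hi := Finset.mem_range.1 hi
    have e : ((-1:ℂ)^δ) = (-1)^(δ - i) * (-1)^i := by rw [← pow_add]; congr 1; omega
    rw [e]
    have e2 : ((-1:ℂ)^i) * (-1)^i = 1 := by rw [← mul_pow]; simp
    simp only [zsmul_eq_mul, hR, eval_comp, eval_sub, eval_C, eval_mul, eval_X, zero_add, nsmul_eq_mul, mul_one]
    push_cast
    linear_combination ((-1:ℂ)^(δ-i) * (δ.choose i : ℂ) * P.eval (x - N * i)) * e2
  exact (mul_eq_zero.1 h2).resolve_left (by simp)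

theorem lemmaS (a N : ℕ) (lam : ℂ) (O : ℕ → ℂ[X]) (gb : ℤ → ℂ[X]) (D : ℕ)
    (hX : ∀ l, Xl N lam l ≠ 0)
    (hO : ∀ i, (O i).natDegree ≤ D) (hneg : ∀ h, h < 0 → gb h = 0)
    (hdeg : ∀ h, (gb h).natDegree < a)
    (hdvd : ∀ h : ℤ, (X : ℂ[X]) ^ a ∣ ∑ i ∈ Finset.range (a + 1),
      (O i).comp (X + C ((N:ℂ) * h)) * gb (h - i)) (M : ℤ) :
    opd (D + 1) (opP a N lam O (yS a N lam gb)) M =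
      ∑ s ∈ Finset.range (D + 1), ∑ i ∈ Finset.range (a + 1), ∑ i' ∈ Finset.range (s + 1),
        ((-1) ^ i' * ((D + 1).choose i' : ℂ)) * ((O i).eval (tM N lam M - N * i') *
          (((Xl N lam (s - i')) ^ a)⁻¹ * (gb (M - (s + i : ℕ))).eval (Xl N lam (s - i')))) := by
  choose Q hQ using hdvd
  set δ := D + 1 with hδ
  have hQd : ∀ h, (Q h).natDegree < δ := by
    intro h
    by_cases hq : Q h = 0
    · simp [hq, hδ]
    have h1 : (X ^ a * Q h).natDegree = a + (Q h).natDegree := by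
      rw [natDegree_mul (by simp) hq, natDegree_X_pow]
    rw [← hQ] at h1
    have h2 : (∑ i ∈ Finset.range (a + 1), (O i).comp (X + C ((N:ℂ) * h)) * gb (h - i)).natDegree
        ≤ D + (a - 1) := by
      apply natDegree_sum_le_of_forall_le
      intro i _
      refine natDegree_mul_le.trans (Nat.add_le_add ?_ ?_)
      · rw [natDegree_comp, natDegree_X_add_C, mul_one]; exact hO i
      · have := hdeg (h - i); omega
    have := hdeg 0
    omega
  -- H
  set H : ℕ → ℕ → ℂ := fun i' l => ∑ i ∈ Finset.range (a + 1), (O i).eval (tM N lam M - N * i') *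
          (((Xl N lam l) ^ a)⁻¹ * (gb (M - (i' + l + i : ℕ))).eval (Xl N lam l)) with hH
  have hHQ : ∀ i' l, H i' l = (Q (M - (i' + l : ℕ))).eval (Xl N lam l) := by
    intro i' l
    have h1 := congrArg (eval (Xl N lam l)) (hQ (M - (i' + l : ℕ)))
    simp only [eval_finsetSum, eval_mul, eval_comp, eval_pow, eval_X, eval_add, eval_C] at h1
    have h3 := pow_ne_zero a (hX l)
    rw [eq_comm, ← mul_right_inj' h3, ← h1, hH, Finset.mul_sum]
    apply Finset.sum_congr rfl
    intro i _
    have e1 : Xl N lam l + (N:ℂ) * ((M - (i' + l : ℕ) : ℤ) : ℂ) = tM N lam M - N * i' := by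
      unfold Xl tM; push_cast; ring
    have e2 : M - (i' + l : ℕ) - (i:ℤ) = M - (i' + l + i : ℕ) := by push_cast; ring
    rw [e1, e2]
    field_simp
  have hHneg : ∀ i' l : ℕ, M < i' + l → H i' l = 0 := by
    intro i' l h
    apply Finset.sum_eq_zero
    intro i _
    rw [hneg _ (by push_cast; omega)]; simp
  obtain ⟨L, hL⟩ : ∃ L : ℕ, M + 1 ≤ L := ⟨(M+1).toNat, by omega⟩
  have hLHS : opd δ (opP a N lam O (yS a N lam gb)) M =
      ∑ i' ∈ Finset.range (δ + 1), ((-1) ^ i' * (δ.choose i' : ℂ)) *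
        ∑ l ∈ Finset.range L, H i' l := by
    unfold opd
    apply Finset.sum_congr rfl
    intro i' _
    congr 1
    unfold opP
    rw [Finset.sum_comm]
    apply Finset.sum_congr rfl
    intro i _
    rw [yS_eq a N lam gb hneg _ L (by omega), Finset.mul_sum]
    apply Finset.sum_congr rfl
    intro l _
    have e1 : tM N lam (M - i') = tM N lam M - N * i' := by unfold tM; push_cast; ring
    have e2 : M - (i':ℤ) - i - l = M - (i' + l + i : ℕ) := by push_cast; ring
    rw [e1, e2]
  have hshift : ∀ i' ∈ Finset.range (δ + 1), ∑ l ∈ Finset.range L, H i' l =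
      ∑ s ∈ Finset.range (L + δ), if i' ≤ s then H i' (s - i') else 0 := by
    intro i' hi'
    have hi' := Finset.mem_range.1 hi'
    rw [← Finset.sum_filter]
    have h1 : ∑ l ∈ Finset.range L, H i' l = ∑ l ∈ Finset.range (L + δ - i'), H i' l := by
      apply Finset.sum_subset
      · intro l hl; simp only [Finset.mem_range] at *; omega
      · intro l _ hl
        simp only [Finset.mem_range] at hl
        exact hHneg _ _ (by omega)
    rw [h1]
    apply Finset.sum_bij (fun l _ => l + i')
    · intro l hl; simp only [Finset.mem_filter, Finset.mem_range] at *; omega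
    · intro l _ l' _ h; omega
    · intro s hs
      simp only [Finset.mem_filter, Finset.mem_range] at hs
      exact ⟨s - i', by simp only [Finset.mem_range]; omega, by omega⟩
    · intro l _; simp
  rw [hLHS, Finset.sum_congr rfl (fun i' hi' => by rw [hshift i' hi'])]
  simp only [Finset.mul_sum]
  rw [Finset.sum_comm, add_comm L δ, Finset.sum_range_add]
  have hz : ∑ x ∈ Finset.range L, ∑ y ∈ Finset.range (δ + 1), (-1:ℂ) ^ y * (δ.choose y : ℂ) *
      (if y ≤ δ + x then H y (δ + x - y) else 0) = 0 := by
    apply Finset.sum_eq_zero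
    intro s _
    rw [← findiff (Q (M - (δ + s : ℕ))) δ (hQd _) (Xl N lam (δ + s)) N]
    apply Finset.sum_congr rfl
    intro i' hi'
    have hi' := Finset.mem_range.1 hi'
    rw [if_pos (by omega), hHQ, Nat.add_sub_cancel' (by omega)]
    congr 2
    unfold Xl
    rw [Nat.cast_sub (by omega)]; ring
  rw [hz, add_zero]
  apply Finset.sum_congr rfl
  intro s hs
  have hs := Finset.mem_range.1 hs
  rw [Finset.sum_comm (s := Finset.range (a+1))]
  rw [← Finset.sum_subset (s₁ := Finset.range (s+1)) (s₂ := Finset.range (δ + 1))]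
  · apply Finset.sum_congr rfl
    intro i' hi'
    have hi' := Finset.mem_range.1 hi'
    rw [if_pos (by omega), hH, Finset.mul_sum]
    apply Finset.sum_congr rfl
    intro i _
    rw [Nat.add_sub_cancel' (by omega)]
  · intro l hl; simp only [Finset.mem_range] at *; omega
  · intro l _ hl
    simp only [Finset.mem_range] at hl
    rw [if_neg (by omega), mul_zero]

end ZE
end


section
open Polynomial

namespace ZE

variable {a N m q Kb : ℕ} {A B Nm : ℂ[X]} {g : ℤ → ℂ[X]}

/-- evaluation of the first variable -/
noncomputable def ev (t : ℂ) : Polynomial ℂ[X] →+* ℂ[X] := sub2 (C t) X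

theorem ev_C (t : ℂ) (p : ℂ[X]) : ev t (C p) = C (p.eval t) := by
  rw [ev, sub2_C, comp_C]

theorem ev_bi (t l : ℂ) (p : ℂ[X]) : ev t (bi l p) = p.comp (C (t - l) - X) := by
  rw [ev, sub2_bi]; simp

theorem ev_coeff (t : ℂ) (G : Polynomial ℂ[X]) (e : ℕ) : (ev t G).coeff e = (G.coeff e).eval t := by
  have : ev t = mapRingHom (evalRingHom t) := by
    apply Polynomial.ringHom_ext
    · intro p; simp [ev_C]
    · simp [ev, sub2_X]
  rw [this]; simp

theorem dvd_one_sign (hS : Setup a N m q Kb A B Nm g) (haK : a ≤ Kb) (O : ℕ → ℂ[X])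
    (h1 : (X : Polynomial ℂ[X]) ^ a ∣ ∑ i ∈ Finset.range (a + 1),
        C (O i) * bi 0 (num A B N a i)) (h : ℤ) :
    (X : ℂ[X]) ^ a ∣ ∑ i ∈ Finset.range (a + 1), (O i).comp (X + C ((N:ℂ) * h)) * g (h - i) := by
  apply transfer hS a haK h (Finset.range (a+1)) (fun i => i)
    (fun i hi => by have := Finset.mem_range.1 hi; omega) (fun i => (O i).comp (X + C ((N:ℂ) * h))) a le_rfl
  have h2 := map_dvd (sub2 (X + C ((N:ℂ) * h)) (2 * X)) h1
  rw [map_pow, sub2_X, map_sum] at h2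
  refine ((pow_dvd_pow_of_dvd (Dvd.intro_left 2 rfl) a).trans h2).trans (dvd_of_eq ?_)
  apply Finset.sum_congr rfl
  intro i _
  rw [map_mul, sub2_C, sub2_bi]
  congr 2
  rw [C_0]; ring

theorem dvd_other_sign (hS : Setup a N m q Kb A B Nm g) (haK : a ≤ Kb) (O : ℕ → ℂ[X])
    (h1 : ∑ i ∈ Finset.range (a + 1), O i * num A B N a i = 0) (h : ℤ) :
    (X : ℂ[X]) ^ a ∣ ∑ i ∈ Finset.range (a + 1), (O i).comp (X + C ((N:ℂ) * h)) *
      (g (h - i)).comp (-X) := by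
  have h3 : (X : ℂ[X]) ^ a ∣ ∑ i ∈ Finset.range (a + 1), (O i).comp (C ((N:ℂ) * h) - X) * g (h - i) := by
    apply transfer hS a haK h (Finset.range (a+1)) (fun i => i)
      (fun i hi => by have := Finset.mem_range.1 hi; omega) (fun i => (O i).comp (C ((N:ℂ) * h) - X)) a le_rfl
    have h2 := congrArg (fun p => p.comp (C ((N:ℂ) * h) - X)) h1
    simp only [Polynomial.sum_comp, mul_comp, zero_comp] at h2
    rw [h2]; exact dvd_zero _
  have h4 := map_dvd (compRingHom (-X : ℂ[X])) h3
  rw [map_pow, map_sum] at h4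
  simp only [map_mul, coe_compRingHom_apply, X_comp] at h4
  refine ((pow_dvd_pow_of_dvd (by simp) a).trans h4).trans (dvd_of_eq ?_)
  apply Finset.sum_congr rfl
  intro i _
  rw [comp_assoc]
  congr 2
  simp; ring

/-- first choice of `gb`. -/
noncomputable def gb1 (a : ℕ) (g : ℤ → ℂ[X]) (h : ℤ) : ℂ[X] :=
  C ((-1) ^ a) * (g h).comp (-X) - g h

noncomputable def gb2 (a : ℕ) (g : ℤ → ℂ[X]) (h : ℤ) : ℂ[X] := C ((g h).coeff 0) * X ^ (a - 1)

theorem gb1_dvd (hS : Setup a N m q Kb A B Nm g) (haK : a ≤ Kb) (O : ℕ → ℂ[X])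
    (h1 : (X : Polynomial ℂ[X]) ^ a ∣ ∑ i ∈ Finset.range (a + 1),
        C (O i) * bi 0 (num A B N a i))
    (h2 : ∑ i ∈ Finset.range (a + 1), O i * num A B N a i = 0) (h : ℤ) :
    (X : ℂ[X]) ^ a ∣ ∑ i ∈ Finset.range (a + 1), (O i).comp (X + C ((N:ℂ) * h)) * gb1 a g (h - i) := by
  have e1 := dvd_one_sign hS haK O h1 h
  have e2 := dvd_other_sign hS haK O h2 h
  refine ((e2.mul_left (C ((-1)^a))).sub e1).trans (dvd_of_eq ?_)
  rw [Finset.mul_sum, ← Finset.sum_sub_distrib]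
  apply Finset.sum_congr rfl
  intro i _
  unfold gb1; ring

theorem gb2_dvd (hS : Setup a N m q Kb A B Nm g) (haK : a ≤ Kb) (O : ℕ → ℂ[X])
    (h1 : (X : Polynomial ℂ[X]) ^ a ∣ ∑ i ∈ Finset.range (a + 1),
        C (O i) * bi 0 (num A B N a i)) (h : ℤ) :
    (X : ℂ[X]) ^ a ∣ ∑ i ∈ Finset.range (a + 1), (O i).comp (X + C ((N:ℂ) * h)) * gb2 a g (h - i) := by
  have e1 := dvd_one_sign hS haK O h1 h
  have ha := hS.ha
  have e2 : (X:ℂ[X]) ∣ ∑ i ∈ Finset.range (a + 1), (O i).comp (X + C ((N:ℂ) * h)) * C ((g (h - i)).coeff 0) := by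
    have e3 := (dvd_pow_self (X:ℂ[X]) (by omega : a ≠ 0)).trans e1
    rw [X_dvd_iff] at *
    rw [finsetSum_coeff] at *
    simpa [mul_coeff_zero] using e3
  have e4 := mul_dvd_mul e2 (dvd_refl (X ^ (a-1)))
  rw [← pow_succ', Nat.sub_add_cancel ha, Finset.sum_mul] at e4
  refine e4.trans (dvd_of_eq ?_)
  apply Finset.sum_congr rfl
  intro i _
  unfold gb2; ring

theorem gb1_neg (hS : Setup a N m q Kb A B Nm g) (h : ℤ) (hh : h < 0) : gb1 a g h = 0 := by
  unfold gb1; rw [hS.g_neg h hh]; simp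
theorem gb2_neg (hS : Setup a N m q Kb A B Nm g) (h : ℤ) (hh : h < 0) : gb2 a g h = 0 := by
  unfold gb2; rw [hS.g_neg h hh]; simp
theorem gb1_deg (hS : Setup a N m q Kb A B Nm g) (h : ℤ) : (gb1 a g h).natDegree < a := by
  unfold gb1
  have h1 := hS.g_deg h
  refine lt_of_le_of_lt (natDegree_sub_le _ _) (max_lt ?_ h1)
  refine lt_of_le_of_lt (natDegree_C_mul_le _ _) ?_
  rw [natDegree_comp]; simpa using h1
theorem gb2_deg (hS : Setup a N m q Kb A B Nm g) (h : ℤ) : (gb2 a g h).natDegree < a := by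
  unfold gb2
  have h1 := hS.ha
  refine lt_of_le_of_lt (natDegree_C_mul_le _ _) ?_
  rw [natDegree_X_pow]; omega

noncomputable def El (a N : ℕ) (lam : ℂ) (l : ℕ) : ℂ[X] :=
  ∑ j ∈ Finset.range a, C (((-1)^(j+1) - 1) * ((Xl N lam l)^(j+1))⁻¹) * X ^ j

theorem gb1_eval (hS : Setup a N m q Kb A B Nm g) (lam : ℂ) (l : ℕ) (hX : Xl N lam l ≠ 0) (h : ℤ) :
    ((Xl N lam l) ^ a)⁻¹ * (gb1 a g h).eval (Xl N lam l) = (El a N lam l * g h).coeff (a - 1) := by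
  have ha := hS.ha
  set x := Xl N lam l with hx
  unfold El gb1
  rw [Finset.sum_mul, finsetSum_coeff, ← Finset.sum_range_reflect]
  simp only [eval_sub, eval_mul, eval_C, eval_comp, eval_neg, eval_X]
  rw [eval_eq_sum_range' (hS.g_deg h), eval_eq_sum_range' (hS.g_deg h), Finset.mul_sum,
    ← Finset.sum_sub_distrib, Finset.mul_sum]
  apply Finset.sum_congr rfl
  intro e he
  have he := Finset.mem_range.1 he
  rw [mul_assoc, coeff_C_mul, coeff_X_pow_mul', if_pos (by omega)]
  have e1 : a - 1 - (a - 1 - e) = e := by omega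
  have e2 : a - 1 - e + 1 = a - e := by omega
  rw [e1, e2, neg_pow x e]
  have e3 : ((-1:ℂ)^a) * (-1)^e = (-1)^(a-e) := by
    have : a = (a - e) + e := by omega
    rw [this, pow_add, mul_assoc, ← mul_pow]; simp
  have e4 : (x^a)⁻¹ * x^e = (x^(a-e))⁻¹ := by
    have : x^a = x^(a-e) * x^e := by rw [← pow_add]; congr 1; omega
    rw [this, mul_inv, mul_assoc, inv_mul_cancel₀ (pow_ne_zero _ hX), mul_one]
  rw [← e3, ← e4]; ring

theorem gb2_eval (hS : Setup a N m q Kb A B Nm g) (lam : ℂ) (l : ℕ) (hX : Xl N lam l ≠ 0) (h : ℤ) :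
    ((Xl N lam l) ^ a)⁻¹ * (gb2 a g h).eval (Xl N lam l) = (Xl N lam l)⁻¹ * (g h).coeff 0 := by
  have ha := hS.ha
  unfold gb2
  simp only [eval_mul, eval_C, eval_pow, eval_X]
  have : (Xl N lam l) ^ a = (Xl N lam l)^(a-1) * Xl N lam l := by rw [← pow_succ]; congr 1; omega
  rw [this]
  field_simp

/-- index set and weights -/
def TT (a D : ℕ) : Finset (ℕ × ℕ) := Finset.range (D + 1) ×ˢ Finset.range (a + 1)

noncomputable def Wc (a N D : ℕ) (lam : ℂ) (O : ℕ → ℂ[X]) (τ : ℕ × ℕ) : Polynomial ℂ[X] :=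
  ∑ i' ∈ Finset.range (τ.1 + 1),
    C (C ((-1) ^ i' * ((D + 1).choose i' : ℂ)) * (O τ.2).comp (X - C ((N:ℂ) * i'))) *
      (El a N lam (τ.1 - i')).map C

noncomputable def W2 (N D : ℕ) (lam : ℂ) (O : ℕ → ℂ[X]) (τ : ℕ × ℕ) : ℂ[X] :=
  ∑ i' ∈ Finset.range (τ.1 + 1),
    C ((-1) ^ i' * ((D + 1).choose i' : ℂ)) * (O τ.2).comp (X - C ((N:ℂ) * i')) *
      C ((Xl N lam (τ.1 - i'))⁻¹)

theorem Wc_coeff_zero (ha : 0 < a) (D : ℕ) (lam : ℂ) (O : ℕ → ℂ[X]) (τ : ℕ × ℕ) :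
    (Wc a N D lam O τ).coeff 0 = C (-2) * W2 N D lam O τ := by
  unfold Wc W2
  rw [finsetSum_coeff, Finset.mul_sum]
  apply Finset.sum_congr rfl
  intro i' _
  rw [coeff_C_mul, coeff_map]
  have : (El a N lam (τ.1 - i')).coeff 0 = -2 * (Xl N lam (τ.1 - i'))⁻¹ := by
    unfold El
    obtain ⟨b, rfl⟩ : ∃ b, a = b + 1 := ⟨a - 1, by omega⟩
    rw [Finset.sum_range_succ', coeff_add, finsetSum_coeff, Finset.sum_eq_zero]
    · norm_num
    · intro j _; simp [mul_coeff_zero]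
  rw [this, C_mul (a := (-2:ℂ))]; ring

noncomputable def zz (a N D : ℕ) (lam : ℂ) (O : ℕ → ℂ[X]) (g : ℤ → ℂ[X]) (M : ℤ) : ℂ :=
  (∑ τ ∈ TT a D, ev (tM N lam M) (Wc a N D lam O τ) * g (M - (τ.1 + τ.2 : ℕ))).coeff (a - 1)

theorem zz_eq (hS : Setup a N m q Kb A B Nm g) (haK : a ≤ Kb) (O : ℕ → ℂ[X]) (D : ℕ) (lam : ℂ)
    (hX : ∀ l, Xl N lam l ≠ 0) (hO : ∀ i, (O i).natDegree ≤ D)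
    (h1 : (X : Polynomial ℂ[X]) ^ a ∣ ∑ i ∈ Finset.range (a + 1),
        C (O i) * bi 0 (num A B N a i))
    (h2 : ∑ i ∈ Finset.range (a + 1), O i * num A B N a i = 0) (M : ℤ) :
    opd (D + 1) (opP a N lam O (yS a N lam (gb1 a g))) M = zz a N D lam O g M := by
  rw [lemmaS a N lam O (gb1 a g) D hX hO (gb1_neg hS) (gb1_deg hS) (gb1_dvd hS haK O h1 h2) M]
  unfold zz TT
  rw [Finset.sum_product, finsetSum_coeff]
  apply Finset.sum_congr rfl
  intro s _
  rw [finsetSum_coeff]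
  apply Finset.sum_congr rfl
  intro i _
  dsimp only
  unfold Wc
  rw [map_sum, Finset.sum_mul, finsetSum_coeff]
  apply Finset.sum_congr rfl
  intro i' _
  rw [gb1_eval hS lam _ (hX _), map_mul, ev_C]
  have e1 : ev (tM N lam M) ((El a N lam (s - i')).map C) = El a N lam (s - i') := by
    ext e; rw [ev_coeff]; simp
  dsimp only
  rw [e1, mul_assoc (C _), coeff_C_mul]
  simp only [eval_mul, eval_C, eval_comp, eval_sub, eval_X]
  ring

theorem zz2_eq (hS : Setup a N m q Kb A B Nm g) (haK : a ≤ Kb) (O : ℕ → ℂ[X]) (D : ℕ) (lam : ℂ)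
    (hX : ∀ l, Xl N lam l ≠ 0) (hO : ∀ i, (O i).natDegree ≤ D)
    (h1 : (X : Polynomial ℂ[X]) ^ a ∣ ∑ i ∈ Finset.range (a + 1),
        C (O i) * bi 0 (num A B N a i)) (M : ℤ) :
    opd (D + 1) (opP a N lam O (yS a N lam (gb2 a g))) M =
      ∑ τ ∈ TT a D, (W2 N D lam O τ).eval (tM N lam M) * (g (M - (τ.1 + τ.2 : ℕ))).coeff 0 := by
  rw [lemmaS a N lam O (gb2 a g) D hX hO (gb2_neg hS) (gb2_deg hS) (gb2_dvd hS haK O h1) M]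
  unfold TT
  rw [Finset.sum_product]
  apply Finset.sum_congr rfl
  intro s _
  apply Finset.sum_congr rfl
  intro i _
  dsimp only
  unfold W2
  rw [eval_finsetSum, Finset.sum_mul]
  apply Finset.sum_congr rfl
  intro i' _
  rw [gb2_eval hS lam _ (hX _)]
  simp only [eval_mul, eval_C, eval_comp, eval_sub, eval_X]
  ring

noncomputable def ZZ (a N D K : ℕ) (A B : ℂ[X]) (lam : ℂ) (O : ℕ → ℂ[X]) : Polynomial ℂ[X] :=
  ∑ τ ∈ TT a D, Wc a N D lam O τ * bi lam (num A B N K (τ.1 + τ.2))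

theorem ZZ_coeff_zero (ha : 0 < a) (D K : ℕ) (lam : ℂ) (O : ℕ → ℂ[X]) :
    (ZZ a N D K A B lam O).coeff 0 = C (-2) * ∑ τ ∈ TT a D, W2 N D lam O τ *
      (num A B N K (τ.1 + τ.2)).comp (X - C lam) := by
  unfold ZZ
  rw [finsetSum_coeff, Finset.mul_sum]
  apply Finset.sum_congr rfl
  intro τ _
  rw [mul_coeff_zero, Wc_coeff_zero ha, bi_coeff_zero]; ring

/-- first half of N1: if `Z(t,0) = 0` then `O y = 0`. -/
theorem opP_zero (hS : Setup a N m q Kb A B Nm g) (O : ℕ → ℂ[X]) (D : ℕ)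
    (haK : a + D ≤ Kb) (lam : ℂ)
    (hX : ∀ l, Xl N lam l ≠ 0) (hO : ∀ i, (O i).natDegree ≤ D)
    (h1 : (X : Polynomial ℂ[X]) ^ a ∣ ∑ i ∈ Finset.range (a + 1),
        C (O i) * bi 0 (num A B N a i))
    (hZ : (ZZ a N D (a + D) A B lam O).coeff 0 = 0) (M : ℤ) :
    opP a N lam O (yS a N lam (gb2 a g)) M = 0 := by
  have hz : ∀ M : ℤ, opd (D + 1) (opP a N lam O (yS a N lam (gb2 a g))) M = 0 := by
    intro M
    rw [zz2_eq hS (by omega) O D lam hX hO h1]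
    have ht := transfer hS (a + D) haK M (TT a D) (fun τ => τ.1 + τ.2)
      (fun τ hτ => by
        simp only [TT, Finset.mem_product, Finset.mem_range] at hτ; omega)
      (fun τ => C ((W2 N D lam O τ).eval (tM N lam M))) 1 hS.ha
      (by
        rw [pow_one, X_dvd_iff, coeff_zero_eq_eval_zero, eval_finsetSum]
        rw [ZZ_coeff_zero hS.ha] at hZ
        have h3 := (mul_eq_zero.1 hZ).resolve_left (by simp)
        have h4 := congrArg (eval (tM N lam M)) h3
        simp only [eval_finsetSum, eval_mul, eval_comp, eval_sub, eval_X, eval_C, eval_zero] at h4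
        simp only [eval_mul, eval_comp, eval_sub, eval_X, eval_C]
        have e : tM N lam M - lam = (N:ℂ) * M - 0 := by unfold tM; ring
        rw [e] at h4
        exact h4)
    rw [pow_one, X_dvd_iff, finsetSum_coeff] at ht
    rw [← ht]
    apply Finset.sum_congr rfl
    intro τ _
    rw [coeff_C_mul]
  set f := opP a N lam O (yS a N lam (gb2 a g)) with hf
  have hneg : ∀ M : ℤ, M < 0 → f M = 0 := by
    intro M hM
    simp only [hf, opP]
    apply Finset.sum_eq_zero
    intro i _
    rw [yS, Finset.sum_eq_zero, mul_zero]
    intro l hl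
    have hl := Finset.mem_range.1 hl
    omega
  have hpos : ∀ k : ℕ, f k = 0 := by
    intro k
    induction k using Nat.strong_induction_on with
    | _ k ih =>
      have h5 := hz k
      unfold opd at h5
      rw [Finset.sum_range_succ', Finset.sum_eq_zero] at h5
      · simpa using h5
      · intro i _
        have : f ((k:ℤ) - ((i+1 : ℕ):ℤ)) = 0 := by
          by_cases hk : (k:ℤ) < ((i+1:ℕ):ℤ)
          · exact hneg _ (by omega)
          · have e : (k:ℤ) - ((i+1 : ℕ):ℤ) = ((k - (i+1) : ℕ) : ℤ) := by
              push_cast [Nat.cast_sub (show i+1 ≤ k by omega)]; ring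
            rw [e]; exact ih _ (by omega)
        rw [this, mul_zero]
  by_cases hM : M < 0
  · exact hneg M hM
  · have := hpos M.toNat
    rwa [Int.toNat_of_nonneg (by omega)] at this

end ZE
end


section
open Polynomial

namespace ZE

variable {a N m q Kb : ℕ} {A B Nm : ℂ[X]} {g : ℤ → ℂ[X]}

noncomputable def Dn (a N m : ℕ) : ℂ[X] := ∏ h ∈ Finset.range (m + 1), (X - C ((N : ℂ) * h)) ^ a

theorem Dn_ne (a N m : ℕ) : Dn a N m ≠ 0 := by
  unfold Dn
  rw [Finset.prod_ne_zero_iff]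
  intro h _
  exact pow_ne_zero _ (X_sub_C_ne_zero _)

noncomputable def SG (c : ℂ) : PowerSeries KK →+* PowerSeries KK := PowerSeries.map (sg c)

theorem coeff_SG_iter (c : ℂ) (i e : ℕ) (Φ : PowerSeries KK) :
    PowerSeries.coeff e ((SG c)^[i] Φ) = (sg c)^[i] (PowerSeries.coeff e Φ) := by
  induction i generalizing Φ with
  | zero => rfl
  | succ i ih =>
    rw [Function.iterate_succ_apply, Function.iterate_succ_apply, ih, SG, PowerSeries.coeff_map]

/-- shift of the first variable -/
noncomputable def shp (c : ℂ) : Polynomial ℂ[X] →+* Polynomial ℂ[X] :=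
  mapRingHom (compRingHom (X - C c))

theorem SG_iter_em (c : ℂ) (i : ℕ) (G : Polynomial ℂ[X]) :
    (SG c)^[i] (em G) = em (shp (i * c) G) := by
  ext e
  rw [coeff_SG_iter, coeff_em, coeff_em, sg_iter_alg, shp]
  simp

theorem shp_bi (c lam : ℂ) (p : ℂ[X]) : shp c (bi lam p) = bi lam (p.comp (X - C c)) := by
  have : (shp c).comp (bi lam) = (bi lam).comp (compRingHom (X - C c)) := by
    apply Polynomial.ringHom_ext
    · intro x; simp [shp, bi]
    · simp [shp, bi]; ring
  exact RingHom.congr_fun this p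

theorem shp_C (c : ℂ) (p : ℂ[X]) : shp c (C p) = C (p.comp (X - C c)) := by
  simp [shp]

theorem em_inj : Function.Injective em := by
  intro p q h
  ext1 e
  apply IsFractionRing.injective ℂ[X] KK
  rw [← coeff_em, ← coeff_em, h]

theorem bi_inj (lam : ℂ) : Function.Injective (bi lam) := by
  intro p q h
  have := congrArg (fun G => coeff G 0) h
  simp only [bi_coeff_zero] at this
  exact sh_inj lam this

theorem em_bi_ne (lam : ℂ) {p : ℂ[X]} (hp : p ≠ 0) : em (bi lam p) ≠ 0 := by
  rw [Ne, map_eq_zero_iff _ em_inj, map_eq_zero_iff _ (bi_inj lam)]; exact hp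

theorem cc_em_bi (lam : ℂ) {p : ℂ[X]} (hp : p ≠ 0) :
    PowerSeries.constantCoeff (em (bi lam p)) ≠ 0 := by
  rw [← PowerSeries.coeff_zero_eq_constantCoeff_apply, coeff_em, bi_coeff_zero]
  rw [Ne, map_eq_zero_iff _ (IsFractionRing.injective ℂ[X] KK)]
  exact comp_sub_ne hp lam

noncomputable def FF (a N m : ℕ) (Nm : ℂ[X]) (lam : ℂ) : PowerSeries KK :=
  em (bi lam Nm) * (em (bi lam (Dn a N m)))⁻¹

theorem FF_mul (a N m : ℕ) (Nm : ℂ[X]) (lam : ℂ) :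
    FF a N m Nm lam * em (bi lam (Dn a N m)) = em (bi lam Nm) := by
  unfold FF
  rw [mul_assoc, PowerSeries.inv_mul_cancel _ (cc_em_bi lam (Dn_ne a N m)), mul_one]

theorem FF_step (hS : Setup a N m q Kb A B Nm g) (lam : ℂ) :
    em (bi lam (A.comp (X - C (N:ℂ)))) * SG (N:ℂ) (FF a N m Nm lam) =
      em (bi lam B) * FF a N m Nm lam := by
  have h1 := FF_mul a N m Nm lam
  have h2 := congrArg (SG (N:ℂ)) h1
  have hs : ∀ p, SG (N:ℂ) (em (bi lam p)) = em (bi lam (p.comp (X - C (N:ℂ)))) := by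
    intro p
    have := SG_iter_em (N:ℂ) 1 (bi lam p)
    rw [shp_bi] at this
    simpa using this
  rw [map_mul, hs, hs] at h2
  have hrec : A.comp (X - C (N:ℂ)) * Nm.comp (X - C (N:ℂ)) * Dn a N m =
      B * Nm * (Dn a N m).comp (X - C (N:ℂ)) := hS.recF
  have h3 : em (bi lam (A.comp (X - C (N:ℂ)))) * em (bi lam (Nm.comp (X - C (N:ℂ)))) *
      em (bi lam (Dn a N m)) = em (bi lam B) * em (bi lam Nm) *
        em (bi lam ((Dn a N m).comp (X - C (N:ℂ)))) := by
    rw [← map_mul, ← map_mul, ← map_mul, ← map_mul, hrec, map_mul, map_mul, map_mul, map_mul]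
  have d1 := em_bi_ne lam (Dn_ne a N m)
  have d2 := em_bi_ne lam (comp_sub_ne (Dn_ne a N m) (N:ℂ))
  apply mul_left_cancel₀ (mul_ne_zero d1 d2)
  linear_combination (em (bi lam (A.comp (X - C (N:ℂ)))) * em (bi lam (Dn a N m))) * h2 + h3
    - (em (bi lam B) * em (bi lam ((Dn a N m).comp (X - C (N:ℂ))))) * h1

theorem FF_chain (hS : Setup a N m q Kb A B Nm g) (lam : ℂ) (K : ℕ) : ∀ κ ≤ K,
    em (bi lam (num A B N K 0)) * (SG (N:ℂ))^[κ] (FF a N m Nm lam) =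
      em (bi lam (num A B N K κ)) * FF a N m Nm lam := by
  intro κ
  induction κ with
  | zero => intro _; rfl
  | succ κ ih =>
    intro hκ
    have h1 := ih (by omega)
    have h2 := congrArg ((SG (N:ℂ))^[κ]) (FF_step hS lam)
    rw [← RingHom.coe_pow, map_mul, map_mul, RingHom.coe_pow, SG_iter_em, SG_iter_em, shp_bi, shp_bi,
      ← Function.iterate_succ_apply] at h2
    have e1 : (A.comp (X - C (N:ℂ))).comp (X - C ((κ:ℂ) * N)) = A.comp (X - C ((N:ℂ) * (κ + 1))) := by
      rw [comp_assoc]; congr 1; simp; ring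
    rw [e1, mul_comm (κ:ℂ)] at h2
    have h3 : em (bi lam (num A B N K (κ+1))) * em (bi lam (A.comp (X - C ((N:ℂ) * (κ + 1))))) =
        em (bi lam (num A B N K κ)) * em (bi lam (B.comp (X - C ((N:ℂ) * κ)))) := by
      rw [← map_mul, ← map_mul, num_succ A B N K κ (by omega), map_mul, map_mul]
    have d1 := em_bi_ne lam (comp_sub_ne hS.hA0 ((N:ℂ) * (κ + 1)))
    apply mul_left_cancel₀ d1
    linear_combination (em (bi lam (num A B N K 0))) * h2 + em (bi lam (B.comp (X - C ((N:ℂ) * κ)))) * h1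
      - FF a N m Nm lam * h3

theorem num_ne (hS : Setup a N m q Kb A B Nm g) (K κ : ℕ) : num A B N K κ ≠ 0 := by
  unfold num
  refine mul_ne_zero ?_ ?_
  · rw [Finset.prod_ne_zero_iff]; intro k _; exact comp_sub_ne hS.hB0 _
  · rw [Finset.prod_ne_zero_iff]; intro k _; exact comp_sub_ne hS.hA0 _

/-- linear independence from pole orders -/
theorem indep_poles (α : ℂ) (d : ℕ) (v : ℕ → KK) (n : ℕ → ℕ) (ρ : ℕ → PowerSeries ℂ)
    (hn : ∀ i < d, ∀ j < d, n i = n j → i = j) (hn1 : ∀ i < d, 1 ≤ n i)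
    (hρ : ∀ i < d, PowerSeries.constantCoeff (ρ i) ≠ 0)
    (hv : ∀ i < d, exK α (v i) * (algebraMap (PowerSeries ℂ) LL PowerSeries.X) ^ (n i)
        = algebraMap (PowerSeries ℂ) LL (ρ i))
    (c : ℕ → ℂ) (ρ0 : PowerSeries ℂ)
    (hc : ∑ i ∈ Finset.range d, exK α (algebraMap ℂ KK (c i)) * exK α (v i)
      = algebraMap (PowerSeries ℂ) LL ρ0) : ∀ i < d, c i = 0 := by
  by_contra hcon
  push Not at hcon
  obtain ⟨i0, hi0, hci0⟩ := hcon
  classical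
  obtain ⟨j, hj, hjmax⟩ := Finset.exists_max_image ((Finset.range d).filter (fun i => c i ≠ 0)) n
    ⟨i0, by simp [hi0, hci0]⟩
  simp only [Finset.mem_filter, Finset.mem_range] at hj hjmax
  have hcc : ∀ x : ℂ, exK α (algebraMap ℂ KK x) = algebraMap (PowerSeries ℂ) LL (PowerSeries.C x) := by
    intro x
    rw [IsScalarTower.algebraMap_apply ℂ ℂ[X] KK, exK_alg]
    congr 1
    exact exS_C α x
  have h1 : ∑ i ∈ Finset.range d, PowerSeries.C (c i) * ρ i * PowerSeries.X ^ (n j - n i)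
      = ρ0 * PowerSeries.X ^ (n j) := by
    apply IsFractionRing.injective (PowerSeries ℂ) LL
    rw [map_sum, map_mul, ← hc, Finset.sum_mul]
    apply Finset.sum_congr rfl
    intro i hi
    have hi := Finset.mem_range.1 hi
    by_cases hci : c i = 0
    · simp [hci]
    · have := hjmax i ⟨hi, hci⟩
      rw [hcc, map_mul, map_mul, ← hv i hi, map_pow, map_pow]
      have e : n j = n i + (n j - n i) := by omega
      conv_rhs => rw [e, pow_add]
      ring
  have h2 := congrArg PowerSeries.constantCoeff h1
  have hnj : n j ≠ 0 := by have := hn1 j hj.1; omega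
  rw [map_sum, map_mul, map_pow, PowerSeries.constantCoeff_X, zero_pow hnj, mul_zero,
    Finset.sum_eq_single j] at h2
  · simp only [Nat.sub_self, pow_zero, mul_one, map_mul, PowerSeries.constantCoeff_C] at h2
    rcases mul_eq_zero.1 h2 with h | h
    · exact hj.2 h
    · exact hρ j hj.1 h
  · intro i hi hij
    have hi := Finset.mem_range.1 hi
    by_cases hci : c i = 0
    · simp [hci]
    · have h3 := hjmax i ⟨hi, hci⟩
      have h4 : n i ≠ n j := fun h => hij (hn i hi j hj.1 h)
      rw [map_mul, map_pow, PowerSeries.constantCoeff_X, zero_pow (by omega), mul_zero]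
  · intro h; exact absurd (Finset.mem_range.2 hj.1) h

end ZE
end


section
open Polynomial

namespace ZE

variable {a N m q Kb : ℕ} {A B Nm : ℂ[X]} {g : ℤ → ℂ[X]}

theorem em_X : em X = PowerSeries.X := by
  ext e
  rw [coeff_em, PowerSeries.coeff_X, coeff_X]
  by_cases h : e = 1
  · simp [h]
  · simp [h, Ne.symm h]

theorem low_coeff (a : ℕ) (S Ψ F : PowerSeries KK) (G : Polynomial ℂ[X])
    (hS : PowerSeries.constantCoeff S ≠ 0) (h : S * Ψ = em G * F) (hG : (X : Polynomial ℂ[X]) ^ a ∣ G) :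
    ∀ e < a, PowerSeries.coeff e Ψ = 0 := by
  obtain ⟨Q, rfl⟩ := hG
  have h1 : Ψ = PowerSeries.X ^ a * (em Q * F * S⁻¹) := by
    have : Ψ = S⁻¹ * (S * Ψ) := by
      rw [← mul_assoc, PowerSeries.inv_mul_cancel _ hS, one_mul]
    rw [this, h, map_mul, map_pow, em_X]; ring
  exact PowerSeries.X_pow_dvd_iff.1 (Dvd.intro _ h1.symm)

noncomputable def DnE (a N m h0 : ℕ) : ℂ[X] :=
  ∏ h ∈ (Finset.range (m + 1)).erase h0, (X - C ((N : ℂ) * h)) ^ a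

theorem Dn_split (lam : ℂ) (h0 : ℕ) (hh : h0 ≤ m) :
    bi lam (Dn a N m) = (C (X - C (lam + N * h0)) - X) ^ a * bi lam (DnE a N m h0) := by
  unfold Dn DnE
  rw [← Finset.mul_prod_erase (Finset.range (m+1)) _ (Finset.mem_range.2 (by omega : h0 < m + 1)), map_mul,
    map_pow]
  congr 2
  simp [bi]
  ring

theorem DnE_ne (hN : 0 < N) (h0 : ℕ) : (DnE a N m h0).eval ((N:ℂ) * h0) ≠ 0 := by
  unfold DnE
  rw [eval_prod, Finset.prod_ne_zero_iff]
  intro h hh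
  rw [Finset.mem_erase] at hh
  simp only [eval_pow, eval_sub, eval_X, eval_C]
  apply pow_ne_zero
  rw [← mul_sub]
  refine mul_ne_zero (by exact_mod_cast hN.ne') ?_
  rw [sub_ne_zero]
  exact_mod_cast hh.1.symm

theorem killF (hS : Setup a N m q Kb A B Nm g) (O : ℕ → ℂ[X])
    (h1 : (X : Polynomial ℂ[X]) ^ a ∣ ∑ i ∈ Finset.range (a + 1),
        C (O i) * bi 0 (num A B N a i)) (e : ℕ) (he : e < a) :
    ∑ i ∈ Finset.range (a + 1), algebraMap ℂ[X] KK (O i) *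
      ((sg (N:ℂ))^[i]) (PowerSeries.coeff e (FF a N m Nm 0)) = 0 := by
  have := low_coeff a (em (bi 0 (num A B N a 0)))
    (∑ i ∈ Finset.range (a+1), em (C (O i)) * (SG (N:ℂ))^[i] (FF a N m Nm 0)) (FF a N m Nm 0) _
    (cc_em_bi 0 (num_ne hS a 0)) (by
      rw [Finset.mul_sum, map_sum, Finset.sum_mul]
      apply Finset.sum_congr rfl
      intro i hi
      have hi := Finset.mem_range.1 hi
      have h2 := FF_chain hS 0 a i (by omega)
      rw [map_mul]
      linear_combination em (C (O i)) * h2) h1 e he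
  rw [← this, map_sum]
  apply Finset.sum_congr rfl
  intro i _
  have : em (C (O i)) = PowerSeries.C (algebraMap ℂ[X] KK (O i)) := by
    ext e
    rw [coeff_em, coeff_C, PowerSeries.coeff_C]
    split_ifs <;> simp
  rw [this, PowerSeries.coeff_C_mul, coeff_SG_iter]

noncomputable def RR (N m : ℕ) (g : ℤ → ℂ[X]) : KK :=
  ∑ h ∈ Finset.range (m + 1), algebraMap ℂ KK ((g h).coeff 0) *
    (algebraMap ℂ[X] KK (X - C ((N:ℂ) * h)))⁻¹

theorem sg_const_iter (c x : ℂ) (i : ℕ) : (sg c)^[i] (algebraMap ℂ KK x) = algebraMap ℂ KK x := by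
  induction i with
  | zero => rfl
  | succ i ih => rw [Function.iterate_succ_apply, sg_const, ih]

theorem RR_shift (i : ℕ) : (sg (N:ℂ))^[i] (RR N m g) =
    ∑ h ∈ Finset.range (m + 1), algebraMap ℂ KK ((g h).coeff 0) *
    (algebraMap ℂ[X] KK (X - C ((N:ℂ) * i + N * h)))⁻¹ := by
  unfold RR
  rw [← RingHom.coe_pow, map_sum]
  apply Finset.sum_congr rfl
  intro h _
  rw [map_mul, map_inv₀, RingHom.coe_pow, sg_const_iter, sg_iter_alg]
  congr 4
  simp; ring

theorem yS2_big (hS : Setup a N m q Kb A B Nm g) (lam : ℂ) (hX : ∀ l, Xl N lam l ≠ 0) (k : ℕ)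
    (hk : m ≤ k) : yS a N lam (gb2 a g) k = ∑ h ∈ Finset.range (m + 1),
      (g h).coeff 0 * (tM N lam k - N * h)⁻¹ := by
  unfold yS
  have e0 : ((k:ℤ) + 1).toNat = k + 1 := by omega
  rw [e0, ← Finset.sum_range_reflect]
  rw [Finset.sum_subset (s₁ := Finset.range (m+1)) (s₂ := Finset.range (k+1))]
  · apply Finset.sum_congr rfl
    intro h hh
    have hh := Finset.mem_range.1 hh
    rw [gb2_eval hS lam _ (hX _), mul_comm]
    have e1 : (k:ℤ) - ((k + 1 - 1 - h : ℕ):ℤ) = h := by omega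
    have e2 : Xl N lam (k + 1 - 1 - h) = tM N lam k - N * h := by
      unfold Xl tM
      rw [show k + 1 - 1 - h = k - h by omega, Nat.cast_sub (by omega)]; push_cast; ring
    rw [e1, e2]
  · intro l hl; simp only [Finset.mem_range] at *; omega
  · intro h _ hl
    simp only [Finset.mem_range] at hl
    rw [hS.g_big _ (by omega)]; simp

theorem kill_RR (hS : Setup a N m q Kb A B Nm g) (O : ℕ → ℂ[X]) (lam : ℂ)
    (hX : ∀ l, Xl N lam l ≠ 0)
    (h0 : ∀ M : ℤ, opP a N lam O (yS a N lam (gb2 a g)) M = 0) :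
    ∑ i ∈ Finset.range (a + 1), algebraMap ℂ[X] KK (O i) * ((sg (N:ℂ))^[i]) (RR N m g) = 0 := by
  classical
  have hN := hS.hN
  set T := Finset.range (a + 1) ×ˢ Finset.range (m + 1) with hT
  set L : ℕ × ℕ → ℂ[X] := fun y => X - C ((N:ℂ) * y.1 + N * y.2) with hL
  set P : ℂ[X] := ∑ y ∈ T, O y.1 * C ((g y.2).coeff 0) * ∏ z ∈ T.erase y, L z with hP
  have hLne : ∀ y, algebraMap ℂ[X] KK (L y) ≠ 0 := by
    intro y
    rw [Ne, map_eq_zero_iff _ (IsFractionRing.injective ℂ[X] KK)]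
    exact X_sub_C_ne_zero _
  have hPz : P = 0 := by
    apply Polynomial.eq_zero_of_infinite_isRoot
    refine Set.infinite_of_injective_forall_mem (f := fun k : ℕ => tM N lam ((k + m + a : ℕ) : ℤ)) ?_ ?_
    · intro k k' h
      simp only [tM] at h
      have h' := add_right_cancel h
      have h2 := mul_left_cancel₀ (by exact_mod_cast hN.ne' : (N:ℂ) ≠ 0) h'
      have h3 : ((k + m + a : ℕ) : ℤ) = ((k' + m + a : ℕ) : ℤ) := by exact_mod_cast h2
      omega
    · intro k
      set t := tM N lam ((k + m + a : ℕ) : ℤ) with ht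
      change P.eval t = 0
      have hLt : ∀ y ∈ T, (L y).eval t ≠ 0 := by
        intro y hy
        simp only [hT, Finset.mem_product, Finset.mem_range] at hy
        have := hX (k + m + a - y.1 - y.2)
        simp only [hL, eval_sub, eval_X, eval_C]
        intro h
        apply this
        rw [← h, ht]
        unfold Xl tM
        rw [Nat.cast_sub (by omega), Nat.cast_sub (by omega)]
        push_cast; ring
      have h1 : P.eval t = (∏ z ∈ T, (L z).eval t) * ∑ y ∈ T, (O y.1).eval t * ((g y.2).coeff 0 * ((L y).eval t)⁻¹) := by
        rw [hP, eval_finsetSum, Finset.mul_sum]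
        apply Finset.sum_congr rfl
        intro y hy
        rw [← Finset.mul_prod_erase T _ hy]
        simp only [eval_mul, eval_C, eval_prod]
        have := hLt y hy
        field_simp
      rw [h1, hT, Finset.sum_product, ← mul_zero (∏ z ∈ T, (L z).eval t), ← h0 ((k + m + a : ℕ) : ℤ)]
      congr 1
      unfold opP
      apply Finset.sum_congr rfl
      intro i hi
      have hi := Finset.mem_range.1 hi
      have e1 : ((k + m + a : ℕ) : ℤ) - i = ((k + m + a - i : ℕ) : ℤ) := by
        rw [Nat.cast_sub (by omega)]
      rw [e1, yS2_big hS lam hX _ (by omega), Finset.mul_sum]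
      apply Finset.sum_congr rfl
      intro h _
      simp only [hL, eval_sub, eval_X, eval_C]
      have e2 : tM N lam ((k + m + a - i : ℕ) : ℤ) - N * h = t - (N * i + N * h) := by
        rw [← e1, ht]; unfold tM; push_cast; ring
      rw [e2]
  have h2 : (∏ z ∈ T, algebraMap ℂ[X] KK (L z)) * ∑ i ∈ Finset.range (a + 1), algebraMap ℂ[X] KK (O i) * ((sg (N:ℂ))^[i]) (RR N m g) = algebraMap ℂ[X] KK P := by
    rw [hP, map_sum]
    simp only [RR_shift, Finset.mul_sum]
    rw [hT, Finset.sum_product]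
    apply Finset.sum_congr rfl
    intro i hi
    apply Finset.sum_congr rfl
    intro h hh
    have hy : (i, h) ∈ T := by rw [hT]; exact Finset.mem_product.2 ⟨hi, hh⟩
    rw [← hT, ← Finset.mul_prod_erase T _ hy]
    simp only [map_mul, map_prod]
    rw [IsScalarTower.algebraMap_apply ℂ ℂ[X] KK]
    rw [show (algebraMap ℂ ℂ[X]) ((g h).coeff 0) = C ((g h).coeff 0) from rfl]
    have key : ∀ u p o c : KK, u ≠ 0 → u * p * (o * (c * u⁻¹)) = o * c * p := by
      intro u p o c hu; field_simp
    exact key _ _ _ _ (hLne (i, h))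
  rw [hPz, map_zero] at h2
  refine (mul_eq_zero.1 h2).resolve_left ?_
  exact Finset.prod_ne_zero_iff.2 (fun z _ => hLne z)

theorem RR_pole (hS : Setup a N m q Kb A B Nm g) : ∃ ρ : PowerSeries ℂ,
    PowerSeries.constantCoeff ρ ≠ 0 ∧ exK 0 (RR N m g) * (algebraMap (PowerSeries ℂ) LL PowerSeries.X) ^ 1
        = algebraMap (PowerSeries ℂ) LL ρ := by
  have hN := hS.hN
  have hcc : ∀ x : ℂ, exK 0 (algebraMap ℂ KK x) = algebraMap (PowerSeries ℂ) LL (PowerSeries.C x) := by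
    intro x
    rw [IsScalarTower.algebraMap_apply ℂ ℂ[X] KK, exK_alg]
    congr 1
    exact exS_C 0 x
  have hinj := IsFractionRing.injective (PowerSeries ℂ) LL
  have hX0 : algebraMap (PowerSeries ℂ) LL PowerSeries.X ≠ 0 := by
    rw [Ne, map_eq_zero_iff _ hinj]; exact PowerSeries.X_ne_zero
  have key : ∀ y : ℂ[X], PowerSeries.constantCoeff (exS 0 y) ≠ 0 → ∀ x,
      exK 0 (algebraMap ℂ KK x * (algebraMap ℂ[X] KK y)⁻¹) =
        algebraMap (PowerSeries ℂ) LL (PowerSeries.C x * (exS 0 y)⁻¹) := by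
    intro y h3 x
    rw [map_mul, map_mul, hcc, map_inv₀, exK_alg]
    congr 1
    apply inv_eq_of_mul_eq_one_left
    rw [← map_mul, PowerSeries.inv_mul_cancel _ h3, map_one]
  refine ⟨PowerSeries.C ((g 0).coeff 0) + PowerSeries.X * ∑ h ∈ Finset.range m,
    PowerSeries.C ((g (h + 1 : ℕ)).coeff 0) * (exS 0 (X - C ((N:ℂ) * (h + 1 : ℕ))))⁻¹, ?_, ?_⟩
  · simp only [map_add, map_mul, PowerSeries.constantCoeff_C, PowerSeries.constantCoeff_X, zero_mul, add_zero]
    exact hS.g_ne 0 le_rfl (by omega)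
  · unfold RR
    rw [Finset.sum_range_succ', map_add, map_sum, add_mul, map_add, add_comm, pow_one]
    congr 1
    · rw [map_mul, map_inv₀, exK_alg, hcc]
      have : exS 0 (X - C ((N:ℂ) * (0:ℕ))) = PowerSeries.X := by
        rw [Nat.cast_zero, mul_zero, C_0, sub_zero, exS_X]; simp
      rw [this, mul_assoc, inv_mul_cancel₀ hX0, mul_one]
      rfl
    · rw [map_mul, mul_comm, map_sum]
      congr 1
      apply Finset.sum_congr rfl
      intro h _
      apply key
      rw [exS_const]
      simp only [eval_sub, eval_X, eval_C, zero_sub, Ne, neg_eq_zero]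
      exact mul_ne_zero (by exact_mod_cast hN.ne') (by exact_mod_cast Nat.succ_ne_zero h)

theorem N1 (hS : Setup a N m q Kb A B Nm g) (ha2 : 2 ≤ a) (O : ℕ → ℂ[X]) (D : ℕ)
    (haK : a + D ≤ Kb) (lam : ℂ)
    (hX : ∀ l, Xl N lam l ≠ 0) (hO : ∀ i, (O i).natDegree ≤ D)
    (hOne : ∃ i ≤ a, O i ≠ 0)
    (h1 : (X : Polynomial ℂ[X]) ^ a ∣ ∑ i ∈ Finset.range (a + 1),
        C (O i) * bi 0 (num A B N a i)) :
    (ZZ a N D (a + D) A B lam O).coeff 0 ≠ 0 := by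
  intro hZ
  have hR := kill_RR hS O lam hX (opP_zero hS O D haK lam hX hO h1 hZ)
  obtain ⟨i, hi, hne⟩ := hOne
  apply hne
  set v : ℕ → KK := fun e => if e < a then PowerSeries.coeff e (FF a N m Nm 0) else RR N m g with hv
  have hp : ∀ e, ∃ ρ : PowerSeries ℂ, PowerSeries.constantCoeff ρ ≠ 0 ∧ exK 0 (v e) *
      (algebraMap (PowerSeries ℂ) LL PowerSeries.X) ^ (if e < a then a + e else 1)
        = algebraMap (PowerSeries ℂ) LL ρ := by
    intro e
    by_cases he : e < a
    · simp only [hv, he, if_true]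
      apply pole_lemma 0 a hS.ha (FF a N m Nm 0) (bi 0 (DnE a N m 0)) (bi 0 Nm)
      · have h2 := FF_mul a N m Nm 0
        rw [Dn_split 0 0 (Nat.zero_le _), map_mul, map_pow] at h2
        rw [← h2]
        simp; ring
      · rw [bi_coeff_zero]
        have := DnE_ne (a := a) (m := m) hS.hN 0
        simpa using this
      · rw [bi_coeff_zero]
        have := hS.Nm_ne 0 (Nat.zero_le _)
        simpa using this
    · simp only [hv, he, if_false]
      exact RR_pole hS
  choose ρ hρ0 hρ using hp
  refine casK N hS.hN (a + 1) v ?_ O ?_ i (by omega)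
  · intro c hc
    apply indep_poles 0 (a + 1) v (fun e => if e < a then a + e else 1) ρ _ _ (fun i _ => hρ0 i)
      (fun i _ => hρ i) c 0
    · have h3 := congrArg (exK 0) hc
      rw [map_sum, map_zero] at h3
      simp only [map_mul] at h3
      rw [h3, map_zero]
    · intro i hi j hj hij
      split_ifs at hij <;> omega
    · intro i _
      split_ifs <;> omega
  · intro j hj
    by_cases hja : j < a
    · simp only [hv, hja, if_true]
      exact killF hS O h1 j hja
    · simp only [hv, hja, if_false]
      exact hR

end ZE
end


section
open Polynomial

namespace ZE

variable {a N m q Kb : ℕ} {A B Nm : ℂ[X]} {g : ℤ → ℂ[X]}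

theorem sum_range_mul' {M : Type*} [AddCommMonoid M] (N a : ℕ) (f : ℕ → M) :
    ∑ j ∈ Finset.range (N * a), f j = ∑ l ∈ Finset.range N, ∑ e ∈ Finset.range a, f (l * a + e) := by
  induction N with
  | zero => simp
  | succ N ih => rw [Nat.succ_mul, Finset.sum_range_add, ih, Finset.sum_range_succ]

noncomputable def Phi (a N m D : ℕ) (Nm : ℂ[X]) (O : ℕ → ℂ[X]) (lam : ℂ) : PowerSeries KK :=
  ∑ τ ∈ TT a D, em (Wc a N D lam O τ) * (SG (N:ℂ))^[τ.1 + τ.2] (FF a N m Nm lam)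

noncomputable def Zi (a N D K' : ℕ) (A B : ℂ[X]) (O : ℕ → ℂ[X]) (lam : ℂ) (i : ℕ) : Polynomial ℂ[X] :=
  ∑ τ ∈ TT a D, shp (i * N) (Wc a N D lam O τ) * bi lam (num A B N K' (τ.1 + τ.2 + i))

theorem mem_TT {D : ℕ} {τ : ℕ × ℕ} (hτ : τ ∈ TT a D) : τ.1 + τ.2 ≤ a + D := by
  simp only [TT, Finset.mem_product, Finset.mem_range] at hτ; omega

theorem Phi_shift (hS : Setup a N m q Kb A B Nm g) (O : ℕ → ℂ[X]) (D : ℕ) (lam : ℂ) (K' i : ℕ)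
    (hi : a + D + i ≤ K') :
    em (bi lam (num A B N K' 0)) * (SG (N:ℂ))^[i] (Phi a N m D Nm O lam) =
      em (Zi a N D K' A B O lam i) * FF a N m Nm lam := by
  unfold Phi Zi
  rw [← RingHom.coe_pow, map_sum, map_sum, Finset.mul_sum, Finset.sum_mul]
  apply Finset.sum_congr rfl
  intro τ hτ
  have h1 := mem_TT hτ
  rw [map_mul, RingHom.coe_pow, SG_iter_em, ← Function.iterate_add_apply, add_comm i]
  have := FF_chain hS lam K' (τ.1 + τ.2 + i) (by omega)
  rw [map_mul]
  linear_combination em (shp (i * N) (Wc a N D lam O τ)) * this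

theorem shp_zero (G : Polynomial ℂ[X]) : shp 0 G = G := by
  ext1 e; simp [shp]

theorem Zi_zero (D K : ℕ) (O : ℕ → ℂ[X]) (lam : ℂ) :
    Zi a N D K A B O lam 0 = ZZ a N D K A B lam O := by
  unfold Zi ZZ
  simp [shp_zero]

theorem mul_coeff_deg (G H : Polynomial ℂ[X]) (x y : ℕ) (hG : ∀ e, (G.coeff e).natDegree ≤ x)
    (hH : ∀ e, (H.coeff e).natDegree ≤ y) (e : ℕ) : ((G * H).coeff e).natDegree ≤ x + y := by
  rw [coeff_mul]
  apply natDegree_sum_le_of_forall_le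
  intro p _
  exact natDegree_mul_le.trans (Nat.add_le_add (hG _) (hH _))

theorem Wc_deg (D : ℕ) (O : ℕ → ℂ[X]) (hO : ∀ i, (O i).natDegree ≤ D) (lam : ℂ) (τ : ℕ × ℕ) (e : ℕ) :
    ((Wc a N D lam O τ).coeff e).natDegree ≤ D := by
  unfold Wc
  rw [finsetSum_coeff]
  apply natDegree_sum_le_of_forall_le
  intro i _
  rw [coeff_C_mul, coeff_map, mul_comm]
  refine (natDegree_C_mul_le _ _).trans ((natDegree_C_mul_le _ _).trans ?_)
  rw [natDegree_comp_sub]; exact hO _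

theorem Zi_deg (hS : Setup a N m q Kb A B Nm g) (D : ℕ) (O : ℕ → ℂ[X]) (hO : ∀ i, (O i).natDegree ≤ D)
    (lam : ℂ) (K' i : ℕ) (hi : a + D + i ≤ K') (e : ℕ) :
    ((Zi a N D K' A B O lam i).coeff e).natDegree ≤ D + K' * q := by
  unfold Zi
  rw [finsetSum_coeff]
  apply natDegree_sum_le_of_forall_le
  intro τ hτ
  have := mem_TT hτ
  apply mul_coeff_deg
  · intro e
    simp only [shp, coe_mapRingHom, coeff_map, coe_compRingHom_apply]
    rw [natDegree_comp_sub]; exact Wc_deg D O hO lam τ e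
  · intro e
    exact (bi_coeff_deg _ _ _).trans (num_deg hS.degA hS.degB N K' _ (by omega))

theorem exists_nonroot (p : ℂ[X]) (hp : p ≠ 0) (M : ℕ) (hM : p.natDegree < M) (f : ℕ → ℂ)
    (hf : Function.Injective f) : ∃ h < M, p.eval (f h) ≠ 0 := by
  by_contra hcon
  push Not at hcon
  apply hp
  apply Polynomial.eq_zero_of_natDegree_lt_card_of_eval_eq_zero p (f := fun i : Fin M => f i)
  · intro i j h; exact Fin.ext (hf h)
  · intro i; exact hcon i i.2
  · simpa using hM

noncomputable def lm (l : ℕ) : ℂ := (l : ℂ) + 1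

theorem Xl_ne (l k : ℕ) : Xl N (lm l) k ≠ 0 := by
  unfold Xl lm
  have : ((N * k + (l + 1) : ℕ) : ℂ) ≠ 0 := Nat.cast_ne_zero.2 (by omega)
  push_cast at this; exact this

theorem Phi_mul (hS : Setup a N m q Kb A B Nm g) (O : ℕ → ℂ[X]) (D : ℕ) (lam : ℂ) :
    Phi a N m D Nm O lam * em (bi lam (num A B N (a + D) 0)) * em (bi lam (Dn a N m)) =
      em (ZZ a N D (a + D) A B lam O * bi lam Nm) := by
  have h1 := Phi_shift hS O D lam (a + D) 0 (by omega)
  rw [Zi_zero] at h1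
  have h2 := FF_mul a N m Nm lam
  simp only [Function.iterate_zero, id] at h1
  rw [map_mul]
  linear_combination em (bi lam (Dn a N m)) * h1 + em (ZZ a N D (a + D) A B lam O) * h2

theorem Phi_pole (hS : Setup a N m q Kb A B Nm g) (O : ℕ → ℂ[X]) (D : ℕ) (haK : a + D ≤ Kb) (lam : ℂ)
    (h0 : ℕ) (hh : h0 ≤ m)
    (hZ : ((ZZ a N D (a + D) A B lam O).coeff 0).eval (lam + N * h0) ≠ 0) (e : ℕ) :
    ∃ ρ : PowerSeries ℂ, PowerSeries.constantCoeff ρ ≠ 0 ∧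
      exK (lam + N * h0) (PowerSeries.coeff e (Phi a N m D Nm O lam)) *
        (algebraMap (PowerSeries ℂ) LL PowerSeries.X) ^ (a + e)
        = algebraMap (PowerSeries ℂ) LL ρ := by
  apply pole_lemma _ a hS.ha _ (bi lam (num A B N (a + D) 0) * bi lam (DnE a N m h0))
    (ZZ a N D (a + D) A B lam O * bi lam Nm)
  · rw [← Phi_mul hS O D lam, Dn_split lam h0 hh]
    simp only [map_mul, map_pow]
    ring
  · rw [mul_coeff_zero, bi_coeff_zero, bi_coeff_zero]
    simp only [eval_mul, eval_comp, eval_sub, eval_X, eval_C, add_sub_cancel_left]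
    refine mul_ne_zero ?_ (DnE_ne hS.hN h0)
    have := num_zero_eval hS (a + D) haK h0 (by omega) (by omega)
    exact_mod_cast this
  · rw [mul_coeff_zero, bi_coeff_zero]
    simp only [eval_mul, eval_comp, eval_sub, eval_X, eval_C, add_sub_cancel_left]
    exact mul_ne_zero hZ (hS.Nm_ne h0 hh)

theorem Phi_reg (hS : Setup a N m q Kb A B Nm g)
    (hAZ : ∀ T : ℤ, -(N * Kb : ℤ) ≤ T → T ≤ N * m - N → A.eval (T : ℂ) ≠ 0)
    (O : ℕ → ℂ[X]) (D : ℕ) (haK : a + D + 1 ≤ Kb)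
    (l l' : ℕ) (hl : l < N) (hl' : l' < N) (hne : l ≠ l') (h0 : ℕ) (hh : h0 < m) (e : ℕ) :
    ∃ ρ : PowerSeries ℂ,
      exK (lm l + N * h0) (PowerSeries.coeff e (Phi a N m D Nm O (lm l'))) =
        algebraMap (PowerSeries ℂ) LL ρ := by
  apply reg_lemma _ _ (bi (lm l') (num A B N (a + D) 0) * bi (lm l') (Dn a N m))
    (ZZ a N D (a + D) A B (lm l') O * bi (lm l') Nm)
  · rw [← Phi_mul hS O D (lm l'), map_mul]; ring
  · rw [mul_coeff_zero, bi_coeff_zero, bi_coeff_zero]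
    simp only [eval_mul, eval_comp, eval_sub, eval_X, eval_C]
    have e1 : lm l + (N:ℂ) * h0 - lm l' = ((l - l' + N * h0 : ℤ) : ℂ) := by
      unfold lm; push_cast; ring
    rw [e1]
    refine mul_ne_zero ?_ ?_
    · unfold num
      simp only [Finset.range_zero, Finset.prod_empty, one_mul, eval_prod, eval_comp, eval_sub, eval_X,
        eval_C]
      rw [Finset.prod_ne_zero_iff]
      intro k hk
      have hk := (Finset.mem_Ico.1 hk).2
      have e2 : ((l - l' + N * h0 : ℤ) : ℂ) - N * (k + 1) = ((l - l' + N * h0 - N * (k + 1) : ℤ) : ℂ) := by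
        push_cast; ring
      rw [e2]
      apply hAZ
      · have h1 : (N:ℤ) * (k + 2) ≤ N * Kb := by
          apply mul_le_mul_of_nonneg_left <;> omega
        have h2 : (0:ℤ) ≤ N * h0 := by positivity
        linarith [show (l':ℤ) < N by exact_mod_cast hl', show (0:ℤ) ≤ l by positivity]
      · have h1 : (N:ℤ) * (h0 + 1) ≤ N * m := by
          apply mul_le_mul_of_nonneg_left <;> omega
        have h2 : (0:ℤ) ≤ N * k := by positivity
        linarith [show (l:ℤ) < N by exact_mod_cast hl, show (0:ℤ) ≤ l' by positivity]
    · unfold Dn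
      rw [eval_prod, Finset.prod_ne_zero_iff]
      intro h _
      simp only [eval_pow, eval_sub, eval_X, eval_C]
      apply pow_ne_zero
      have e2 : ((l - l' + N * h0 : ℤ) : ℂ) - N * h = ((l - l' + N * h0 - N * h : ℤ) : ℂ) := by
        push_cast; ring
      rw [e2]
      have : (l - l' + N * h0 - N * h : ℤ) ≠ 0 := by
        intro h3
        have h4 : (N:ℤ) ∣ (l - l' : ℤ) := ⟨h - h0, by linarith⟩
        have h5 := Int.eq_zero_of_abs_lt_dvd h4 (by rw [abs_lt]; constructor <;> omega)
        omega
      exact_mod_cast this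

theorem Phi_indep (hS : Setup a N m q Kb A B Nm g)
    (hAZ : ∀ T : ℤ, -(N * Kb : ℤ) ≤ T → T ≤ N * m - N → A.eval (T : ℂ) ≠ 0)
    (O : ℕ → ℂ[X]) (D : ℕ) (haK : a + D + 1 ≤ Kb) (hO : ∀ i, (O i).natDegree ≤ D)
    (hm : D + (a + D) * q < m)
    (hZ : ∀ l < N, (ZZ a N D (a + D) A B (lm l) O).coeff 0 ≠ 0) (c : ℕ → ℂ)
    (hc : ∑ j ∈ Finset.range (N * a), algebraMap ℂ KK (c j) *
      PowerSeries.coeff (j % a) (Phi a N m D Nm O (lm (j / a))) = 0) : ∀ j < N * a, c j = 0 := by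
  have ha := hS.ha
  rw [sum_range_mul'] at hc
  have hc2 : ∑ l ∈ Finset.range N, ∑ e ∈ Finset.range a, algebraMap ℂ KK (c (l * a + e)) *
      PowerSeries.coeff e (Phi a N m D Nm O (lm l)) = 0 := by
    rw [← hc]
    apply Finset.sum_congr rfl
    intro l _
    apply Finset.sum_congr rfl
    intro e he
    have he := Finset.mem_range.1 he
    have e1 : (l * a + e) % a = e := by rw [Nat.mul_add_mod', Nat.mod_eq_of_lt he]
    have e2 : (l * a + e) / a = l := by
      rw [mul_comm, Nat.mul_add_div ha, Nat.div_eq_of_lt he, add_zero]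
    rw [e1, e2]
  intro j hj
  have hl : j / a < N := Nat.div_lt_of_lt_mul (by rwa [mul_comm])
  set l := j / a with hldef
  have hdeg : ((ZZ a N D (a + D) A B (lm l) O).coeff 0).natDegree < m := by
    rw [← Zi_zero]
    exact lt_of_le_of_lt (Zi_deg hS D O hO (lm l) (a + D) 0 (by omega) 0) hm
  obtain ⟨h0, hh0, hev⟩ := exists_nonroot _ (hZ l hl) m hdeg (fun h => lm l + N * h) (by
    intro h h' hh
    have h2 := mul_left_cancel₀ (by exact_mod_cast hS.hN.ne' : (N:ℂ) ≠ 0) (add_left_cancel hh)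
    exact_mod_cast h2)
  set α := lm l + (N:ℂ) * h0 with hα
  have hp := Phi_pole hS O D (by omega) (lm l) h0 hh0.le hev
  choose ρ hρ0 hρ using hp
  have hcc : ∀ x : ℂ, exK α (algebraMap ℂ KK x) = algebraMap (PowerSeries ℂ) LL (PowerSeries.C x) := by
    intro x
    rw [IsScalarTower.algebraMap_apply ℂ ℂ[X] KK, exK_alg]
    congr 1
    exact exS_C α x
  have hreg : ∃ ρ0 : PowerSeries ℂ, ∑ l' ∈ (Finset.range N).erase l, ∑ e ∈ Finset.range a,
      exK α (algebraMap ℂ KK (c (l' * a + e))) *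
      exK α (PowerSeries.coeff e (Phi a N m D Nm O (lm l'))) = algebraMap (PowerSeries ℂ) LL ρ0 := by
    have hr : ∀ l' e, ∃ ρ0 : PowerSeries ℂ, l' ∈ (Finset.range N).erase l →
        exK α (PowerSeries.coeff e (Phi a N m D Nm O (lm l'))) = algebraMap (PowerSeries ℂ) LL ρ0 := by
      intro l' e
      by_cases h : l' ∈ (Finset.range N).erase l
      · rw [Finset.mem_erase, Finset.mem_range] at h
        obtain ⟨ρ0, h2⟩ := Phi_reg hS hAZ O D haK l l' hl h.2 h.1.symm h0 hh0 e
        exact ⟨ρ0, fun _ => h2⟩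
      · exact ⟨0, fun h' => absurd h' h⟩
    choose r hr using hr
    refine ⟨∑ l' ∈ (Finset.range N).erase l, ∑ e ∈ Finset.range a,
      PowerSeries.C (c (l' * a + e)) * r l' e, ?_⟩
    rw [map_sum]
    apply Finset.sum_congr rfl
    intro l' hl'
    rw [map_sum]
    apply Finset.sum_congr rfl
    intro e _
    rw [map_mul, hcc, hr l' e hl']
  obtain ⟨ρ0, hρ0'⟩ := hreg
  have key := indep_poles α a (fun e => PowerSeries.coeff e (Phi a N m D Nm O (lm l))) (fun e => a + e) ρ
    (fun i _ j _ h => by omega) (fun i _ => by omega) (fun i _ => hρ0 i) (fun i _ => hρ i)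
    (fun e => c (l * a + e)) (-ρ0) (by
      have h3 := congrArg (exK α) hc2
      rw [map_zero, map_sum, ← Finset.add_sum_erase _ _ (Finset.mem_range.2 hl)] at h3
      simp only [map_sum, map_mul] at h3
      rw [hρ0'] at h3
      rw [map_neg]
      exact eq_neg_of_add_eq_zero_left h3)
  have := key (j % a) (Nat.mod_lt _ ha)
  rw [hldef] at this
  rwa [mul_comm, Nat.div_add_mod] at this

/-- the combined symbol -/
noncomputable def Xi (a N D K' : ℕ) (A B : ℂ[X]) (O O' : ℕ → ℂ[X]) (lam : ℂ) : Polynomial ℂ[X] :=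
  ∑ i ∈ Finset.range (N * a), C (O' i) * Zi a N D K' A B O lam i

theorem step2 (hS : Setup a N m q Kb A B Nm g)
    (hAZ : ∀ T : ℤ, -(N * Kb : ℤ) ≤ T → T ≤ N * m - N → A.eval (T : ℂ) ≠ 0)
    (O : ℕ → ℂ[X]) (D : ℕ) (haK : a + D + 1 ≤ Kb) (hO : ∀ i, (O i).natDegree ≤ D)
    (hm : D + (a + D) * q < m)
    (hZ : ∀ l < N, (ZZ a N D (a + D) A B (lm l) O).coeff 0 ≠ 0)
    (K' : ℕ) (hK' : K' = a + D + N * a) (l0 : ℕ) (hl0 : l0 < N) :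
    ∃ O' : ℕ → ℂ[X], (∀ i, (O' i).natDegree ≤ N * a * (D + K' * q)) ∧
      (∀ l < N, l ≠ l0 → (X : Polynomial ℂ[X]) ^ a ∣ Xi a N D K' A B O O' (lm l)) ∧
      ((X : Polynomial ℂ[X]) ^ (a - 1) ∣ Xi a N D K' A B O O' (lm l0)) ∧
      (Xi a N D K' A B O O' (lm l0)).coeff (a - 1) ≠ 0 := by
  classical
  have ha := hS.ha
  have hlt : l0 * a + (a - 1) < N * a := by
    calc l0 * a + (a - 1) < (l0 + 1) * a := by rw [Nat.succ_mul]; omega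
      _ ≤ N * a := Nat.mul_le_mul_right _ hl0
  set j0 : Fin (N * a) := ⟨l0 * a + (a - 1), hlt⟩ with hj0
  have hcard : Fintype.card {j : Fin (N * a) // j ≠ j0} < Fintype.card (Fin (N * a)) := by
    exact Fintype.card_subtype_lt (x := j0) (by simp)
  obtain ⟨c, ⟨i1, hi1⟩, hcd, hc⟩ := lemmaA hcard (D + K' * q)
    (fun (j : {j : Fin (N * a) // j ≠ j0}) (i : Fin (N * a)) =>
      (Zi a N D K' A B O (lm (j.1 / a)) i).coeff (j.1 % a))
    (fun j i => Zi_deg hS D O hO _ K' i (by have := i.2; omega) _)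
  set O' : ℕ → ℂ[X] := fun i => if h : i < N * a then c ⟨i, h⟩ else 0 with hO'
  have hsum : ∀ (lam : ℂ) e, (Xi a N D K' A B O O' lam).coeff e =
      ∑ i : Fin (N * a), (Zi a N D K' A B O lam i).coeff e * c i := by
    intro lam e
    unfold Xi
    rw [finsetSum_coeff, Finset.sum_range]
    apply Finset.sum_congr rfl
    intro i _
    rw [coeff_C_mul]
    have h1 : O' i = c i := by simp only [hO']; rw [dif_pos i.2]
    rw [h1, mul_comm]
  have hzero : ∀ l < N, ∀ e < a, (l ≠ l0 ∨ e ≠ a - 1) → (Xi a N D K' A B O O' (lm l)).coeff e = 0 := by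
    intro l hl e he hle
    have hlt2 : l * a + e < N * a := by
      calc l * a + e < (l + 1) * a := by rw [Nat.succ_mul]; omega
        _ ≤ N * a := Nat.mul_le_mul_right _ hl
    have e1 : (l * a + e) % a = e := by rw [Nat.mul_add_mod', Nat.mod_eq_of_lt he]
    have e2 : (l * a + e) / a = l := by
      rw [mul_comm, Nat.mul_add_div ha, Nat.div_eq_of_lt he, add_zero]
    have e3 : (l0 * a + (a-1)) % a = a - 1 := by rw [Nat.mul_add_mod', Nat.mod_eq_of_lt (by omega)]
    have e4 : (l0 * a + (a-1)) / a = l0 := by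
      rw [mul_comm, Nat.mul_add_div ha, Nat.div_eq_of_lt (by omega), add_zero]
    have hne : (⟨l * a + e, hlt2⟩ : Fin (N * a)) ≠ j0 := by
      intro h
      have h' : l * a + e = l0 * a + (a - 1) := congrArg Fin.val h
      rcases hle with h1 | h1
      · apply h1; rw [← e2, h', e4]
      · apply h1; rw [← e1, h', e3]
    have := hc ⟨⟨l * a + e, hlt2⟩, hne⟩
    dsimp only at this
    rw [e1, e2] at this
    rw [hsum, this]
  refine ⟨O', ?_, ?_, ?_, ?_⟩
  · intro i
    simp only [hO']
    split_ifs with h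
    · refine (hcd _).trans (Nat.mul_le_mul_right _ ?_)
      have := hcard.le
      rwa [Fintype.card_fin] at this
    · simp
  · intro l hl hne
    rw [X_pow_dvd_iff]
    intro e he
    exact hzero l hl e he (Or.inl hne)
  · rw [X_pow_dvd_iff]
    intro e he
    exact hzero l0 hl0 e (by omega) (Or.inr (by omega))
  · intro hκ
    have hall : ∀ l < N, (X : Polynomial ℂ[X]) ^ a ∣ Xi a N D K' A B O O' (lm l) := by
      intro l hl
      rw [X_pow_dvd_iff]
      intro e he
      by_cases h : l ≠ l0 ∨ e ≠ a - 1
      · exact hzero l hl e he h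
      · push Not at h
        rw [h.1, h.2, hκ]
    have hcas := casK N hS.hN (N * a)
      (fun j => PowerSeries.coeff (j % a) (Phi a N m D Nm O (lm (j / a))))
      (Phi_indep hS hAZ O D haK hO hm hZ) O' (by
        intro j hj
        have hl : j / a < N := Nat.div_lt_of_lt_mul (by rwa [mul_comm])
        have := low_coeff a (em (bi (lm (j / a)) (num A B N K' 0)))
          (∑ i ∈ Finset.range (N * a), em (C (O' i)) * (SG (N:ℂ))^[i] (Phi a N m D Nm O (lm (j / a))))
          (FF a N m Nm (lm (j / a))) _
          (cc_em_bi _ (num_ne hS K' 0)) (by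
            unfold Xi
            rw [Finset.mul_sum, map_sum, Finset.sum_mul]
            apply Finset.sum_congr rfl
            intro i hi
            have hi := Finset.mem_range.1 hi
            have h2 := Phi_shift hS O D (lm (j/a)) K' i (by omega)
            rw [map_mul]
            linear_combination em (C (O' i)) * h2) (hall _ hl) (j % a) (Nat.mod_lt _ ha)
        rw [← this, map_sum]
        apply Finset.sum_congr rfl
        intro i _
        have : em (C (O' i)) = PowerSeries.C (algebraMap ℂ[X] KK (O' i)) := by
          ext e
          rw [coeff_em, coeff_C, PowerSeries.coeff_C]
          split_ifs <;> simp
        rw [this, PowerSeries.coeff_C_mul, coeff_SG_iter]) i1 i1.2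
    apply hi1
    simpa [hO'] using hcas

theorem Xi_deg (hS : Setup a N m q Kb A B Nm g) (D : ℕ) (O : ℕ → ℂ[X]) (hO : ∀ i, (O i).natDegree ≤ D)
    (lam : ℂ) (K' : ℕ) (hK' : K' = a + D + N * a) (O' : ℕ → ℂ[X]) (D' : ℕ)
    (hO' : ∀ i, (O' i).natDegree ≤ D') (e : ℕ) :
    ((Xi a N D K' A B O O' lam).coeff e).natDegree ≤ D' + (D + K' * q) := by
  unfold Xi
  rw [finsetSum_coeff]
  apply natDegree_sum_le_of_forall_le
  intro i hi
  have hi := Finset.mem_range.1 hi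
  rw [coeff_C_mul]
  exact natDegree_mul_le.trans (Nat.add_le_add (hO' _) (Zi_deg hS D O hO lam K' i (by omega) e))

end ZE
end


section
open Polynomial

namespace ZE

variable {a N m q Kb : ℕ} {A B Nm : ℂ[X]} {g : ℤ → ℂ[X]}

/-- general difference operator -/
noncomputable def op (I N : ℕ) (lam : ℂ) (c : ℕ → ℂ[X]) (f : ℤ → ℂ) (M : ℤ) : ℂ :=
  ∑ i ∈ Finset.range I, (c i).eval (tM N lam M) * f (M - i)

theorem ev_shp (t c : ℂ) (G : Polynomial ℂ[X]) : ev t (shp c G) = ev (t - c) G := by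
  ext e
  rw [ev_coeff, ev_coeff]
  simp [shp]

theorem tM_sub (lam : ℂ) (M : ℤ) (i : ℕ) : tM N lam (M - i) = tM N lam M - i * N := by
  unfold tM; push_cast; ring

noncomputable def SS (a N D : ℕ) (lam : ℂ) (O O' : ℕ → ℂ[X]) (g : ℤ → ℂ[X]) (M : ℤ) : ℂ[X] :=
  ∑ x ∈ Finset.range (N * a) ×ˢ TT a D,
    (C ((O' x.1).eval (tM N lam M)) * ev (tM N lam M - x.1 * N) (Wc a N D lam O x.2)) *
      g (M - (x.2.1 + x.2.2 + x.1 : ℕ))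

theorem op_zz (D : ℕ) (lam : ℂ) (O O' : ℕ → ℂ[X]) (M : ℤ) :
    op (N * a) N lam O' (zz a N D lam O g) M = (SS a N D lam O O' g M).coeff (a - 1) := by
  unfold op zz SS
  rw [Finset.sum_product, finsetSum_coeff]
  apply Finset.sum_congr rfl
  intro i _
  rw [← coeff_C_mul, Finset.mul_sum]
  congr 1
  apply Finset.sum_congr rfl
  intro τ _
  rw [tM_sub]
  have : M - (i:ℤ) - ((τ.1 + τ.2 : ℕ) : ℤ) = M - ((τ.1 + τ.2 + i : ℕ) : ℤ) := by push_cast; ring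
  rw [this]
  ring

theorem ev_Xi (D K' : ℕ) (lam : ℂ) (O O' : ℕ → ℂ[X]) (M : ℤ) :
    ev (tM N lam M) (Xi a N D K' A B O O' lam) =
    ∑ x ∈ Finset.range (N * a) ×ˢ TT a D,
    (C ((O' x.1).eval (tM N lam M)) * ev (tM N lam M - x.1 * N) (Wc a N D lam O x.2)) *
      (num A B N K' (x.2.1 + x.2.2 + x.1)).comp (C ((N:ℂ) * M) - X) := by
  unfold Xi Zi
  rw [Finset.sum_product, map_sum]
  apply Finset.sum_congr rfl
  intro i _
  rw [map_mul, ev_C, map_sum, Finset.mul_sum]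
  apply Finset.sum_congr rfl
  intro τ _
  rw [map_mul, ev_shp, ev_bi, ← mul_assoc]
  have : tM N lam M - lam = (N:ℂ) * M := by unfold tM; ring
  rw [this]

theorem mem_idx {D K' : ℕ} (hK' : K' = a + D + N * a) (x : ℕ × ℕ × ℕ)
    (hx : x ∈ Finset.range (N * a) ×ˢ TT a D) : x.2.1 + x.2.2 + x.1 ≤ K' := by
  rw [Finset.mem_product, Finset.mem_range] at hx
  have := mem_TT hx.2
  omega

theorem op_zz_zero (hS : Setup a N m q Kb A B Nm g) (D K' : ℕ) (hK' : K' = a + D + N * a) (hKb : K' ≤ Kb)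
    (lam : ℂ) (O O' : ℕ → ℂ[X]) (hXi : (X : Polynomial ℂ[X]) ^ a ∣ Xi a N D K' A B O O' lam) (M : ℤ) :
    op (N * a) N lam O' (zz a N D lam O g) M = 0 := by
  have ha := hS.ha
  rw [op_zz]
  have h1 := map_dvd (ev (tM N lam M)) hXi
  rw [map_pow, show ev (tM N lam M) X = X from sub2_X _ _, ev_Xi] at h1
  have h2 := transfer hS K' hKb M _ _ (mem_idx hK') _ a le_rfl h1
  rw [X_pow_dvd_iff] at h2
  exact h2 (a-1) (by omega)

theorem op_zz_main (hS : Setup a N m q Kb A B Nm g) (D K' : ℕ) (hK' : K' = a + D + N * a) (hKb : K' ≤ Kb)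
    (lam : ℂ) (O O' : ℕ → ℂ[X]) (hXi : (X : Polynomial ℂ[X]) ^ (a-1) ∣ Xi a N D K' A B O O' lam) (M : ℤ) :
    (num A B N K' 0).eval ((N:ℂ) * M) * op (N * a) N lam O' (zz a N D lam O g) M =
      ((Xi a N D K' A B O O' lam).coeff (a-1)).eval (tM N lam M) * (g M).coeff 0 := by
  have ha := hS.ha
  rw [op_zz]
  have h1 := map_dvd (ev (tM N lam M)) hXi
  rw [map_pow, show ev (tM N lam M) X = X from sub2_X _ _] at h1
  have h1' := h1
  rw [ev_Xi] at h1
  have h2 := transfer hS K' hKb M _ _ (mem_idx hK') _ (a-1) (by omega) h1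
  have h3 := exchange_sum hS K' M 0 (by omega) _ _ (mem_idx (a := a) (N := N) (D := D) hK')
    (fun x => C ((O' x.1).eval (tM N lam M)) * ev (tM N lam M - x.1 * N) (Wc a N D lam O x.2))
  rw [← ev_Xi] at h3
  change X ^ (a-1) ∣ SS a N D lam O O' g M at h2
  change X ^ a ∣ _ * SS a N D lam O O' g M - _ at h3
  obtain ⟨s, hs⟩ := h2
  obtain ⟨x, hx⟩ := h1'
  rw [X_pow_dvd_iff] at h3
  have h4 := h3 (a-1) (by omega)
  rw [← ev_coeff, hs, hx]
  rw [hs, hx, coeff_sub, mul_left_comm, mul_assoc, coeff_X_pow_mul', coeff_X_pow_mul', if_pos le_rfl,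
    if_pos le_rfl, Nat.sub_self, mul_coeff_zero, mul_coeff_zero] at h4
  rw [coeff_X_pow_mul', coeff_X_pow_mul', if_pos le_rfl, if_pos le_rfl, Nat.sub_self]
  have h5 : ((num A B N K' 0).comp (C ((N:ℂ) * M) - X)).coeff 0 = (num A B N K' 0).eval ((N:ℂ)*M) := by
    rw [coeff_zero_eq_eval_zero, eval_comp]; simp
  rw [h5] at h4
  simp only [Nat.cast_zero, sub_zero] at h4
  linear_combination h4

end ZE
end


section
open Polynomial

namespace ZE

variable {a N m q Kb : ℕ} {A B Nm : ℂ[X]} {g : ℤ → ℂ[X]}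

/-- truncated moments -/
def Mom (N m : ℕ) (w : ℂ) (Γ : ℕ → ℂ) (f : ℕ → ℤ → ℂ) (c I : ℕ) : Prop :=
  ∀ φ : ℂ[X], φ.natDegree < c →
    (∀ l < N, ∀ M : ℕ, m ≤ M → M < m + I → φ.eval (tM N (lm l) M) = 0) →
    ∑ l ∈ Finset.range N, Γ l * ∑ M ∈ Finset.range m, w ^ M * (f l M * φ.eval (tM N (lm l) M)) = 0

theorem shift_sum (m i : ℕ) (w : ℂ) (f : ℤ → ℂ) (hf : ∀ M, M < 0 → f M = 0) (u v : ℕ → ℂ)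
    (huv : ∀ M, u (M + i) = v M) (hu : ∀ M, m ≤ M → M < m + i → u M = 0) :
    ∑ M ∈ Finset.range m, w ^ M * (f ((M:ℤ) - i) * u M) =
      w ^ i * ∑ M ∈ Finset.range m, w ^ M * (f M * v M) := by
  have h1 : ∑ M ∈ Finset.range m, w ^ M * (f ((M:ℤ) - i) * u M) =
      ∑ M ∈ Finset.range (m + i), w ^ M * (f ((M:ℤ) - i) * u M) := by
    apply Finset.sum_subset
    · intro x hx; simp only [Finset.mem_range] at *; omega
    · intro x hx hx2
      simp only [Finset.mem_range] at hx hx2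
      rw [hu x (by omega) hx]; ring
  rw [h1, add_comm m i, Finset.sum_range_add, Finset.mul_sum]
  have h2 : ∑ M ∈ Finset.range i, w ^ M * (f ((M:ℤ) - i) * u M) = 0 := by
    apply Finset.sum_eq_zero
    intro x hx
    have := Finset.mem_range.1 hx
    rw [hf _ (by omega)]; ring
  rw [h2, zero_add]
  apply Finset.sum_congr rfl
  intro M _
  rw [add_comm i M, huv]
  have : (((M + i : ℕ) : ℤ) - i) = M := by push_cast; ring
  rw [this]; ring

theorem Mom.op {w : ℂ} {Γ : ℕ → ℂ} {f : ℕ → ℤ → ℂ} {c0 I : ℕ} (h : Mom N m w Γ f c0 I)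
    (hf : ∀ l M, M < 0 → f l M = 0) (I' : ℕ) (c : ℕ → ℂ[X]) (D : ℕ) (hc : ∀ i, (c i).natDegree ≤ D) :
    Mom N m w Γ (fun l => ZE.op I' N (lm l) c (f l)) (c0 - D) (I + I') := by
  intro φ hφ hv
  have key : ∀ i < I', ∑ l ∈ Finset.range N, Γ l * ∑ M ∈ Finset.range m,
      w ^ M * (f l ((M:ℤ) - i) * (c i * φ).eval (tM N (lm l) M)) = 0 := by
    intro i hi
    have h1 : ∀ l < N, ∑ M ∈ Finset.range m, w ^ M * (f l ((M:ℤ) - i) * (c i * φ).eval (tM N (lm l) M)) =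
        w ^ i * ∑ M ∈ Finset.range m, w ^ M * (f l M *
          ((c i * φ).comp (X + C ((N:ℂ) * i))).eval (tM N (lm l) M)) := by
      intro l hl
      apply shift_sum m i w (f l) (hf l) (fun M => (c i * φ).eval (tM N (lm l) M))
      · intro M
        rw [eval_comp]
        congr 1
        simp only [tM, eval_add, eval_X, eval_C]; push_cast; ring
      · intro M h1 h2
        rw [eval_mul, hv l hl M h1 (by omega), mul_zero]
    have h2 := h ((c i * φ).comp (X + C ((N:ℂ) * i))) (by
        rw [natDegree_comp, natDegree_X_add_C, mul_one]
        have h3 := hc i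
        have := natDegree_mul_le (p := c i) (q := φ)
        omega) (by
        intro l hl M h1 h2
        rw [eval_comp]
        have : eval (tM N (lm l) M) (X + C ((N:ℂ) * i)) = tM N (lm l) ((M + i : ℕ) : ℤ) := by
          simp only [tM, eval_add, eval_X, eval_C]; push_cast; ring
        rw [this, eval_mul, hv l hl (M + i) (by omega) (by omega), mul_zero])
    calc _ = ∑ l ∈ Finset.range N, w ^ i * (Γ l * ∑ M ∈ Finset.range m, w ^ M * (f l M *
          ((c i * φ).comp (X + C ((N:ℂ) * i))).eval (tM N (lm l) M))) := by
          apply Finset.sum_congr rfl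
          intro l hl
          rw [h1 l (Finset.mem_range.1 hl)]; ring
      _ = 0 := by rw [← Finset.mul_sum, h2, mul_zero]
  have h3 := Finset.sum_eq_zero (fun i hi => key i (Finset.mem_range.1 hi))
  rw [← h3, Finset.sum_comm]
  apply Finset.sum_congr rfl
  intro l _
  rw [← Finset.mul_sum, Finset.sum_comm]
  congr 1
  apply Finset.sum_congr rfl
  intro M _
  unfold ZE.op
  rw [Finset.sum_mul, Finset.mul_sum]
  apply Finset.sum_congr rfl
  intro i _
  rw [eval_mul]; ring

theorem op_neg (I : ℕ) (lam : ℂ) (c : ℕ → ℂ[X]) (f : ℤ → ℂ) (hf : ∀ M, M < 0 → f M = 0) (M : ℤ)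
    (hM : M < 0) : op I N lam c f M = 0 := by
  unfold op
  apply Finset.sum_eq_zero
  intro i _
  rw [hf _ (by omega), mul_zero]

theorem yS_neg (lam : ℂ) (gb : ℤ → ℂ[X]) (M : ℤ) (hM : M < 0) : yS a N lam gb M = 0 := by
  unfold yS
  have : (M + 1).toNat = 0 := by omega
  rw [this]; simp

/-- the defect sequence -/
noncomputable def Ed (A B : ℂ[X]) (N : ℕ) (lam : ℂ) (d : ℤ → ℂ) (M : ℤ) : ℂ :=
  A.eval (tM N lam M - N) * d (M - 1) - B.eval (tM N lam M) * d M

theorem op_Ed (lam : ℂ) (c : ℕ → ℂ[X]) (hc : c a = 0) (d : ℤ → ℂ) (M : ℤ) :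
    op a N lam c (Ed A B N lam d) M = opP a N lam (opO A B N c) d M := by
  unfold opP
  have := opO_sum A B N c (evalRingHom (tM N lam M)) (fun i => d (M - i)) a
  simp only [coe_evalRingHom] at this
  rw [this, hc, eval_zero]
  unfold op Ed
  rw [zero_mul, zero_mul, sub_zero]
  apply Finset.sum_congr rfl
  intro i _
  rw [tM_sub]
  simp only [eval_comp, eval_sub, eval_X, eval_C]
  have e1 : M - (i:ℤ) - 1 = M - ((i + 1 : ℕ) : ℤ) := by push_cast; ring
  rw [e1]
  have e2 : tM N lam M - (i:ℂ) * N - N = tM N lam M - N * (i + 1) := by ring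
  have e3 : tM N lam M - (i:ℂ) * N = tM N lam M - N * i := by ring
  rw [e2, e3]

theorem op_opd (δ : ℕ) (lam : ℂ) (f : ℤ → ℂ) (M : ℤ) :
    op (δ + 1) N lam (fun i => C ((-1) ^ i * (δ.choose i : ℂ))) f M = opd δ f M := by
  unfold op opd
  simp only [eval_C]

noncomputable def cDc (a q : ℕ) : ℕ := (a - 1) * (q + a * q)
noncomputable def cD (a q : ℕ) : ℕ := cDc a q + q
noncomputable def cK (a N q : ℕ) : ℕ := a + cD a q + N * a
noncomputable def cD' (a N q : ℕ) : ℕ := N * a * (cD a q + cK a N q * q)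
noncomputable def cI (a N q : ℕ) : ℕ := a + (cD a q + 2) + N * a
noncomputable def ck (a N q : ℕ) : ℕ := cD' a N q + (cD a q + cK a N q * q) + N * cI a N q + 1
noncomputable def cC3 (a N q c2 : ℕ) : ℕ := c2 + N * cI a N q + 1 + cK a N q * q
noncomputable def cC0 (a N q c2 : ℕ) : ℕ := cC3 a N q c2 + cD' a N q + cDc a q

noncomputable def mm (N m : ℕ) (w : ℂ) (g : ℤ → ℂ[X]) (φ : ℂ[X]) : ℂ :=
  ∑ h ∈ Finset.range (m + 1), w ^ h * ((g h).coeff 0 * φ.eval ((N:ℂ) * h))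

theorem chi_exists (N m I : ℕ) : ∃ χ : ℂ[X], χ ≠ 0 ∧ χ.natDegree = N * I ∧
    (∀ l < N, ∀ M : ℕ, m ≤ M → M < m + I → χ.eval (tM N (lm l) M) = 0) := by
  refine ⟨∏ i ∈ Finset.range (N * I), (X - C ((N * m + 1 + i : ℕ) : ℂ)), ?_, ?_, ?_⟩
  · exact Finset.prod_ne_zero_iff.2 fun i _ => X_sub_C_ne_zero _
  · rw [natDegree_prod _ _ (fun i _ => X_sub_C_ne_zero _)]
    simp only [natDegree_X_sub_C]; simp
  · intro l hl M h1 h2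
    rw [eval_prod]
    obtain ⟨j, rfl⟩ := Nat.exists_eq_add_of_le h1
    apply Finset.prod_eq_zero (i := N * j + l)
    · rw [Finset.mem_range]
      calc N * j + l < N * (j + 1) := by rw [Nat.mul_succ]; omega
        _ ≤ N * I := Nat.mul_le_mul_left _ (by omega)
    · simp only [tM, lm, eval_sub, eval_X, eval_C]; push_cast; ring

/-- from the moment hypothesis to the functional. -/
theorem toMM (hS : Setup a N m q Kb A B Nm g) (ha2 : 2 ≤ a)
    (hAZ : ∀ T : ℤ, -(N * Kb : ℤ) ≤ T → T ≤ N * m - N → A.eval (T : ℂ) ≠ 0)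
    (hKb : cK a N q + 1 ≤ Kb) (hm : cD a q + (a + cD a q) * q < m)
    (w : ℂ) (Γ : ℕ → ℂ) (c2 : ℕ)
    (hMom : Mom N m w Γ (fun l => Ed A B N (lm l) (yS a N (lm l) (gb1 a g))) (cC0 a N q c2) 0)
    (l0 : ℕ) (hl0 : l0 < N) (hΓ : Γ l0 ≠ 0) :
    ∃ κ : ℂ[X], κ ≠ 0 ∧ κ.natDegree ≤ ck a N q ∧ ∀ ψ : ℂ[X], ψ.natDegree < c2 →
      mm N m w g (κ * ψ) = 0 := by
  obtain ⟨c, ⟨i1, hi1, hO1⟩, hcd, hca, hX1, hX2⟩ := step1 a N q hS.ha A B hS.hA0 hS.degA hS.degB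
  set O := opO A B N c with hOdef
  have hOd : ∀ i, (O i).natDegree ≤ cD a q := by
    intro i
    have hc : ∀ i, (c i).natDegree ≤ cDc a q := hcd
    rw [hOdef]
    unfold cD
    cases i with
    | zero =>
      simp only [opO, natDegree_neg]
      exact natDegree_mul_le.trans (Nat.add_le_add (hc _) hS.degB)
    | succ i =>
      simp only [opO]
      refine (natDegree_sub_le _ _).trans (max_le ?_ ?_)
      · refine natDegree_mul_le.trans (Nat.add_le_add (hc _) ?_)
        rw [natDegree_comp_sub]; exact hS.degA
      · refine natDegree_mul_le.trans (Nat.add_le_add (hc _) ?_)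
        rw [natDegree_comp_sub]; exact hS.degB
  have haK : a ≤ Kb := by unfold cK at hKb; omega
  have haKD : a + cD a q + 1 ≤ Kb := by unfold cK at hKb; omega
  have hZ : ∀ l < N, (ZZ a N (cD a q) (a + cD a q) A B (lm l) O).coeff 0 ≠ 0 := by
    intro l hl
    exact N1 hS ha2 O (cD a q) (by omega) (lm l) (Xl_ne l) hOd ⟨i1, hi1, hO1⟩ hX1
  obtain ⟨O', hO'd, hXi, hXi0, hκ⟩ := step2 hS hAZ O (cD a q) haKD hOd hm hZ (cK a N q) rfl l0 hl0
  have hM1 := hMom.op (fun l M hM => by unfold Ed; rw [yS_neg _ _ _ hM, yS_neg _ _ _ (by omega)]; ring) a c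
    (cDc a q) hcd
  have e1 : (fun l => op a N (lm l) c (Ed A B N (lm l) (yS a N (lm l) (gb1 a g)))) =
      fun l => opP a N (lm l) O (yS a N (lm l) (gb1 a g)) := by
    funext l M
    exact op_Ed (lm l) c (hca a le_rfl) _ M
  rw [e1] at hM1
  have hneg1 : ∀ l M, M < 0 → opP a N (lm l) O (yS a N (lm l) (gb1 a g)) M = 0 := by
    intro l M hM
    unfold opP
    apply Finset.sum_eq_zero
    intro i _
    rw [yS_neg _ _ _ (by omega), mul_zero]
  have hM2 := hM1.op hneg1 (cD a q + 1 + 1)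
    (fun i => C ((-1) ^ i * ((cD a q + 1).choose i : ℂ))) 0 (fun i => (natDegree_C _).le)
  have e2 : (fun l => op (cD a q + 1 + 1) N (lm l) (fun i => C ((-1) ^ i * ((cD a q + 1).choose i : ℂ)))
      (opP a N (lm l) O (yS a N (lm l) (gb1 a g)))) = fun l => zz a N (cD a q) (lm l) O g := by
    funext l M
    rw [op_opd, zz_eq hS haK O (cD a q) (lm l) (Xl_ne l) hOd hX1 hX2]
  have hneg2 : ∀ l M, M < 0 → zz a N (cD a q) (lm l) O g M = 0 := by
    intro l M hM
    rw [← congrFun (congrFun e2 l) M]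
    exact op_neg _ _ _ _ (hneg1 l) M hM
  rw [e2] at hM2
  have hM3 := hM2.op hneg2 (N * a) O' _ hO'd
  have hCle : cC3 a N q c2 ≤ cC0 a N q c2 - cDc a q - 0 - N * a * (cD a q + cK a N q * q) := by
    unfold cC0 cD'; omega
  have hIle : 0 + a + (cD a q + 1 + 1) + N * a = cI a N q := by unfold cI; ring
  rw [hIle] at hM3
  obtain ⟨χ, hχ0, hχd, hχ⟩ := chi_exists N m (cI a N q)
  set lam := lm l0 with hlam
  set κ0 := (Xi a N (cD a q) (cK a N q) A B O O' lam).coeff (a - 1) with hκ0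
  set Y : ℂ[X] := X + C lam with hY
  refine ⟨κ0.comp Y * χ.comp Y * (X - C ((N:ℂ) * m)), ?_, ?_, ?_⟩
  · have hcomp : ∀ p : ℂ[X], p ≠ 0 → p.comp Y ≠ 0 := by
      intro p hp h
      have := comp_sub_ne hp (-lam)
      apply this
      rw [map_neg, sub_neg_eq_add]; exact h
    exact mul_ne_zero (mul_ne_zero (hcomp _ hκ) (hcomp _ hχ0)) (X_sub_C_ne_zero _)
  · refine natDegree_mul_le.trans ?_
    rw [natDegree_X_sub_C]
    unfold ck
    refine Nat.add_le_add_right (natDegree_mul_le.trans ?_) 1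
    rw [natDegree_comp, natDegree_comp, hY, natDegree_X_add_C, mul_one, mul_one, hχd]
    refine Nat.add_le_add_right ?_ _
    exact Xi_deg hS (cD a q) O hOd lam (cK a N q) rfl O' (cD' a N q) hO'd (a-1)
  · intro ψ hψ
    have h1 := hM3 (χ * (X - C (lam + N * m)) * (num A B N (cK a N q) 0).comp (X - C lam) *
      ψ.comp (X - C lam)) (by
        refine lt_of_lt_of_le ?_ hCle
        unfold cC3
        refine lt_of_le_of_lt natDegree_mul_le ?_
        rw [natDegree_comp_sub]
        have h2 : (χ * (X - C (lam + N * m)) * (num A B N (cK a N q) 0).comp (X - C lam)).natDegree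
            ≤ N * cI a N q + 1 + cK a N q * q := by
          refine natDegree_mul_le.trans (Nat.add_le_add (natDegree_mul_le.trans (Nat.add_le_add hχd.le ?_)) ?_)
          · rw [natDegree_X_sub_C]
          · rw [natDegree_comp_sub]
            exact num_deg hS.degA hS.degB N _ 0 (Nat.zero_le _)
        omega) (by
        intro l hl M h1 h2
        rw [eval_mul, eval_mul, eval_mul, hχ l hl M h1 h2]; ring)
    rw [Finset.sum_eq_single l0 (by
        intro l hl hne
        have hl := Finset.mem_range.1 hl
        have : ∀ M, op (N * a) N (lm l) O' (zz a N (cD a q) (lm l) O g) M = 0 :=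
          op_zz_zero hS (cD a q) (cK a N q) rfl (by omega) (lm l) O O' (hXi l hl hne)
        simp only [this]; simp) (by
        intro h; exact absurd (Finset.mem_range.2 hl0) h)] at h1
    have h2 := (mul_eq_zero.1 h1).resolve_left hΓ
    unfold mm
    rw [Finset.sum_range_succ]
    have h3 : w ^ m * ((g m).coeff 0 * eval ((N:ℂ) * m)
        (κ0.comp Y * χ.comp Y * (X - C ((N:ℂ) * m)) * ψ)) = 0 := by
      simp only [eval_mul, eval_sub, eval_X, eval_C]; ring
    rw [h3, add_zero, ← h2]
    apply Finset.sum_congr rfl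
    intro M _
    congr 1
    have h4 := op_zz_main hS (cD a q) (cK a N q) rfl (by omega) lam O O' hXi0 M
    rw [← hκ0] at h4
    simp only [eval_mul, eval_comp, eval_sub, eval_X, eval_C, hY, eval_add]
    have e5 : tM N lam M - lam = (N:ℂ) * M := by unfold tM; push_cast; ring
    have e6 : tM N lam M - (lam + N * m) = (N:ℂ) * M - N * m := by unfold tM; push_cast; ring
    have e7 : (N:ℂ) * M + lam = tM N lam M := by unfold tM; push_cast; ring
    rw [e5, e6, e7]
    simp only [Int.cast_natCast] at h4
    linear_combination (-(eval (tM N lam M) χ * ((N:ℂ) * M - N * m) * eval ((N:ℂ) * M) ψ)) * h4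

end ZE
end


section
open Polynomial

namespace ZE

variable {a N m q Kb : ℕ} {A B Nm : ℂ[X]} {g : ℤ → ℂ[X]}

theorem bezout_bounded {ι : Type} [Fintype ι] (κ : ℂ[X]) (hκ : κ ≠ 0) (f : ι → ℂ[X]) (k L : ℕ)
    (hk : κ.natDegree ≤ k) (hL : ∀ i, (f i).natDegree ≤ L)
    (h : ∀ x : ℂ, κ.eval x = 0 → (∀ i, (f i).eval x = 0) → False) :
    ∃ (u0 : ℂ[X]) (u : ι → ℂ[X]), 1 = κ * u0 + ∑ i, f i * u i ∧ u0.natDegree ≤ k + L ∧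
      ∀ i, (u i).natDegree ≤ k := by
  classical
  set F : Option ι → ℂ[X] := fun o => o.elim κ f with hF
  have htop : Ideal.span (Set.range F) = ⊤ := by
    obtain ⟨d, hd⟩ := (IsPrincipalIdealRing.principal (Ideal.span (Set.range F))).principal
    rw [hd]
    have hdv : ∀ o, d ∣ F o := by
      intro o
      have : F o ∈ Ideal.span (Set.range F) := Ideal.subset_span ⟨o, rfl⟩
      rw [hd] at this
      exact Ideal.mem_span_singleton.1 this
    have hd0 : d ≠ 0 := by
      rintro rfl
      exact hκ (zero_dvd_iff.1 (hdv none))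
    rw [show (Submodule.span ℂ[X] {d} = ⊤) ↔ IsUnit d from Ideal.span_singleton_eq_top]
    by_contra hu
    obtain ⟨x, hx⟩ := IsAlgClosed.exists_root d (by
      intro hdeg
      exact hu (isUnit_iff_degree_eq_zero.2 hdeg))
    have hev : ∀ o, (F o).eval x = 0 := fun o => eval_eq_zero_of_dvd_of_eval_eq_zero (hdv o) hx
    exact h x (hev none) (fun i => hev (some i))
  have h1 : (1:ℂ[X]) ∈ Ideal.span (Set.range F) := by rw [htop]; trivial
  rw [Ideal.mem_span_range_iff_exists_fun] at h1
  obtain ⟨c, hc⟩ := h1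
  rw [Fintype.sum_option] at hc
  refine ⟨c none + ∑ i, f i * (c (some i) / κ), fun i => c (some i) % κ, ?_, ?_, ?_⟩
  · have e2 : ∀ i, f i * (c (some i) % κ) = c (some i) * f i - κ * (f i * (c (some i) / κ)) := by
      intro i
      have := EuclideanDomain.div_add_mod (c (some i)) κ
      linear_combination f i * this
    simp only [e2]
    rw [Finset.sum_sub_distrib, ← Finset.mul_sum, ← hc]
    simp only [hF, Option.elim]; ring
  all_goals
    have hr : ∀ i, (c (some i) % κ).natDegree ≤ k := by
      intro i
      by_cases h0 : c (some i) % κ = 0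
      · rw [h0]; simp
      · have := natDegree_le_natDegree (EuclideanDomain.mod_lt (c (some i)) hκ).le
        exact this.trans hk
  · set u0 := c none + ∑ i, f i * (c (some i) / κ) with hu0
    have e : κ * u0 = 1 - ∑ i, f i * (c (some i) % κ) := by
      have e2 : ∀ i, f i * (c (some i) % κ) = c (some i) * f i - κ * (f i * (c (some i) / κ)) := by
        intro i
        have := EuclideanDomain.div_add_mod (c (some i)) κ
        linear_combination f i * this
      simp only [e2]
      rw [Finset.sum_sub_distrib, ← Finset.mul_sum, ← hc, hu0]
      simp only [hF, Option.elim]; ring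
    have hd : (κ * u0).natDegree ≤ k + L := by
      rw [e]
      refine (natDegree_sub_le _ _).trans (max_le (by simp) ?_)
      apply natDegree_sum_le_of_forall_le
      intro i _
      refine natDegree_mul_le.trans ?_
      have := hL i; have := hr i; omega
    by_cases h0 : u0 = 0
    · rw [h0]; simp
    · rw [natDegree_mul hκ h0] at hd; omega
  · exact hr

def Jc (Λ : ℂ[X] →ₗ[ℂ] ℂ) (c : ℕ) (f : ℂ[X]) : Prop := ∀ ψ : ℂ[X], ψ.natDegree < c → Λ (f * ψ) = 0

def Inv (Λ : ℂ[X] →ₗ[ℂ] ℂ) (w : ℂ) (N : ℕ) (A B : ℂ[X]) : Prop :=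
  ∀ ψ : ℂ[X], Λ (C w * (A * ψ.comp (X + C (N:ℂ))) - B * ψ) = 0

theorem Jc_B {Λ : ℂ[X] →ₗ[ℂ] ℂ} {w : ℂ} (hI : Inv Λ w N A B) (hA : A.natDegree ≤ q) {c : ℕ} {f : ℂ[X]}
    (h : Jc Λ c f) : Jc Λ (c - q) (B * f.comp (X + C (-(N:ℂ)))) := by
  intro ψ hψ
  have h1 := hI (f.comp (X + C (-(N:ℂ))) * ψ)
  rw [map_sub, mul_comp, comp_assoc] at h1
  have e : (X + C (-(N:ℂ))).comp (X + C (N:ℂ)) = X := by simp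
  rw [e, comp_X] at h1
  have h2 := h (A * ψ.comp (X + C (N:ℂ))) (by
    refine lt_of_le_of_lt natDegree_mul_le ?_
    rw [natDegree_comp, natDegree_X_add_C]; omega)
  have e2 : C w * (A * (f * ψ.comp (X + C (N:ℂ)))) = w • (f * (A * ψ.comp (X + C (N:ℂ)))) := by
    rw [smul_eq_C_mul]; ring
  rw [e2, map_smul, h2, smul_zero, zero_sub, neg_eq_zero] at h1
  rw [mul_assoc]; exact h1

theorem Jc_A {Λ : ℂ[X] →ₗ[ℂ] ℂ} {w : ℂ} (hw : w ≠ 0) (hI : Inv Λ w N A B) (hB : B.natDegree ≤ q) {c : ℕ} {f : ℂ[X]}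
    (h : Jc Λ c f) : Jc Λ (c - q) (A * f.comp (X + C (N:ℂ))) := by
  intro ψ hψ
  have h1 := hI (f * ψ.comp (X + C (-(N:ℂ))))
  rw [map_sub, mul_comp, comp_assoc] at h1
  have e : (X + C (-(N:ℂ))).comp (X + C (N:ℂ)) = X := by simp
  rw [e, comp_X] at h1
  have h2 := h (B * ψ.comp (X + C (-(N:ℂ)))) (by
    refine lt_of_le_of_lt natDegree_mul_le ?_
    rw [natDegree_comp, natDegree_X_add_C]; omega)
  have e2 : C w * (A * (f.comp (X + C (N:ℂ)) * ψ)) = w • (A * f.comp (X + C (N:ℂ)) * ψ) := by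
    rw [smul_eq_C_mul]; ring
  have e3 : B * (f * ψ.comp (X + C (-(N:ℂ)))) = f * (B * ψ.comp (X + C (-(N:ℂ)))) := by ring
  rw [e3, h2, e2, map_smul, sub_zero, smul_eq_mul] at h1
  exact (mul_eq_zero.1 h1).resolve_left hw

noncomputable def fG (G : ℂ[X]) (s : ℂ) (κ : ℂ[X]) : ℕ → ℂ[X]
  | 0 => κ
  | i + 1 => G * (fG G s κ i).comp (X + C s)

theorem fG_deg (G : ℂ[X]) (s : ℂ) (κ : ℂ[X]) (k : ℕ) (hG : G.natDegree ≤ q) (hκ : κ.natDegree ≤ k) (i : ℕ) :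
    (fG G s κ i).natDegree ≤ k + i * q := by
  induction i with
  | zero => simpa [fG] using hκ
  | succ i ih =>
    simp only [fG]
    refine natDegree_mul_le.trans ?_
    rw [natDegree_comp, natDegree_X_add_C, Nat.succ_mul]; omega

theorem fG_root (G : ℂ[X]) (s : ℂ) (κ : ℂ[X]) (i : ℕ) : ∀ x : ℂ, (fG G s κ i).eval x = 0 →
    κ.eval (x + i * s) = 0 ∨ ∃ j < i, G.eval (x + j * s) = 0 := by
  induction i with
  | zero => intro x h; left; simpa [fG] using h
  | succ i ih =>
    intro x h
    simp only [fG, eval_mul, eval_comp, eval_add, eval_X, eval_C] at h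
    rcases mul_eq_zero.1 h with h | h
    · right; exact ⟨0, by omega, by simpa using h⟩
    · rcases ih _ h with h | ⟨j, hj, h⟩
      · left
        have : x + ((i + 1 : ℕ) : ℂ) * s = x + s + i * s := by push_cast; ring
        rw [this]; exact h
      · right
        refine ⟨j + 1, by omega, ?_⟩
        have : x + ((j + 1 : ℕ) : ℂ) * s = x + s + j * s := by push_cast; ring
        rw [this]; exact h

theorem fG_all (G : ℂ[X]) (s : ℂ) (hs : s ≠ 0) (κ : ℂ[X]) (hκ0 : κ ≠ 0) (k : ℕ) (hκ : κ.natDegree ≤ k) (x : ℂ)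
    (h : ∀ i ≤ k, (fG G s κ i).eval x = 0) : ∃ j < k, G.eval (x + j * s) = 0 := by
  obtain ⟨i, hi, hev⟩ := exists_nonroot κ hκ0 (k + 1) (by omega) (fun i : ℕ => x + i * s) (by
    intro i j hij
    have h2 := mul_right_cancel₀ hs (add_left_cancel hij)
    exact_mod_cast h2)
  rcases fG_root G s κ i x (h i (by omega)) with h1 | ⟨j, hj, h1⟩
  · exact absurd h1 hev
  · exact ⟨j, by omega, h1⟩

noncomputable def cC2 (k q : ℕ) : ℕ := 2 * (k + k * q) + k + q + 1 + k * q

theorem low_zero {Λ : ℂ[X] →ₗ[ℂ] ℂ} {w : ℂ} (hw : w ≠ 0) (hN : 0 < N) (hI : Inv Λ w N A B)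
    (hA : A.natDegree ≤ q) (hB : B.natDegree ≤ q) (κ : ℂ[X]) (hκ0 : κ ≠ 0) (k : ℕ) (hκ : κ.natDegree ≤ k)
    (hJ : Jc Λ (cC2 k q) κ) (hk : k ≤ Kb)
    (sep : ∀ x : ℂ, (∃ i < Kb, B.eval (x - N * i) = 0) → (∃ i < Kb, A.eval (x + N * i) = 0) → False) :
    ∀ φ : ℂ[X], φ.natDegree < q → Λ φ = 0 := by
  have hN' : (N:ℂ) ≠ 0 := by exact_mod_cast hN.ne'
  have hJB : ∀ i, Jc Λ (cC2 k q - i * q) (fG B (-(N:ℂ)) κ i) := by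
    intro i
    induction i with
    | zero => simpa [fG] using hJ
    | succ i ih =>
      have := Jc_B hI hA ih
      rw [Nat.sub_sub, ← Nat.succ_mul] at this
      exact this
  have hJA : ∀ i, Jc Λ (cC2 k q - i * q) (fG A (N:ℂ) κ i) := by
    intro i
    induction i with
    | zero => simpa [fG] using hJ
    | succ i ih =>
      have := Jc_A hw hI hB ih
      rw [Nat.sub_sub, ← Nat.succ_mul] at this
      exact this
  obtain ⟨u0, u, h1, hu0, hu⟩ := bezout_bounded (ι := Fin (k + 1) ⊕ Fin (k + 1)) κ hκ0
    (Sum.elim (fun i => fG B (-(N:ℂ)) κ i) (fun i => fG A (N:ℂ) κ i)) k (k + k * q) hκ (by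
      rintro (i | i)
      · refine (fG_deg B _ κ k hB hκ i).trans ?_
        have := Nat.mul_le_mul_right q (Nat.lt_succ_iff.1 i.2)
        omega
      · refine (fG_deg A _ κ k hA hκ i).trans ?_
        have := Nat.mul_le_mul_right q (Nat.lt_succ_iff.1 i.2)
        omega) (by
      intro x _ hx
      obtain ⟨j, hj, h1⟩ := fG_all B (-(N:ℂ)) (neg_ne_zero.2 hN') κ hκ0 k hκ x
        (fun i hi => hx (Sum.inl ⟨i, by omega⟩))
      obtain ⟨j', hj', h2⟩ := fG_all A (N:ℂ) hN' κ hκ0 k hκ x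
        (fun i hi => hx (Sum.inr ⟨i, by omega⟩))
      refine sep x ⟨j, by omega, ?_⟩ ⟨j', by omega, ?_⟩
      · have : x - N * j = x + j * -(N:ℂ) := by ring
        rw [this]; exact h1
      · have : x + N * j' = x + j' * (N:ℂ) := by ring
        rw [this]; exact h2)
  intro φ hφ
  have e : φ = κ * (u0 * φ) + ∑ i, Sum.elim (fun i : Fin (k+1) => fG B (-(N:ℂ)) κ i)
      (fun i : Fin (k+1) => fG A (N:ℂ) κ i) i * (u i * φ) := by
    conv_lhs => rw [← one_mul φ, h1]
    rw [add_mul, Finset.sum_mul]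
    congr 1
    · ring
    · apply Finset.sum_congr rfl
      intro i _; ring
  rw [e, map_add, map_sum, hJ _ (by
    refine lt_of_le_of_lt natDegree_mul_le ?_
    unfold cC2; omega), zero_add]
  apply Finset.sum_eq_zero
  rintro (i | i) _
  · apply hJB i
    refine lt_of_le_of_lt natDegree_mul_le ?_
    have := Nat.mul_le_mul_right q (Nat.lt_succ_iff.1 i.2)
    have := hu (Sum.inl i)
    unfold cC2; omega
  · apply hJA i
    refine lt_of_le_of_lt natDegree_mul_le ?_
    have := Nat.mul_le_mul_right q (Nat.lt_succ_iff.1 i.2)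
    have := hu (Sum.inr i)
    unfold cC2; omega

theorem ext_lemma (Λ : ℂ[X] →ₗ[ℂ] ℂ) (q0 I : ℕ) (h0 : ∀ φ : ℂ[X], φ.natDegree < q0 → Λ φ = 0)
    (h : ∀ i < I, ∃ p : ℂ[X], p.natDegree ≤ q0 + i ∧ p.coeff (q0 + i) ≠ 0 ∧ Λ p = 0) (hq0 : 0 < q0) :
    ∀ φ : ℂ[X], φ.natDegree < q0 + I → Λ φ = 0 := by
  induction I with
  | zero => simpa using h0
  | succ I ih =>
    have ih := ih (fun i hi => h i (by omega))
    intro φ hφ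
    obtain ⟨p, hp1, hp2, hp3⟩ := h I (by omega)
    set c := φ.coeff (q0 + I) / p.coeff (q0 + I) with hc
    have h2 : Λ (φ - c • p) = 0 := by
      apply ih
      have hle : (φ - c • p).natDegree ≤ q0 + I := by
        refine (natDegree_sub_le _ _).trans (max_le (by omega) ((natDegree_smul_le _ _).trans hp1))
      have hco : (φ - c • p).coeff (q0 + I) = 0 := by
        rw [coeff_sub, coeff_smul, smul_eq_mul, hc, div_mul_cancel₀ _ hp2, sub_self]
      rcases hle.lt_or_eq with h | h
      · exact h
      · exfalso
        rw [← h, coeff_natDegree, leadingCoeff_eq_zero] at hco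
        rw [hco] at h; simp at h; omega
    rw [map_sub, map_smul, hp3, smul_zero, sub_zero] at h2
    exact h2

theorem ext_neg {Λ : ℂ[X] →ₗ[ℂ] ℂ} (hI : Inv Λ (-1) N A B) (hq : 0 < q)
    (hA : A.natDegree ≤ q) (hB : B.natDegree ≤ q) (hl : A.coeff q = B.coeff q) (hl0 : A.coeff q ≠ 0)
    (h0 : ∀ φ : ℂ[X], φ.natDegree < q → Λ φ = 0) (φ : ℂ[X]) : Λ φ = 0 := by
  apply ext_lemma Λ q (φ.natDegree + 1) h0 _ hq φ (by omega)
  intro i _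
  refine ⟨_, ?_, ?_, hI (X ^ i)⟩
  · refine (natDegree_sub_le _ _).trans (max_le ((natDegree_C_mul_le _ _).trans (natDegree_mul_le.trans ?_))
      (natDegree_mul_le.trans ?_))
    · rw [natDegree_comp, natDegree_X_add_C, natDegree_X_pow]; omega
    · rw [natDegree_X_pow]; omega
  · rw [coeff_sub, coeff_C_mul, coeff_mul_add_eq_of_natDegree_le hA (by
      rw [natDegree_comp, natDegree_X_add_C, natDegree_X_pow, mul_one]),
      coeff_mul_add_eq_of_natDegree_le hB (natDegree_X_pow_le i), X_pow_comp, coeff_X_add_C_pow, ← hl]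
    simp only [Nat.sub_self, pow_zero, Nat.choose_self, coeff_X_pow_self]
    intro h
    apply hl0
    linear_combination (-1/2 : ℂ) * h

theorem ext_pos {Λ : ℂ[X] →ₗ[ℂ] ℂ} (hI : Inv Λ 1 N A B) (hq : 0 < q) (d0 : ℕ)
    (hA : A.natDegree ≤ q) (hB : B.natDegree ≤ q) (hl : A.coeff q = B.coeff q)
    (hnext : ∀ i : ℕ, i < d0 - q → A.coeff q * (N * i) + (A.coeff (q - 1) - B.coeff (q - 1)) ≠ 0)
    (h0 : ∀ φ : ℂ[X], φ.natDegree < q → Λ φ = 0) (φ : ℂ[X]) (hφ : φ.natDegree < d0 - 1) : Λ φ = 0 := by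
  apply ext_lemma Λ q (d0 - 1 - q) h0 _ hq φ (by omega)
  intro i hi
  have e : C (1:ℂ) * (A * (X ^ (i+1)).comp (X + C (N:ℂ))) - B * X ^ (i+1) =
      A * ((X + C (N:ℂ)) ^ (i+1) - X ^ (i+1)) + (A - B) * X ^ (i+1) := by
    rw [X_pow_comp, C_1]; ring
  have d1 : ((X + C (N:ℂ)) ^ (i+1) - X ^ (i+1)).natDegree ≤ i := by
    rw [natDegree_le_iff_coeff_eq_zero]
    intro j hj
    rw [coeff_sub, coeff_X_add_C_pow, coeff_X_pow]
    rcases eq_or_ne j (i+1) with rfl | h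
    · simp
    · rw [if_neg h, Nat.choose_eq_zero_of_lt (by omega)]; simp
  have d2 : (A - B).natDegree ≤ q - 1 := by
    rw [natDegree_le_iff_coeff_eq_zero]
    intro j hj
    rcases eq_or_ne j q with rfl | h
    · rw [coeff_sub, hl, sub_self]
    · rw [coeff_sub, coeff_eq_zero_of_natDegree_lt (by omega), coeff_eq_zero_of_natDegree_lt (by omega), sub_self]
  refine ⟨_, ?_, ?_, hI (X ^ (i+1))⟩
  · rw [e]
    refine natDegree_add_le_of_degree_le (natDegree_mul_le.trans (by omega)) (natDegree_mul_le.trans ?_)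
    rw [natDegree_X_pow]; omega
  · rw [e, coeff_add, coeff_mul_add_eq_of_natDegree_le hA d1]
    have e2 : q + i = (q - 1) + (i + 1) := by omega
    rw [e2, coeff_mul_add_eq_of_natDegree_le d2 (natDegree_X_pow_le (i+1)), coeff_sub, coeff_sub, coeff_X_pow_self,
      coeff_X_add_C_pow, coeff_X_pow, if_neg (by omega)]
    have h2 := hnext (i+1) (by omega)
    have e3 : i + 1 - i = 1 := by omega
    rw [e3, Nat.choose_succ_self_right]
    intro h
    apply h2
    rw [← h]; push_cast; ring

noncomputable def mmL (N m : ℕ) (w : ℂ) (g : ℤ → ℂ[X]) : ℂ[X] →ₗ[ℂ] ℂ where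
  toFun := mm N m w g
  map_add' x y := by
    unfold mm; rw [← Finset.sum_add_distrib]; apply Finset.sum_congr rfl; intro h _; rw [eval_add]; ring
  map_smul' c x := by
    unfold mm; rw [RingHom.id_apply, smul_eq_mul, Finset.mul_sum]
    apply Finset.sum_congr rfl; intro h _; rw [eval_smul, smul_eq_mul]; ring

theorem mmL_apply (w : ℂ) (φ : ℂ[X]) : mmL N m w g φ = mm N m w g φ := rfl

theorem mmL_inv (hS : Setup a N m q Kb A B Nm g) (w : ℂ) : Inv (mmL N m w g) w N A B := by
  intro ψ
  rw [map_sub, sub_eq_zero, mmL_apply, mmL_apply]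
  have hP : ∀ h : ℤ, A.eval ((N:ℂ) * (h - 1 : ℤ)) * (g (h - 1)).coeff 0 = B.eval ((N:ℂ) * h) * (g h).coeff 0 := by
    intro h
    have h1 := (dvd_pow_self (X:ℂ[X]) hS.ha.ne').trans (hS.P1 h)
    rw [X_dvd_iff, coeff_sub, mul_coeff_zero, mul_coeff_zero, coeff_zero_eq_eval_zero (comp A _),
      coeff_zero_eq_eval_zero (comp B _), eval_comp, eval_comp] at h1
    simp only [eval_sub, eval_C, eval_X, sub_zero] at h1
    linear_combination h1
  unfold mm
  have h1 : ∀ h ∈ Finset.range (m+1), w ^ h * ((g h).coeff 0 *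
      eval ((N:ℂ) * h) (C w * (A * ψ.comp (X + C (N:ℂ))))) =
      w ^ (h+1) * ((g (h+1 : ℕ)).coeff 0 * eval ((N:ℂ) * (h+1:ℕ)) (B * ψ)) := by
    intro h _
    have h2 := hP ((h + 1 : ℕ) : ℤ)
    have e1 : (((h + 1 : ℕ) : ℤ) - 1) = (h : ℤ) := by push_cast; ring
    rw [e1] at h2
    simp only [eval_mul, eval_C, eval_comp, eval_add, eval_X]
    have e2 : (N:ℂ) * ((h+1 : ℕ) : ℂ) = N * h + N := by push_cast; ring
    simp only [Int.cast_natCast] at h2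
    rw [e2] at h2 ⊢
    rw [pow_succ]
    linear_combination w ^ h * w * eval ((N:ℂ) * h + N) ψ * h2
  rw [Finset.sum_congr rfl h1]
  have h3 := Finset.sum_range_succ' (fun h : ℕ => w ^ h * ((g h).coeff 0 * eval ((N:ℂ) * h) (B * ψ))) (m+1)
  have h4 := Finset.sum_range_succ (fun h : ℕ => w ^ h * ((g h).coeff 0 * eval ((N:ℂ) * h) (B * ψ))) (m+1)
  rw [h3] at h4
  have h5 := hP 0
  rw [hS.g_neg (0 - 1) (by omega)] at h5
  have h6 := hS.g_big ((m + 1 : ℕ) : ℤ) (by push_cast; omega)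
  rw [h6] at h4
  simp only [coeff_zero, zero_mul, mul_zero, add_zero] at h4
  simp only [coeff_zero, mul_zero] at h5
  have h7 : w ^ 0 * ((g ((0:ℕ):ℤ)).coeff 0 * eval ((N:ℂ) * ((0:ℕ):ℂ)) (B * ψ)) = 0 := by
    rw [eval_mul]
    have e : (N:ℂ) * ((0:ℕ):ℂ) = N * ((0:ℤ):ℂ) := by simp
    rw [e]
    simp only [Nat.cast_zero]
    linear_combination (-(eval ((N:ℂ) * ((0:ℤ):ℂ)) ψ)) * h5
  simp only [Nat.cast_zero] at h7 h4
  rw [← h4]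
  rw [h7, add_zero]

/-- MAIN core theorem (stage I) -/
theorem core (hS : Setup a N m q Kb A B Nm g) (ha2 : 2 ≤ a) (hq : 0 < q)
    (hAZ : ∀ T : ℤ, -(N * Kb : ℤ) ≤ T → T ≤ N * m - N → A.eval (T : ℂ) ≠ 0)
    (hKb : cK a N q + 1 ≤ Kb) (hkKb : ck a N q ≤ Kb) (hm : cD a q + (a + cD a q) * q < m)
    (sep : ∀ x : ℂ, (∃ i < Kb, B.eval (x - N * i) = 0) → (∃ i < Kb, A.eval (x + N * i) = 0) → False)
    (hl : A.coeff q = B.coeff q) (hl0 : A.coeff q ≠ 0) (d0 : ℕ) (hd0 : m < d0 - 1)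
    (hnext : ∀ i : ℕ, i < d0 - q → A.coeff q * (N * i) + (A.coeff (q - 1) - B.coeff (q - 1)) ≠ 0)
    (w : ℂ) (hw : w = 1 ∨ w = -1) (Γ : ℕ → ℂ)
    (hMom : Mom N m w Γ (fun l => Ed A B N (lm l) (yS a N (lm l) (gb1 a g)))
      (cC0 a N q (cC2 (ck a N q) q)) 0) :
    ∀ l < N, Γ l = 0 := by
  intro l0 hl0'
  by_contra hΓ
  obtain ⟨κ, hκ0, hκd, hκ⟩ := toMM hS ha2 hAZ hKb hm w Γ _ hMom l0 hl0' hΓ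
  have hinv := mmL_inv hS w
  have hw0 : w ≠ 0 := by rcases hw with rfl | rfl <;> norm_num
  have hlow := low_zero hw0 hS.hN hinv hS.degA hS.degB κ hκ0 _ hκd hκ hkKb sep
  have hall : ∀ φ : ℂ[X], φ.natDegree < d0 - 1 → mmL N m w g φ = 0 := by
    intro φ hφ
    rcases hw with rfl | rfl
    · exact ext_pos hinv hq d0 hS.degA hS.degB hl hnext hlow φ hφ
    · exact ext_neg hinv hq hS.degA hS.degB hl hl0 hlow φ
  have h1 := hall (∏ h ∈ Finset.range m, (X - C ((N:ℂ) * (h + 1 : ℕ)))) (by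
    rw [natDegree_prod _ _ (fun i _ => X_sub_C_ne_zero _)]
    simp only [natDegree_X_sub_C]; simpa using hd0)
  rw [mmL_apply] at h1
  unfold mm at h1
  rw [Finset.sum_range_succ'] at h1
  rw [Finset.sum_eq_zero (by
    intro h hh
    rw [eval_prod, Finset.prod_eq_zero hh (by simp)]; simp), zero_add] at h1
  have hne := hS.g_ne 0 le_rfl (by omega)
  rw [eval_prod] at h1
  have h2 : ∏ j ∈ Finset.range m, eval ((N:ℂ) * ((0:ℕ):ℂ)) (X - C ((N:ℂ) * (j + 1 : ℕ))) ≠ 0 := by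
    rw [Finset.prod_ne_zero_iff]
    intro j _
    simp only [eval_sub, eval_X, eval_C, Nat.cast_zero, mul_zero, zero_sub, neg_ne_zero]
    exact mul_ne_zero (by exact_mod_cast hS.hN.ne') (Nat.cast_ne_zero.2 (by omega))
  rw [pow_zero, one_mul] at h1
  exact mul_ne_zero hne h2 h1

end ZE
end


section
open Polynomial

namespace ZE

section generic
variable {K : Type} [Field K]

noncomputable def qe (N : ℕ) (g : ℤ → K[X]) (φ : K[X]) (h : ℤ) (e : ℕ) : K :=
  (φ.comp (C ((N:K) * h) - X) * g h).coeff e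

noncomputable def gv (a N : ℕ) (g : ℤ → K[X]) (φ : K[X]) (h : ℤ) (y : K) : K :=
  ∑ e ∈ Finset.range a, qe N g φ h e * (y ^ e * (y ^ a)⁻¹)

noncomputable def u0 (a N m : ℕ) (g : ℤ → K[X]) (φ : K[X]) (t : ℕ) : K :=
  -∑ h ∈ Finset.range (m + 1), if N * h < t then gv a N g φ h ((N:K) * h - t) else 0

noncomputable def vv (a N m : ℕ) (g : ℤ → K[X]) (φ : K[X]) (t : ℕ) : K :=
  -∑ h ∈ Finset.range (m + 1), if t < N * h then gv a N g φ h ((N:K) * h - t) else 0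

noncomputable def dd (a N m : ℕ) (g : ℤ → K[X]) (t : ℕ) : K :=
  ∑ h ∈ Finset.range (m + 1), if N * h < t then
    (gv a N g 1 h ((N:K) * h - t) - gv a N g 1 h (t - (N:K) * h)) else 0

noncomputable def uu (a N m : ℕ) (g : ℤ → K[X]) (φ : K[X]) (t : ℕ) : K :=
  u0 a N m g φ t + φ.eval (t:K) * dd a N m g t

variable (a N m : ℕ) (g : ℤ → K[X])

theorem qe_add (φ ψ : K[X]) (h : ℤ) (e : ℕ) : qe N g (φ + ψ) h e = qe N g φ h e + qe N g ψ h e := by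
  unfold qe; rw [add_comp, add_mul, coeff_add]

theorem qe_Cmul (c : K) (φ : K[X]) (h : ℤ) (e : ℕ) : qe N g (C c * φ) h e = c * qe N g φ h e := by
  unfold qe; rw [mul_comp, C_comp, mul_assoc, coeff_C_mul]

theorem gv_add (φ ψ : K[X]) (h : ℤ) (y : K) : gv a N g (φ + ψ) h y = gv a N g φ h y + gv a N g ψ h y := by
  unfold gv; rw [← Finset.sum_add_distrib]; apply Finset.sum_congr rfl; intro e _; rw [qe_add]; ring

theorem gv_Cmul (c : K) (φ : K[X]) (h : ℤ) (y : K) : gv a N g (C c * φ) h y = c * gv a N g φ h y := by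
  unfold gv; rw [Finset.mul_sum]; apply Finset.sum_congr rfl; intro e _; rw [qe_Cmul]; ring

theorem u0_add (φ ψ : K[X]) (t : ℕ) : u0 a N m g (φ + ψ) t = u0 a N m g φ t + u0 a N m g ψ t := by
  unfold u0; rw [← neg_add, ← Finset.sum_add_distrib]; congr 1
  apply Finset.sum_congr rfl; intro h _; split_ifs
  · rw [gv_add]
  · rw [add_zero]

theorem u0_Cmul (c : K) (φ : K[X]) (t : ℕ) : u0 a N m g (C c * φ) t = c * u0 a N m g φ t := by
  unfold u0; rw [mul_neg, Finset.mul_sum]; congr 1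
  apply Finset.sum_congr rfl; intro h _; split_ifs
  · rw [gv_Cmul]
  · rw [mul_zero]

theorem vv_add (φ ψ : K[X]) (t : ℕ) : vv a N m g (φ + ψ) t = vv a N m g φ t + vv a N m g ψ t := by
  unfold vv; rw [← neg_add, ← Finset.sum_add_distrib]; congr 1
  apply Finset.sum_congr rfl; intro h _; split_ifs
  · rw [gv_add]
  · rw [add_zero]

theorem vv_Cmul (c : K) (φ : K[X]) (t : ℕ) : vv a N m g (C c * φ) t = c * vv a N m g φ t := by
  unfold vv; rw [mul_neg, Finset.mul_sum]; congr 1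
  apply Finset.sum_congr rfl; intro h _; split_ifs
  · rw [gv_Cmul]
  · rw [mul_zero]

theorem uu_add (φ ψ : K[X]) (t : ℕ) : uu a N m g (φ + ψ) t = uu a N m g φ t + uu a N m g ψ t := by
  unfold uu; rw [u0_add, eval_add]; ring

theorem uu_Cmul (c : K) (φ : K[X]) (t : ℕ) : uu a N m g (C c * φ) t = c * uu a N m g φ t := by
  unfold uu; rw [u0_Cmul, eval_mul, eval_C]; ring

/-- key telescoping identity -/
theorem gv_root (ha : 0 < a) (s : K) (φ : K[X]) (h : ℤ) (hy : (N:K) * h - s ≠ 0) :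
    gv a N g ((X - C s) * φ) h ((N:K) * h - s) = qe N g φ h (a - 1) := by
  set y := (N:K) * h - s with hydef
  set Y := φ.comp (C ((N:K) * h) - X) * g h with hY
  have e0 : ((X - C s) * φ).comp (C ((N:K) * h) - X) * g h = C y * Y - X * Y := by
    rw [mul_comp, sub_comp, X_comp, C_comp, hY, hydef, C_sub]; ring
  unfold gv qe
  rw [e0, ← hY]
  have key : ∀ b, ∑ e ∈ Finset.range (b + 1), (C y * Y - X * Y).coeff e * y ^ e = Y.coeff b * y ^ (b + 1) := by
    intro b
    induction b with
    | zero => simp; ring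
    | succ b ih =>
      rw [Finset.sum_range_succ, ih, coeff_sub, coeff_C_mul, coeff_X_mul]; ring
  have h1 := key (a - 1)
  rw [Nat.sub_add_cancel ha] at h1
  have h2 : ∑ e ∈ Finset.range a, (C y * Y - X * Y).coeff e * (y ^ e * (y ^ a)⁻¹) =
      (∑ e ∈ Finset.range a, (C y * Y - X * Y).coeff e * y ^ e) * (y ^ a)⁻¹ := by
    rw [Finset.sum_mul]; apply Finset.sum_congr rfl; intro e _; ring
  rw [h2, h1, mul_assoc, mul_inv_cancel₀ (pow_ne_zero _ hy), mul_one]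

theorem u0_root [CharZero K] (ha : 0 < a) (s : ℕ) (φ : K[X]) :
    u0 a N m g ((X - C (s:K)) * φ) s =
      -∑ h ∈ Finset.range (m + 1), if N * h < s then qe N g φ h (a - 1) else 0 := by
  unfold u0; congr 1
  apply Finset.sum_congr rfl; intro h _
  split_ifs with hh
  · have := gv_root a N g ha (s:K) φ h (by
      rw [Int.cast_natCast, sub_ne_zero]; exact_mod_cast hh.ne)
    simpa using this
  · rfl

theorem vv_root [CharZero K] (ha : 0 < a) (s : ℕ) (φ : K[X]) :
    vv a N m g ((X - C (s:K)) * φ) s =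
      -∑ h ∈ Finset.range (m + 1), if s < N * h then qe N g φ h (a - 1) else 0 := by
  unfold vv; congr 1
  apply Finset.sum_congr rfl; intro h _
  split_ifs with hh
  · have := gv_root a N g ha (s:K) φ h (by
      rw [Int.cast_natCast, sub_ne_zero]; exact_mod_cast hh.ne')
    simpa using this
  · rfl

theorem uu_rec [CharZero K] (ha : 0 < a) (k : K) (t : ℕ) (φ : K[X]) :
    uu a N m g ((X - C k) * φ) t = (t - k) * uu a N m g φ t
      -∑ h ∈ Finset.range (m + 1), if N * h < t then qe N g φ h (a - 1) else 0 := by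
  have e : (X - C k) * φ = (X - C (t:K)) * φ + C (t - k) * φ := by rw [C_sub]; ring
  rw [e, uu_add, uu_Cmul]
  have : uu a N m g ((X - C (t:K)) * φ) t =
      -∑ h ∈ Finset.range (m + 1), if N * h < t then qe N g φ h (a - 1) else 0 := by
    unfold uu; rw [u0_root a N m g ha, eval_mul]; simp
  rw [this]; ring

theorem vv_rec [CharZero K] (ha : 0 < a) (k : K) (t : ℕ) (φ : K[X]) :
    vv a N m g ((X - C k) * φ) t = (t - k) * vv a N m g φ t
      -∑ h ∈ Finset.range (m + 1), if t < N * h then qe N g φ h (a - 1) else 0 := by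
  have e : (X - C k) * φ = (X - C (t:K)) * φ + C (t - k) * φ := by rw [C_sub]; ring
  rw [e, vv_add, vv_Cmul, vv_root a N m g ha]; ring

theorem qe_rec (k : K) (φ : K[X]) (h : ℤ) (e : ℕ) :
    qe N g ((X - C k) * φ) h (e + 1) = (N * h - k) * qe N g φ h (e + 1) - qe N g φ h e := by
  unfold qe
  have e0 : ((X - C k) * φ).comp (C ((N:K) * h) - X) * g h =
      C ((N:K) * h - k) * (φ.comp (C ((N:K) * h) - X) * g h) - X * (φ.comp (C ((N:K) * h) - X) * g h) := by
    rw [mul_comp, sub_comp, X_comp, C_comp, C_sub]; ring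
  rw [e0, coeff_sub, coeff_C_mul, coeff_X_mul]

theorem qe_rec_zero (k : K) (φ : K[X]) (h : ℤ) :
    qe N g ((X - C k) * φ) h 0 = (N * h - k) * qe N g φ h 0 := by
  unfold qe
  have e0 : ((X - C k) * φ).comp (C ((N:K) * h) - X) * g h =
      C ((N:K) * h - k) * (φ.comp (C ((N:K) * h) - X) * g h) - X * (φ.comp (C ((N:K) * h) - X) * g h) := by
    rw [mul_comp, sub_comp, X_comp, C_comp, C_sub]; ring
  rw [e0, coeff_sub, coeff_C_mul, coeff_X_mul_zero, sub_zero]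

end generic

end ZE
end


section
open Polynomial

namespace ZE

theorem qe_zero_of_dvd {K : Type} [Field K] (N : ℕ) (g : ℤ → K[X]) (φ : K[X]) (h : ℤ) (a e : ℕ) (he : e < a)
    (hd : (X - C ((N:K) * h)) ^ a ∣ φ) : qe N g φ h e = 0 := by
  obtain ⟨ψ, rfl⟩ := hd
  unfold qe
  have : ((X - C ((N:K) * h)) ^ a * ψ).comp (C ((N:K) * h) - X) * g h =
      X ^ a * (C ((-1) ^ a) * ψ.comp (C ((N:K) * h) - X) * g h) := by
    rw [mul_comp, pow_comp, sub_comp, X_comp, C_comp]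
    have : (C ((N:K) * h) - X - C ((N:K) * h)) ^ a = X ^ a * C ((-1:K) ^ a) := by
      rw [C_pow, ← mul_pow]; congr 1; simp
    rw [this]; ring
  rw [this, coeff_X_pow_mul', if_neg (by omega)]

theorem dvd_of_root_mul {K : Type} [Field K] (x s : K) (a : ℕ) (φ : K[X])
    (h : (X - C x) ^ (a + 1) ∣ (X - C s) * φ) : (X - C x) ^ a ∣ φ := by
  by_cases hx : x = s
  · subst hx
    rw [pow_succ'] at h
    exact (mul_dvd_mul_iff_left (X_sub_C_ne_zero x)).1 h
  · have hc : IsCoprime ((X - C x) ^ a) (X - C s) :=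
      (isCoprime_X_sub_C_of_isUnit_sub (sub_ne_zero.2 hx).isUnit).pow_left
    exact hc.dvd_of_dvd_mul_left ((pow_dvd_pow _ (Nat.le_succ a)).trans h)

theorem natDegree_quot {K : Type} [Field K] (s : K) (χ φ : K[X]) (h : χ = (X - C s) * φ) :
    φ.natDegree ≤ χ.natDegree := by
  by_cases h0 : φ = 0
  · simp [h0]
  · rw [h, natDegree_mul (X_sub_C_ne_zero s) h0]; omega

variable {a N m q Kb : ℕ} {A B Nm : ℂ[X]} {g : ℤ → ℂ[X]}

theorem qe_shift (hS : Setup a N m q Kb A B Nm g) (ψ : ℂ[X]) (h : ℤ) (e : ℕ) (he : e < a) :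
    qe N g (A * ψ.comp (X + C (N:ℂ))) h e = qe N g (B * ψ) (h + 1) e := by
  have h1 := hS.P1 (h + 1)
  rw [add_sub_cancel_right] at h1
  obtain ⟨Q, hQ⟩ := h1
  unfold qe
  rw [← sub_eq_zero, ← coeff_sub]
  have : (A * ψ.comp (X + C (N:ℂ))).comp (C ((N:ℂ) * h) - X) * g h -
      (B * ψ).comp (C ((N:ℂ) * (h + 1 : ℤ)) - X) * g (h + 1) =
      X ^ a * (Q * ψ.comp (C ((N:ℂ) * (h + 1 : ℤ)) - X)) := by
    have e1 : (ψ.comp (X + C (N:ℂ))).comp (C ((N:ℂ) * h) - X) = ψ.comp (C ((N:ℂ) * (h + 1 : ℤ)) - X) := by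
      rw [comp_assoc]; congr 1
      rw [add_comp, X_comp, C_comp]; push_cast; simp only [C_add, C_mul, mul_add, mul_one]; ring
    rw [mul_comp, mul_comp, e1, ← mul_assoc, ← hQ]; ring
  rw [this, coeff_X_pow_mul', if_neg (by omega)]

theorem gv_shift (hS : Setup a N m q Kb A B Nm g) (ψ : ℂ[X]) (h : ℤ) (y : ℂ) :
    gv a N g (A * ψ.comp (X + C (N:ℂ))) h y = gv a N g (B * ψ) (h + 1) y := by
  unfold gv; apply Finset.sum_congr rfl; intro e he
  rw [qe_shift hS ψ h e (Finset.mem_range.1 he)]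

theorem qe_g0 {K : Type} [Field K] (N : ℕ) (g : ℤ → K[X]) (φ : K[X]) (h : ℤ) (e : ℕ) (hg : g h = 0) :
    qe N g φ h e = 0 := by unfold qe; rw [hg, mul_zero, coeff_zero]

theorem gv_g0 {K : Type} [Field K] (a N : ℕ) (g : ℤ → K[X]) (φ : K[X]) (h : ℤ) (y : K) (hg : g h = 0) :
    gv a N g φ h y = 0 := by
  unfold gv; apply Finset.sum_eq_zero; intro e _; rw [qe_g0 _ _ _ _ _ hg, zero_mul]

theorem qe_B0 (hB : (X : ℂ[X]) ^ (a + 1) ∣ B) (ψ : ℂ[X]) (e : ℕ) (he : e < a) : qe N g (B * ψ) 0 e = 0 := by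
  apply qe_zero_of_dvd N g _ 0 a e he
  simpa using ((pow_dvd_pow X (Nat.le_succ a)).trans hB).mul_right ψ

theorem gv_B0 (hB : (X : ℂ[X]) ^ (a + 1) ∣ B) (ψ : ℂ[X]) (y : ℂ) : gv a N g (B * ψ) 0 y = 0 := by
  unfold gv; apply Finset.sum_eq_zero; intro e he; rw [qe_B0 hB ψ e (Finset.mem_range.1 he), zero_mul]

theorem vv_shift (hS : Setup a N m q Kb A B Nm g) (ψ : ℂ[X]) (t : ℕ) :
    vv a N m g (A * ψ.comp (X + C (N:ℂ))) t = vv a N m g (B * ψ) (t + N) := by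
  unfold vv; congr 1
  have h1 : ∀ h ∈ Finset.range (m + 1), (if t < N * h then gv a N g (A * ψ.comp (X + C (N:ℂ))) h ((N:ℂ) * h - t) else 0)
      = (fun h : ℕ => if t + N < N * h then gv a N g (B * ψ) h ((N:ℂ) * h - (t + N : ℕ)) else 0) (h + 1) := by
    intro h _
    have : t + N < N * (h + 1) ↔ t < N * h := by rw [mul_add]; omega
    simp only [this]
    congr 1
    rw [gv_shift hS]; push_cast; congr 1; ring
  rw [Finset.sum_congr rfl h1]
  set f := (fun h : ℕ => if t + N < N * h then gv a N g (B * ψ) h ((N:ℂ) * h - (t + N : ℕ)) else 0)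
  have h2 := Finset.sum_range_succ' f (m + 1)
  have h3 := Finset.sum_range_succ f (m + 1)
  have f0 : f 0 = 0 := by simp [f]
  have fm : f (m + 1) = 0 := by
    simp only [f]; rw [gv_g0, ite_self]; exact hS.g_big _ (by push_cast; omega)
  rw [f0] at h2; rw [fm] at h3
  linear_combination h3 - h2

theorem u0_shift (hS : Setup a N m q Kb A B Nm g) (hB : (X : ℂ[X]) ^ (a + 1) ∣ B) (ψ : ℂ[X]) (t : ℕ) :
    u0 a N m g (A * ψ.comp (X + C (N:ℂ))) t = u0 a N m g (B * ψ) (t + N) := by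
  unfold u0; congr 1
  have h1 : ∀ h ∈ Finset.range (m + 1), (if N * h < t then gv a N g (A * ψ.comp (X + C (N:ℂ))) h ((N:ℂ) * h - t) else 0)
      = (fun h : ℕ => if N * h < t + N then gv a N g (B * ψ) h ((N:ℂ) * h - (t + N : ℕ)) else 0) (h + 1) := by
    intro h _
    have : N * (h + 1) < t + N ↔ N * h < t := by rw [mul_add]; omega
    simp only [this]
    congr 1
    rw [gv_shift hS]; push_cast; congr 1; ring
  rw [Finset.sum_congr rfl h1]
  set f := (fun h : ℕ => if N * h < t + N then gv a N g (B * ψ) h ((N:ℂ) * h - (t + N : ℕ)) else 0)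
  have h2 := Finset.sum_range_succ' f (m + 1)
  have h3 := Finset.sum_range_succ f (m + 1)
  have f0 : f 0 = 0 := by
    simp only [f]; rw [Nat.cast_zero, gv_B0 hB, ite_self]
  have fm : f (m + 1) = 0 := by
    simp only [f]; rw [gv_g0, ite_self]; exact hS.g_big _ (by push_cast; omega)
  rw [f0] at h2; rw [fm] at h3
  linear_combination h3 - h2

theorem u0_B_small (hB : (X : ℂ[X]) ^ (a + 1) ∣ B) (ψ : ℂ[X]) (t : ℕ) (ht : t ≤ N) :
    u0 a N m g (B * ψ) t = 0 := by
  unfold u0; rw [neg_eq_zero]; apply Finset.sum_eq_zero; intro h _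
  split_ifs with hh
  · have : h = 0 := by
      by_contra h0
      have : N * 1 ≤ N * h := Nat.mul_le_mul_left _ (by omega)
      omega
    subst this; rw [Nat.cast_zero, gv_B0 hB]
  · rfl

theorem vv_B_small (hS : Setup a N m q Kb A B Nm g) (hB : (X : ℂ[X]) ^ (a + 1) ∣ B) (ψ : ℂ[X]) (t : ℕ) (ht : t < N)
    (hB0 : B.eval (t:ℂ) = 0) (dP : ℕ) (hP3 : ∀ φ : ℂ[X], φ.natDegree < dP → ∑ h ∈ Finset.range (m + 1), qe N g φ h (a - 1) = 0)
    (hd : (B * ψ).natDegree < dP) :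
    vv a N m g (B * ψ) t = 0 := by
  obtain ⟨φ, hφ⟩ : (X - C (t:ℂ)) ∣ B * ψ := (dvd_iff_isRoot.2 hB0).mul_right ψ
  have hdeg := natDegree_quot _ _ _ hφ
  have hdv : (X - C (0:ℂ)) ^ a ∣ φ := by
    apply dvd_of_root_mul 0 (t:ℂ) a φ
    rw [← hφ, C_0, sub_zero]; exact hB.mul_right ψ
  rw [hφ, vv_root a N m g hS.ha, neg_eq_zero]
  refine Eq.trans ?_ (hP3 φ (by omega))
  apply Finset.sum_congr rfl; intro h _
  split_ifs with hh
  · rfl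
  · have : h = 0 := by
      by_contra h0
      have : N * 1 ≤ N * h := Nat.mul_le_mul_left _ (by omega)
      omega
    subst this
    rw [qe_zero_of_dvd N g φ _ a (a - 1) (by have := hS.ha; omega)]
    simpa using hdv

theorem u0_A_big (hS : Setup a N m q Kb A B Nm g) (hA : (X - C ((N:ℂ) * m)) ^ (a + 1) ∣ A) (ψ : ℂ[X]) (s : ℕ)
    (hs : N * m < s + N) (hs2 : s ≤ N * m)
    (hA0 : A.eval (s:ℂ) = 0) (dP : ℕ) (hP3 : ∀ φ : ℂ[X], φ.natDegree < dP → ∑ h ∈ Finset.range (m + 1), qe N g φ h (a - 1) = 0)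
    (hd : (A * ψ).natDegree < dP) :
    u0 a N m g (A * ψ) s = 0 := by
  obtain ⟨φ, hφ⟩ : (X - C (s:ℂ)) ∣ A * ψ := (dvd_iff_isRoot.2 hA0).mul_right ψ
  have hdeg := natDegree_quot _ _ _ hφ
  have hdv : (X - C ((N:ℂ) * m)) ^ a ∣ φ := by
    apply dvd_of_root_mul _ (s:ℂ) a φ
    rw [← hφ]; exact hA.mul_right ψ
  rw [hφ, u0_root a N m g hS.ha, neg_eq_zero]
  refine Eq.trans ?_ (hP3 φ (by omega))
  apply Finset.sum_congr rfl; intro h hh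
  have hm := Finset.mem_range.1 hh
  split_ifs with hh
  · rfl
  · have : h = m := by
      by_contra h0
      have : N * (h + 1) ≤ N * m := Nat.mul_le_mul_left _ (by omega)
      rw [mul_add] at this
      omega
    subst this
    rw [qe_zero_of_dvd N g φ _ a (a - 1) (by have := hS.ha; omega)]
    simpa using hdv

theorem sum_by_parts (w : ℂ) (m : ℕ) (hm : 0 < m) (f k : ℕ → ℂ) (f' : ℕ → ℂ) (h0 : f' 0 = 0) (hs : ∀ M, f' (M + 1) = f M)
    (hl : f (m - 1) = 0) :
    ∑ M ∈ Finset.range m, w ^ M * (w * f M - k M) = ∑ M ∈ Finset.range m, w ^ M * (f' M - k M) := by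
  obtain ⟨b, rfl⟩ : ∃ b, m = b + 1 := ⟨m - 1, by omega⟩
  simp only [mul_sub, Finset.sum_sub_distrib]
  congr 1
  rw [Finset.sum_range_succ, Finset.sum_range_succ' (fun M => w ^ M * f' M), h0]
  rw [Nat.add_sub_cancel] at hl
  rw [hl]; simp only [mul_zero, add_zero]
  apply Finset.sum_congr rfl; intro M _; rw [hs]; ring

theorem sum_residues {K : Type} [AddCommMonoid K] (N m : ℕ) (F : ℕ → K) :
    ∑ t ∈ Finset.range (N * m), F t = ∑ l ∈ Finset.range N, ∑ M ∈ Finset.range m, F (N * M + l) := by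
  rw [Finset.sum_comm]
  induction m with
  | zero => simp
  | succ m ih => rw [mul_add, mul_one, Finset.sum_range_add, ih, Finset.sum_range_succ]

theorem dd_eq_yS (hS : Setup a N m q Kb A B Nm g) (l M : ℕ) (hl : l < N) (hM : M ≤ m) :
    dd a N m g (N * M + l + 1) = yS a N (lm l) (gb1 a g) (M:ℤ) := by
  have gvx : ∀ (h : ℤ) (x : ℂ), gv a N g 1 h x = (x ^ a)⁻¹ * (g h).eval x := by
    intro h x
    unfold gv qe
    rw [eval_eq_sum_range' (hS.g_deg h), Finset.mul_sum]
    apply Finset.sum_congr rfl; intro e _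
    rw [one_comp, one_mul]; ring
  unfold dd yS
  have e1 : ((M:ℤ) + 1).toNat = M + 1 := by omega
  rw [e1, ← Finset.sum_range_reflect (fun l' : ℕ => ((Xl N (lm l) l') ^ a)⁻¹ * (gb1 a g (M - l')).eval (Xl N (lm l) l'))]
  rw [← Finset.sum_subset (Finset.range_mono (show M + 1 ≤ m + 1 by omega))]
  · apply Finset.sum_congr rfl
    intro h hh
    have hh := Finset.mem_range.1 hh
    have hlt : N * h < N * M + l + 1 := by
      have : N * h ≤ N * M := Nat.mul_le_mul_left _ (by omega)
      omega
    rw [if_pos hlt]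
    have e2 : (M:ℤ) - (M + 1 - 1 - h : ℕ) = h := by omega
    rw [e2]
    have e3 : ((N * M + l + 1 : ℕ) : ℂ) - (N:ℂ) * h = Xl N (lm l) (M + 1 - 1 - h) := by
      unfold Xl lm; rw [Nat.add_sub_cancel, Nat.cast_sub (by omega)]; push_cast; ring
    have e4 : (N:ℂ) * h - ((N * M + l + 1 : ℕ) : ℂ) = -Xl N (lm l) (M + 1 - 1 - h) := by
      rw [← e3]; ring
    rw [e3, e4, gvx, gvx]
    unfold gb1
    simp only [eval_sub, eval_mul, eval_C, eval_comp, eval_neg, eval_X]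
    rw [neg_pow, mul_inv]
    have : ((-1:ℂ) ^ a)⁻¹ = (-1) ^ a := by
      rcases neg_one_pow_eq_or ℂ a with h | h <;> rw [h] <;> norm_num
    rw [this]; ring
  · intro h _ hh
    rw [Finset.mem_range, not_lt] at hh
    rw [if_neg]
    have : N * (M + 1) ≤ N * h := Nat.mul_le_mul_left _ hh
    rw [mul_add] at this; omega

end ZE
end


section
open Polynomial

namespace ZE
variable {a N m q Kb : ℕ} {A B Nm : ℂ[X]} {g : ℤ → ℂ[X]}

theorem P_cancel (hS : Setup a N m q Kb A B Nm g) (hB : (X : ℂ[X]) ^ (a + 1) ∣ B) (w : ℂ) (ψ : ℂ[X]) (e : ℕ) (he : e < a) :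
    ∑ h ∈ Finset.range (m + 1), w ^ h * qe N g (C w * (A * ψ.comp (X + C (N:ℂ))) - B * ψ) h e = 0 := by
  have e1 : ∀ h ∈ Finset.range (m + 1), w ^ h * qe N g (C w * (A * ψ.comp (X + C (N:ℂ))) - B * ψ) h e =
      (fun h : ℕ => w ^ h * qe N g (B * ψ) h e) (h + 1) - (fun h : ℕ => w ^ h * qe N g (B * ψ) h e) h := by
    intro h _
    have : C w * (A * ψ.comp (X + C (N:ℂ))) - B * ψ = C w * (A * ψ.comp (X + C (N:ℂ))) + C (-1) * (B * ψ) := by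
      simp; ring
    rw [this, qe_add, qe_Cmul, qe_Cmul, qe_shift hS ψ h e he]
    push_cast; ring
  rw [Finset.sum_congr rfl e1, Finset.sum_range_sub (fun h : ℕ => w ^ h * qe N g (B * ψ) h e), qe_g0 (h := ((m + 1 : ℕ) : ℤ)) (hg := hS.g_big _ (by push_cast; omega)),
    Nat.cast_zero, qe_B0 hB ψ e he]
  simp

theorem middle (hS : Setup a N m q Kb A B Nm g) (hm : 0 < m) (hB : (X : ℂ[X]) ^ (a + 1) ∣ B)
    (hA : (X - C ((N:ℂ) * m)) ^ (a + 1) ∣ A) (hB0 : ∀ t : ℕ, t < N → B.eval (t:ℂ) = 0)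
    (hA0 : ∀ s : ℕ, N * m < s + N → s ≤ N * m → A.eval (s:ℂ) = 0) (dP : ℕ)
    (hP3 : ∀ φ : ℂ[X], φ.natDegree < dP → ∑ h ∈ Finset.range (m + 1), qe N g φ h (a - 1) = 0)
    (w : ℂ) (γ γ' : ℕ → ℂ) (hγ : ∀ t, γ (t + N) = w * γ t) (hγ' : ∀ t, γ' (t + N) = w * γ' t) (ce : ℕ → ℂ)
    (c2 : ℕ) (hc2 : c2 ≤ dP)
    (hF : ∀ φ : ℂ[X], φ.natDegree < c2 →
      ∑ e ∈ Finset.range a, ce e * ∑ h ∈ Finset.range (m + 1), w ^ h * qe N g φ h e +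
      ∑ t ∈ Finset.range (N * m), γ (t + 1) * uu a N m g φ (t + 1) +
      ∑ t ∈ Finset.range (N * m), γ' t * vv a N m g φ t = 0) (c : ℕ) (hc : c + q ≤ c2) :
    Mom N m w (fun l => γ (l + 1)) (fun l => Ed A B N (lm l) (yS a N (lm l) (gb1 a g))) c 0 := by
  intro ψ hψ _
  have hγ2 : ∀ M t, γ (N * M + t) = w ^ M * γ t := by
    intro M t
    induction M with
    | zero => simp
    | succ M ih => rw [show N * (M + 1) + t = N * M + t + N by ring, hγ, ih]; ring
  have hγ2' : ∀ M t, γ' (N * M + t) = w ^ M * γ' t := by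
    intro M t
    induction M with
    | zero => simp
    | succ M ih => rw [show N * (M + 1) + t = N * M + t + N by ring, hγ', ih]; ring
  set ψp := ψ.comp (X + C (N:ℂ)) with hψp
  have dA : (A * ψp).natDegree < c2 := by
    refine lt_of_le_of_lt natDegree_mul_le ?_
    rw [hψp, natDegree_comp, natDegree_X_add_C]; have := hS.degA; omega
  have dB : (B * ψ).natDegree < c2 := by
    refine lt_of_le_of_lt natDegree_mul_le ?_
    have := hS.degB; omega
  have h0 := hF (C w * (A * ψp) - B * ψ) (by
    refine lt_of_le_of_lt (natDegree_sub_le _ _) (max_lt (lt_of_le_of_lt (natDegree_C_mul_le _ _) dA) dB))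
  have hP : ∑ e ∈ Finset.range a, ce e * ∑ h ∈ Finset.range (m + 1), w ^ h * qe N g (C w * (A * ψp) - B * ψ) h e = 0 := by
    apply Finset.sum_eq_zero; intro e he
    rw [P_cancel hS hB w ψ e (Finset.mem_range.1 he), mul_zero]
  have esub : C w * (A * ψp) - B * ψ = C w * (A * ψp) + C (-1) * (B * ψ) := by simp; ring
  have hV : ∑ t ∈ Finset.range (N * m), γ' t * vv a N m g (C w * (A * ψp) - B * ψ) t = 0 := by
    rw [sum_residues]
    apply Finset.sum_eq_zero; intro l hl
    have hl := Finset.mem_range.1 hl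
    have e1 : ∀ M ∈ Finset.range m, γ' (N * M + l) * vv a N m g (C w * (A * ψp) - B * ψ) (N * M + l) =
        (fun M => γ' l * w ^ M * vv a N m g (B * ψ) (N * M + l)) (M + 1) -
        (fun M => γ' l * w ^ M * vv a N m g (B * ψ) (N * M + l)) M := by
      intro M _
      simp only
      rw [esub, vv_add, vv_Cmul, vv_Cmul, vv_shift hS, hγ2', show N * (M + 1) + l = N * M + l + N by ring]
      ring
    rw [Finset.sum_congr rfl e1, Finset.sum_range_sub (fun M => γ' l * w ^ M * vv a N m g (B * ψ) (N * M + l))]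
    have v1 : vv a N m g (B * ψ) (N * m + l) = 0 := by
      unfold vv; rw [neg_eq_zero]; apply Finset.sum_eq_zero; intro h hh
      rw [if_neg]
      have := Finset.mem_range.1 hh
      have : N * h ≤ N * m := Nat.mul_le_mul_left _ (by omega)
      omega
    have v2 : vv a N m g (B * ψ) (N * 0 + l) = 0 := by
      rw [mul_zero, zero_add]
      exact vv_B_small hS hB ψ l hl (hB0 l hl) dP hP3 (by omega)
    beta_reduce
    rw [v1, v2]; ring
  rw [hP, hV, zero_add, add_zero, sum_residues] at h0
  rw [← h0]
  apply Finset.sum_congr rfl; intro l hl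
  have hl := Finset.mem_range.1 hl
  have e1 : ∀ M ∈ Finset.range m, γ (N * M + l + 1) * uu a N m g (C w * (A * ψp) - B * ψ) (N * M + l + 1) =
      γ (l + 1) * (w ^ M * (w * (fun M => uu a N m g (A * ψp) (N * M + l + 1)) M -
        (fun M => uu a N m g (B * ψ) (N * M + l + 1)) M)) := by
    intro M _
    simp only
    rw [esub, uu_add, uu_Cmul, uu_Cmul, add_assoc, hγ2]
    ring
  rw [Finset.sum_congr rfl e1, ← Finset.mul_sum]
  congr 1
  rw [sum_by_parts w m hm _ _ (fun M => if M = 0 then 0 else uu a N m g (A * ψp) (N * (M - 1) + l + 1)) (by simp)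
    (by intro M; simp) (by
      have e3 : N * (m - 1) + N = N * m := by
        obtain ⟨b, rfl⟩ : ∃ b, m = b + 1 := ⟨m - 1, by omega⟩
        simp; ring
      have h1 : N * m < (N * (m - 1) + l + 1) + N := by omega
      have h2 : N * (m - 1) + l + 1 ≤ N * m := by omega
      unfold uu
      rw [u0_A_big hS hA ψp _ h1 h2 (hA0 _ h1 h2) dP hP3 (by omega), eval_mul, hA0 _ h1 h2]; ring)]
  apply Finset.sum_congr rfl; intro M hM
  have hM := Finset.mem_range.1 hM
  congr 1
  have et : tM N (lm l) M = ((N * M + l + 1 : ℕ) : ℂ) := by unfold tM lm; push_cast; ring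
  unfold Ed
  beta_reduce
  rcases Nat.eq_zero_or_pos M with rfl | hM0
  · rw [if_pos rfl]
    have y0 : yS a N (lm l) (gb1 a g) ((0:ℕ) - 1) = 0 := by unfold yS; simp
    have e2 : uu a N m g (B * ψ) (N * 0 + l + 1) = (B * ψ).eval ((N * 0 + l + 1 : ℕ) : ℂ) * dd a N m g (N * 0 + l + 1) := by
      unfold uu; rw [u0_B_small hB ψ _ (by omega), zero_add]
    rw [y0, e2, dd_eq_yS hS l 0 hl (by omega), et, eval_mul]; ring
  · rw [if_neg (by omega)]
    obtain ⟨b, rfl⟩ : ∃ b, M = b + 1 := ⟨M - 1, by omega⟩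
    rw [Nat.add_sub_cancel]
    unfold uu
    rw [u0_shift hS hB, show N * (b + 1) + l + 1 = N * b + l + 1 + N by ring]
    have d1 := dd_eq_yS hS l b hl (by omega)
    have d2 := dd_eq_yS hS l (b + 1) hl (by omega)
    rw [show N * (b + 1) + l + 1 = N * b + l + 1 + N by ring] at d2
    have e4 : ((b + 1 : ℕ) : ℤ) - 1 = b := by omega
    rw [d1, d2, e4, et, eval_mul, eval_mul, hψp, eval_comp]
    have e5 : ((N * (b + 1) + l + 1 : ℕ) : ℂ) - N = ((N * b + l + 1 : ℕ) : ℂ) := by push_cast; ring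
    have e6 : eval ((N * b + l + 1 : ℕ) : ℂ) (X + C (N:ℂ)) = ((N * (b + 1) + l + 1 : ℕ) : ℂ) := by
      rw [eval_add, eval_X, eval_C]; push_cast; ring
    rw [e5, e6, show N * b + l + 1 + N = N * (b + 1) + l + 1 by ring]; ring

end ZE
end


section
open Polynomial

namespace ZE
variable {a N m q Kb : ℕ} {A B Nm : ℂ[X]} {g : ℤ → ℂ[X]}

noncomputable def lamL (a N m : ℕ) (g : ℤ → ℂ[X]) (w : ℂ) (ce : ℕ → ℂ) : ℂ[X] →ₗ[ℂ] ℂ where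
  toFun φ := ∑ e ∈ Finset.range a, ce e * ∑ h ∈ Finset.range (m + 1), w ^ h * qe N g φ h e
  map_add' x y := by
    rw [← Finset.sum_add_distrib]; apply Finset.sum_congr rfl; intro e _
    rw [← mul_add, ← Finset.sum_add_distrib]; congr 1
    apply Finset.sum_congr rfl; intro h _; rw [qe_add]; ring
  map_smul' c x := by
    rw [smul_eq_mul, Finset.mul_sum]; apply Finset.sum_congr rfl; intro e _
    rw [mul_left_comm]; congr 1; rw [Finset.mul_sum]
    apply Finset.sum_congr rfl; intro h _; rw [smul_eq_C_mul, qe_Cmul, RingHom.id_apply]; ring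

theorem lamL_apply (a N m : ℕ) (g : ℤ → ℂ[X]) (w : ℂ) (ce : ℕ → ℂ) (φ : ℂ[X]) : lamL a N m g w ce φ =
    ∑ e ∈ Finset.range a, ce e * ∑ h ∈ Finset.range (m + 1), w ^ h * qe N g φ h e := rfl

theorem lamL_inv (hS : Setup a N m q Kb A B Nm g) (hB : (X : ℂ[X]) ^ (a + 1) ∣ B) (w : ℂ) (ce : ℕ → ℂ) :
    Inv (lamL a N m g w ce) w N A B := by
  intro ψ
  rw [lamL_apply]
  apply Finset.sum_eq_zero; intro e he
  rw [P_cancel hS hB w ψ e (Finset.mem_range.1 he), mul_zero]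

theorem lamL_ce (hS : Setup a N m q Kb A B Nm g) (w : ℂ) (ce : ℕ → ℂ) (h0 : ∀ φ, lamL a N m g w ce φ = 0) :
    ∀ e < a, ce e = 0 := by
  have main : ∀ k, k ≤ a → ∀ e, a - k ≤ e → e < a → ce e = 0 := by
    intro k
    induction k with
    | zero => intro _ e h1 h2; omega
    | succ k ih =>
      intro hk e h1 h2
      have ih := ih (by omega)
      by_cases he : a - k ≤ e
      · exact ih e he h2
      set φ : ℂ[X] := X ^ e * ∏ h ∈ Finset.range m, (X - C ((N:ℂ) * (h + 1 : ℕ))) ^ a with hφ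
      have hh := h0 φ
      rw [lamL_apply] at hh
      have q1 : ∀ h ∈ Finset.range m, ∀ e' < a, qe N g φ ((h + 1 : ℕ) : ℤ) e' = 0 := by
        intro h hm e' he'
        apply qe_zero_of_dvd N g φ _ a e' he'
        apply Dvd.dvd.mul_left
        rw [Int.cast_natCast]
        exact Finset.dvd_prod_of_mem (fun h : ℕ => (X - C ((N:ℂ) * (h + 1 : ℕ))) ^ a) hm
      have q0 : ∀ e', qe N g φ 0 e' = if e ≤ e' then ((-1) ^ e * ((∏ h ∈ Finset.range m, (-X - C ((N:ℂ) * (h + 1 : ℕ))) ^ a) * g 0).coeff (e' - e)) else 0 := by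
        intro e'
        unfold qe
        have : φ.comp (C ((N:ℂ) * (0:ℤ)) - X) * g 0 = C ((-1) ^ e) * (X ^ e * ((∏ h ∈ Finset.range m, (-X - C ((N:ℂ) * (h + 1 : ℕ))) ^ a) * g 0)) := by
          rw [hφ, mul_comp, X_pow_comp, Polynomial.prod_comp]
          simp only [pow_comp, sub_comp, X_comp, C_comp, Int.cast_zero, mul_zero, C_0, zero_sub]
          rw [neg_pow, C_pow, C_neg, C_1]; ring
        rw [this, coeff_C_mul, coeff_X_pow_mul']
        split_ifs <;> ring
      have q00 : qe N g φ 0 e ≠ 0 := by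
        rw [q0, if_pos le_rfl, Nat.sub_self, mul_coeff_zero]
        refine mul_ne_zero (pow_ne_zero _ (by norm_num)) (mul_ne_zero ?_ (hS.g_ne 0 le_rfl (by omega)))
        rw [coeff_zero_eq_eval_zero, eval_prod, Finset.prod_ne_zero_iff]
        intro h _
        rw [eval_pow]; apply pow_ne_zero
        simp only [eval_sub, eval_neg, eval_X, eval_C, neg_zero, zero_sub]
        rw [neg_ne_zero]
        exact mul_ne_zero (Nat.cast_ne_zero.2 hS.hN.ne') (Nat.cast_ne_zero.2 (by omega))
      rw [Finset.sum_eq_single e] at hh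
      · rw [Finset.sum_range_succ', Finset.sum_eq_zero] at hh
        · simp only [pow_zero, one_mul, zero_add, Nat.cast_zero] at hh
          exact (mul_eq_zero.1 hh).resolve_right q00
        · intro h hm; rw [q1 h hm e h2, mul_zero]
      · intro e' he' hne
        have he' := Finset.mem_range.1 he'
        rcases lt_or_gt_of_ne hne with h | h
        · rw [Finset.sum_range_succ', Finset.sum_eq_zero]
          · rw [Nat.cast_zero, q0, if_neg (by omega)]; ring
          · intro h hm; rw [q1 h hm e' he', mul_zero]
        · rw [ih e' (by omega) he', zero_mul]
      · intro h; exact absurd (Finset.mem_range.2 h2) h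
  intro e he
  exact main a le_rfl e (by omega) he

theorem inv_pos_poly {Λ : ℂ[X] →ₗ[ℂ] ℂ} (hI : Inv Λ 1 N A B) (hq : 0 < q)
    (hA : A.natDegree ≤ q) (hB : B.natDegree ≤ q) (hl : A.coeff q = B.coeff q) (i : ℕ)
    (hnext : A.coeff q * (N * (i+1:ℕ)) + (A.coeff (q - 1) - B.coeff (q - 1)) ≠ 0) :
    ∃ p : ℂ[X], p.natDegree ≤ q + i ∧ p.coeff (q + i) ≠ 0 ∧ Λ p = 0 := by
  have e : C (1:ℂ) * (A * (X ^ (i+1)).comp (X + C (N:ℂ))) - B * X ^ (i+1) =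
      A * ((X + C (N:ℂ)) ^ (i+1) - X ^ (i+1)) + (A - B) * X ^ (i+1) := by
    rw [X_pow_comp, C_1]; ring
  have d1 : ((X + C (N:ℂ)) ^ (i+1) - X ^ (i+1)).natDegree ≤ i := by
    rw [natDegree_le_iff_coeff_eq_zero]
    intro j hj
    rw [coeff_sub, coeff_X_add_C_pow, coeff_X_pow]
    rcases eq_or_ne j (i+1) with rfl | h
    · simp
    · rw [if_neg h, Nat.choose_eq_zero_of_lt (by omega)]; simp
  have d2 : (A - B).natDegree ≤ q - 1 := by
    rw [natDegree_le_iff_coeff_eq_zero]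
    intro j hj
    rcases eq_or_ne j q with rfl | h
    · rw [coeff_sub, hl, sub_self]
    · rw [coeff_sub, coeff_eq_zero_of_natDegree_lt (by omega), coeff_eq_zero_of_natDegree_lt (by omega), sub_self]
  refine ⟨_, ?_, ?_, hI (X ^ (i+1))⟩
  · rw [e]
    refine natDegree_add_le_of_degree_le (natDegree_mul_le.trans (by omega)) (natDegree_mul_le.trans ?_)
    rw [natDegree_X_pow]; omega
  · rw [e, coeff_add, coeff_mul_add_eq_of_natDegree_le hA d1]
    have e2 : q + i = (q - 1) + (i + 1) := by omega
    rw [e2, coeff_mul_add_eq_of_natDegree_le d2 (natDegree_X_pow_le (i+1)), coeff_sub, coeff_sub, coeff_X_pow_self,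
      coeff_X_add_C_pow, coeff_X_pow, if_neg (by omega)]
    have e3 : i + 1 - i = 1 := by omega
    rw [e3, Nat.choose_succ_self_right]
    intro h
    apply hnext
    rw [← h]; push_cast; ring

theorem ext_pos_all {Λ : ℂ[X] →ₗ[ℂ] ℂ} (hI : Inv Λ 1 N A B) (hq : 0 < q) (d0 : ℕ) (hd0 : q < d0)
    (hA : A.natDegree ≤ q) (hB : B.natDegree ≤ q) (hl : A.coeff q = B.coeff q)
    (hnext : ∀ i : ℕ, i ≠ d0 - q → A.coeff q * (N * i) + (A.coeff (q - 1) - B.coeff (q - 1)) ≠ 0)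
    (h0 : ∀ φ : ℂ[X], φ.natDegree < d0 - 1 → Λ φ = 0) (h1 : Λ (X ^ (d0 - 1)) = 0) (φ : ℂ[X]) : Λ φ = 0 := by
  have h2 := ext_lemma Λ (d0 - 1) 1 h0 (by
    intro i hi
    have : i = 0 := by omega
    subst this
    exact ⟨X ^ (d0 - 1), by rw [natDegree_X_pow]; omega, by rw [add_zero, coeff_X_pow_self]; norm_num, h1⟩) (by omega)
  apply ext_lemma Λ (d0 - 1 + 1) (φ.natDegree + 1) h2 _ (by omega) φ (by omega)
  intro i _
  obtain ⟨p, h⟩ := inv_pos_poly hI hq hA hB hl (d0 - q + i) (hnext _ (by omega))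
  refine ⟨p, ?_⟩
  rwa [show q + (d0 - q + i) = d0 - 1 + 1 + i by omega] at h

theorem stage2 (hS : Setup a N m q Kb A B Nm g) (hB : (X : ℂ[X]) ^ (a + 1) ∣ B) (hq : 0 < q)
    (hl : A.coeff q = B.coeff q) (hl0 : A.coeff q ≠ 0) (d0 : ℕ) (hd0 : q < d0)
    (hnext : ∀ i : ℕ, i ≠ d0 - q → A.coeff q * (N * i) + (A.coeff (q - 1) - B.coeff (q - 1)) ≠ 0)
    (w : ℂ) (hw : w = 1 ∨ w = -1) (ce : ℕ → ℂ) (hce : w = 1 → ce (a - 1) = 0)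
    (hP3 : ∀ φ : ℂ[X], φ.natDegree < q → ∑ h ∈ Finset.range (m + 1), qe N g φ h (a - 1) = 0)
    (h0 : ∀ φ : ℂ[X], φ.natDegree < q →
      ∑ e ∈ Finset.range a, ce e * ∑ h ∈ Finset.range (m + 1), w ^ h * qe N g φ h e = 0) :
    ∀ e < a, ce e = 0 := by
  have ha := hS.ha
  rcases hw with rfl | rfl
  · have hn' : ∀ i : ℕ, i < d0 - q → A.coeff q * (N * i) + (A.coeff (q - 1) - B.coeff (q - 1)) ≠ 0 :=
      fun i hi => hnext i (by omega)
    set e1 : ℕ → ℂ := fun e => if e = a - 1 then 1 else 0 with he1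
    have l1 : ∀ φ : ℂ[X], φ.natDegree < d0 - 1 → lamL a N m g 1 ce φ = 0 :=
      ext_pos (lamL_inv hS hB 1 ce) hq d0 hS.degA hS.degB hl hn' h0
    have l2 : ∀ φ : ℂ[X], φ.natDegree < d0 - 1 → lamL a N m g 1 e1 φ = 0 := by
      apply ext_pos (lamL_inv hS hB 1 e1) hq d0 hS.degA hS.degB hl hn'
      intro φ hφ
      rw [lamL_apply, Finset.sum_eq_single (a - 1)]
      · simp only [one_pow, one_mul, hP3 φ hφ, mul_zero]
      · intro e _ hne; simp [he1, hne]
      · intro h; exact absurd (Finset.mem_range.2 (by omega)) h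
    set α := lamL a N m g 1 ce (X ^ (d0 - 1)) with hα
    set β := lamL a N m g 1 e1 (X ^ (d0 - 1)) with hβ
    have hβ0 : β ≠ 0 := by
      intro hb
      have := lamL_ce hS 1 e1 (ext_pos_all (lamL_inv hS hB 1 e1) hq d0 hd0 hS.degA hS.degB hl hnext l2 hb) (a - 1) (by omega)
      simp [he1] at this
    set c' : ℕ → ℂ := fun e => β * ce e - α * e1 e with hc'
    have lc : ∀ φ, lamL a N m g 1 c' φ = β * lamL a N m g 1 ce φ - α * lamL a N m g 1 e1 φ := by
      intro φ
      simp only [lamL_apply, Finset.mul_sum, ← Finset.sum_sub_distrib]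
      apply Finset.sum_congr rfl; intro e _
      apply Finset.sum_congr rfl; intro h _
      rw [hc']; ring
    have hz := lamL_ce hS 1 c' (ext_pos_all (lamL_inv hS hB 1 c') hq d0 hd0 hS.degA hS.degB hl hnext
      (by intro φ hφ; rw [lc, l1 φ hφ, l2 φ hφ]; ring) (by rw [lc, ← hα, ← hβ]; ring))
    intro e he
    by_cases hea : e = a - 1
    · rw [hea]; exact hce rfl
    · have := hz e he
      simp only [hc', he1, if_neg hea, mul_zero, sub_zero] at this
      exact (mul_eq_zero.1 this).resolve_left hβ0
  · exact lamL_ce hS (-1) ce (ext_neg (lamL_inv hS hB (-1) ce) hq hS.degA hS.degB hl hl0 h0)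

end ZE
end


section
open Polynomial

namespace ZE

noncomputable def R (c : ℂ) (k : ℕ) : ℂ[X] := ∏ i ∈ Finset.range k, (X + C (c + i))

theorem R_monic (c : ℂ) (k : ℕ) : (R c k).Monic := monic_prod_of_monic _ _ (fun i _ => monic_X_add_C _)

theorem R_deg (c : ℂ) (k : ℕ) : (R c k).natDegree = k := by
  unfold R; rw [natDegree_prod_of_monic _ _ (fun i _ => monic_X_add_C _)]; simp only [natDegree_X_add_C, Finset.sum_const, Finset.card_range, smul_eq_mul, mul_one]

theorem R_add (c : ℂ) (k l : ℕ) : R c (k + l) = R c k * R (c + k) l := by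
  unfold R; rw [Finset.prod_range_add]; congr 1
  apply Finset.prod_congr rfl; intro i _; push_cast; rw [add_assoc]

theorem R_comp (c d : ℂ) (k : ℕ) : (R c k).comp (X - C d) = R (c - d) k := by
  unfold R; rw [Polynomial.prod_comp]
  apply Finset.prod_congr rfl; intro i _
  rw [add_comp, X_comp, C_comp]
  rw [show c - d + i = (c + i) - d by ring, C_sub]; ring

theorem R_eval (c x : ℂ) (k : ℕ) : (R c k).eval x = ∏ i ∈ Finset.range k, (x + (c + i)) := by
  unfold R; rw [eval_prod]; simp

theorem R_next (c : ℂ) (k : ℕ) : (R c k).nextCoeff = ∑ i ∈ Finset.range k, (c + i) := by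
  unfold R; rw [Monic.nextCoeff_prod _ _ (fun i _ => monic_X_add_C _)]
  simp only [nextCoeff_X_add_C]

theorem R_eval_int (c T : ℤ) (k : ℕ) (h : (R (c:ℂ) k).eval (T:ℂ) = 0) : ∃ i : ℤ, 0 ≤ i ∧ i < k ∧ T + c + i = 0 := by
  rw [R_eval, Finset.prod_eq_zero_iff] at h
  obtain ⟨i, hi, h⟩ := h
  refine ⟨i, by omega, by have := Finset.mem_range.1 hi; omega, ?_⟩
  rw [← add_assoc] at h
  exact_mod_cast h

theorem R_root (c : ℤ) (x : ℂ) (k : ℕ) (h : (R (c:ℂ) k).eval x = 0) : ∃ i : ℤ, 0 ≤ i ∧ i < k ∧ x = ((-c - i : ℤ) : ℂ) := by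
  rw [R_eval, Finset.prod_eq_zero_iff] at h
  obtain ⟨i, hi, h⟩ := h
  refine ⟨i, by omega, by have := Finset.mem_range.1 hi; omega, ?_⟩
  push_cast
  linear_combination h

noncomputable def cA (a r N m : ℕ) : ℂ[X] :=
  (X - C ((N:ℂ) * m)) ^ a * (R ((r * (N * m) + 1 : ℤ) : ℂ) N * R ((-(N * m) : ℤ) : ℂ) N)
noncomputable def cB (a r N m : ℕ) : ℂ[X] :=
  X ^ a * (R ((1 - N : ℤ) : ℂ) N * R ((-((r + 1) * (N * m)) - N : ℤ) : ℂ) N)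
noncomputable def cNm (r N m : ℕ) : ℂ[X] :=
  R ((1:ℤ):ℂ) (r * (N * m)) * R ((-(N * m) - r * (N * m) : ℤ) : ℂ) (r * (N * m))

theorem cA_monic (a r N m : ℕ) : (cA a r N m).Monic :=
  ((monic_X_sub_C _).pow a).mul ((R_monic _ _).mul (R_monic _ _))
theorem cB_monic (a r N m : ℕ) : (cB a r N m).Monic :=
  (monic_X.pow a).mul ((R_monic _ _).mul (R_monic _ _))

theorem cA_deg (a r N m : ℕ) : (cA a r N m).natDegree = a + 2 * N := by
  unfold cA
  rw [((monic_X_sub_C _).pow a).natDegree_mul ((R_monic _ _).mul (R_monic _ _)), (R_monic _ _).natDegree_mul (R_monic _ _),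
    R_deg, R_deg, (monic_X_sub_C _).natDegree_pow, natDegree_X_sub_C]; ring
theorem cB_deg (a r N m : ℕ) : (cB a r N m).natDegree = a + 2 * N := by
  unfold cB
  rw [(monic_X.pow a).natDegree_mul ((R_monic _ _).mul (R_monic _ _)), (R_monic _ _).natDegree_mul (R_monic _ _),
    R_deg, R_deg, natDegree_X_pow]; ring

theorem c_hl (a r N m : ℕ) : (cA a r N m).coeff (a + 2 * N) = (cB a r N m).coeff (a + 2 * N) := by
  have h1 := cA_monic a r N m
  have h2 := cB_monic a r N m
  rw [Monic, leadingCoeff, cA_deg] at h1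
  rw [Monic, leadingCoeff, cB_deg] at h2
  rw [h1, h2]

theorem c_hl1 (a r N m : ℕ) : (cA a r N m).coeff (a + 2 * N) = 1 := by
  have h1 := cA_monic a r N m
  rwa [Monic, leadingCoeff, cA_deg] at h1

theorem c_next (a r N m : ℕ) (ha : 0 < a) : (cA a r N m).coeff (a + 2 * N - 1) - (cB a r N m).coeff (a + 2 * N - 1) =
    -(N * (m * (a - 2 * r * N) - 2 * N) : ℂ) := by
  have h1 : (cA a r N m).coeff (a + 2 * N - 1) = (cA a r N m).nextCoeff := by
    rw [nextCoeff_of_natDegree_pos (by rw [cA_deg]; omega), cA_deg]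
  have h2 : (cB a r N m).coeff (a + 2 * N - 1) = (cB a r N m).nextCoeff := by
    rw [nextCoeff_of_natDegree_pos (by rw [cB_deg]; omega), cB_deg]
  rw [h1, h2]
  unfold cA cB
  rw [((monic_X_sub_C _).pow a).nextCoeff_mul ((R_monic _ _).mul (R_monic _ _)), (R_monic _ _).nextCoeff_mul (R_monic _ _),
    (monic_X.pow a).nextCoeff_mul ((R_monic _ _).mul (R_monic _ _)), (R_monic _ _).nextCoeff_mul (R_monic _ _),
    (monic_X_sub_C _).nextCoeff_pow, monic_X.nextCoeff_pow, R_next, R_next, R_next, R_next, nextCoeff_X_sub_C]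
  have : (X : ℂ[X]).nextCoeff = 0 := by
    have := nextCoeff_X_sub_C (0:ℂ); simpa using this
  rw [this]
  simp only [Finset.sum_add_distrib, Finset.sum_const, Finset.card_range, nsmul_eq_mul]
  push_cast; ring

theorem c_hnext (a r N m : ℕ) (hN : 0 < N) (ha : 2 * r * N < a) (hq : 2 * N ≤ m * (a - 2 * r * N)) (i : ℕ)
    (hi : i ≠ (m * (a - 2 * r * N) + a) - (a + 2 * N)) :
    (cA a r N m).coeff (a + 2 * N) * (N * i) + ((cA a r N m).coeff (a + 2 * N - 1) - (cB a r N m).coeff (a + 2 * N - 1)) ≠ 0 := by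
  rw [c_hl1, c_next a r N m (by omega)]
  intro h
  apply hi
  have hN' : (N:ℂ) ≠ 0 := Nat.cast_ne_zero.2 hN.ne'
  have h2 : (i:ℂ) = m * (a - 2 * r * N) - 2 * N := by
    apply mul_left_cancel₀ hN'; linear_combination h
  have h3 : ((i + 2 * N : ℕ) : ℂ) = ((m * (a - 2 * r * N) : ℕ) : ℂ) := by
    push_cast [Nat.cast_sub ha.le]; rw [h2]; ring
  have := Nat.cast_injective h3
  omega

theorem c_hAZ (a r N m Kb : ℕ) (hN : 0 < N) (hr : 0 < r) (hm : Kb + 1 ≤ m) (T : ℤ) (h1 : -(N * Kb : ℤ) ≤ T) (h2 : T ≤ N * m - N) :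
    (cA a r N m).eval (T : ℂ) ≠ 0 := by
  have hr1 : (N * m : ℤ) ≤ r * (N * m) := by
    have : (1:ℤ) ≤ r := by omega
    nlinarith [show (0:ℤ) ≤ N * m by positivity]
  have hr2 : (N * (Kb + 1) : ℤ) ≤ N * m := by
    have : ((Kb + 1 : ℕ) : ℤ) ≤ m := by omega
    push_cast at this; nlinarith
  rw [mul_add] at hr2
  unfold cA
  rw [eval_mul, eval_mul, eval_pow, eval_sub, eval_X, eval_C]
  refine mul_ne_zero (pow_ne_zero _ ?_) (mul_ne_zero ?_ ?_)
  · rw [sub_ne_zero]; intro h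
    have : T = N * m := by exact_mod_cast h
    omega
  · intro h; obtain ⟨i, h3, h4, h5⟩ := R_eval_int _ _ _ h
    omega
  · intro h; obtain ⟨i, h3, h4, h5⟩ := R_eval_int _ _ _ h
    omega

theorem c_BZ (a r N m Kb : ℕ) (hN : 0 < N) (hr : 0 < r) (hm : Kb + 1 ≤ m) (k : ℤ) (h1 : 1 ≤ k) (h2 : k ≤ m + Kb) :
    (cB a r N m).eval ((N:ℂ) * k) ≠ 0 := by
  have e0 : (N:ℂ) * k = ((N * k : ℤ) : ℂ) := by push_cast; ring
  rw [e0]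
  have hr1 : (N * m : ℤ) ≤ r * (N * m) := by
    have : (1:ℤ) ≤ r := by omega
    nlinarith [show (0:ℤ) ≤ N * m by positivity]
  have hN0 : (0:ℤ) < N := by omega
  have hr2 : (N * Kb + N : ℤ) ≤ N * m := by
    have : ((Kb + 1 : ℕ) : ℤ) ≤ m := by omega
    push_cast at this; nlinarith
  have hk1 : (N : ℤ) ≤ N * k := by nlinarith
  have hk2 : (N * k : ℤ) ≤ N * m + N * Kb := by nlinarith
  unfold cB
  rw [eval_mul, eval_mul, eval_pow, eval_X]
  refine mul_ne_zero (pow_ne_zero _ ?_) (mul_ne_zero ?_ ?_)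
  · intro h
    have : (N * k : ℤ) = 0 := by exact_mod_cast h
    omega
  · intro h; obtain ⟨i, h3, h4, h5⟩ := R_eval_int _ _ _ h
    omega
  · intro h; obtain ⟨i, h3, h4, h5⟩ := R_eval_int _ _ _ h
    rw [add_mul, one_mul] at h5
    omega

theorem c_sep (a r N m Kb : ℕ) (hN : 0 < N) (hr : 0 < r) (hm : 2 * Kb + 1 ≤ m) (x : ℂ)
    (hb : ∃ i < Kb, (cB a r N m).eval (x - N * i) = 0) (hc : ∃ i < Kb, (cA a r N m).eval (x + N * i) = 0) : False := by
  have hN0 : (0:ℤ) < N := by omega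
  have hr1 : (N * m : ℤ) ≤ r * (N * m) := by
    have : (1:ℤ) ≤ r := by omega
    nlinarith [show (0:ℤ) ≤ N * m by positivity]
  have hr2 : (2 * (N * Kb) + N : ℤ) ≤ N * m := by
    have : ((2 * Kb + 1 : ℕ) : ℤ) ≤ m := by omega
    push_cast at this; nlinarith
  have hK : (0:ℤ) ≤ N * Kb := by positivity
  have b1 : ∃ b : ℤ, x = b ∧ ((0 ≤ b ∧ b < N * Kb) ∨ (r + 1) * (N * m) < b) := by
    obtain ⟨i, hi, h⟩ := hb
    have hi1 : (0:ℤ) ≤ N * i := by positivity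
    have hi2 : (N * i + N : ℤ) ≤ N * Kb := by
      have : ((i + 1 : ℕ) : ℤ) ≤ Kb := by omega
      push_cast at this; nlinarith
    unfold cB at h
    rw [eval_mul, eval_mul, eval_pow, eval_X] at h
    rcases mul_eq_zero.1 h with h | h
    · have h := eq_zero_of_pow_eq_zero h
      refine ⟨N * i, by push_cast; linear_combination h, Or.inl ⟨by omega, by omega⟩⟩
    · rcases mul_eq_zero.1 h with h | h
      · obtain ⟨j, h3, h4, h5⟩ := R_root _ _ _ h
        refine ⟨N * i + (-(1 - N) - j), by push_cast at h5 ⊢; linear_combination h5, Or.inl ⟨by omega, by omega⟩⟩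
      · obtain ⟨j, h3, h4, h5⟩ := R_root _ _ _ h
        refine ⟨N * i + (-(-((r + 1) * (N * m)) - N) - j), by push_cast at h5 ⊢; linear_combination h5, Or.inr (by omega)⟩
  have b2 : ∃ b : ℤ, x = b ∧ ((N * m - N * Kb < b ∧ b ≤ N * m) ∨ b < 0) := by
    obtain ⟨i, hi, h⟩ := hc
    have hi1 : (0:ℤ) ≤ N * i := by positivity
    have hi2 : (N * i + N : ℤ) ≤ N * Kb := by
      have : ((i + 1 : ℕ) : ℤ) ≤ Kb := by omega
      push_cast at this; nlinarith
    unfold cA at h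
    rw [eval_mul, eval_mul, eval_pow, eval_sub, eval_X, eval_C] at h
    rcases mul_eq_zero.1 h with h | h
    · have h := eq_zero_of_pow_eq_zero h
      refine ⟨N * m - N * i, by push_cast; linear_combination h, Or.inl ⟨by omega, by omega⟩⟩
    · rcases mul_eq_zero.1 h with h | h
      · obtain ⟨j, h3, h4, h5⟩ := R_root _ _ _ h
        refine ⟨-(N * i) + (-(r * (N * m) + 1) - j), by push_cast at h5 ⊢; linear_combination h5, Or.inr (by omega)⟩
      · obtain ⟨j, h3, h4, h5⟩ := R_root _ _ _ h
        refine ⟨-(N * i) + (-(-(N * m)) - j), by push_cast at h5 ⊢; linear_combination h5, Or.inl ⟨by omega, by omega⟩⟩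
  obtain ⟨b, hb1, hb2⟩ := b1
  obtain ⟨b', hb1', hb2'⟩ := b2
  have : b = b' := by rw [hb1] at hb1'; exact_mod_cast hb1'
  subst this
  rw [add_mul, one_mul] at hb2
  omega

theorem c_Nm_ne (r N m h : ℕ) (hN : 0 < N) (hh : h ≤ m) : (cNm r N m).eval ((N:ℂ) * h) ≠ 0 := by
  have e0 : (N:ℂ) * h = ((N * h : ℤ) : ℂ) := by push_cast; ring
  have h1 : (N * h : ℤ) ≤ N * m := by
    have : (h:ℤ) ≤ m := by omega
    nlinarith
  have h2 : (0:ℤ) ≤ N * h := by positivity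
  rw [e0]; unfold cNm; rw [eval_mul]
  refine mul_ne_zero ?_ ?_
  · intro h; obtain ⟨i, h3, h4, h5⟩ := R_eval_int _ _ _ h
    omega
  · intro h; obtain ⟨i, h3, h4, h5⟩ := R_eval_int _ _ _ h
    push_cast at h4
    omega

theorem cB_dvd (a r N m : ℕ) (hN : 0 < N) : (X : ℂ[X]) ^ (a + 1) ∣ cB a r N m := by
  unfold cB
  rw [pow_succ]
  apply mul_dvd_mul_left
  apply Dvd.dvd.mul_right
  have : (X : ℂ[X]) = X + C (((1 - N : ℤ):ℂ) + (N - 1 : ℕ)) := by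
    rw [Nat.cast_sub hN]; simp
  unfold R
  conv_lhs => rw [this]
  exact Finset.dvd_prod_of_mem (fun i : ℕ => X + C (((1 - N : ℤ):ℂ) + i)) (Finset.mem_range.2 (by omega))

theorem cA_dvd (a r N m : ℕ) (hN : 0 < N) : (X - C ((N:ℂ) * m)) ^ (a + 1) ∣ cA a r N m := by
  unfold cA
  rw [pow_succ]
  apply mul_dvd_mul_left
  apply Dvd.dvd.mul_left
  have : (X : ℂ[X]) - C ((N:ℂ) * m) = X + C (((-(N * m) : ℤ):ℂ) + (0 : ℕ)) := by
    rw [sub_eq_add_neg, ← C_neg]; push_cast; rw [add_zero]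
  unfold R
  rw [this]
  exact Finset.dvd_prod_of_mem (fun i : ℕ => X + C (((-(N * m) : ℤ):ℂ) + i)) (Finset.mem_range.2 (by omega))

theorem cB_zero (a r N m : ℕ) (t : ℕ) (ht : t < N) : (cB a r N m).eval (t:ℂ) = 0 := by
  unfold cB
  have : (R ((1 - N : ℤ):ℂ) N).eval (t:ℂ) = 0 := by
    rw [R_eval, Finset.prod_eq_zero (i := N - 1 - t) (Finset.mem_range.2 (by omega))]
    rw [Nat.sub_sub, Nat.cast_sub (by omega)]; push_cast; ring
  rw [eval_mul, eval_mul, this]; ring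

theorem cA_zero (a r N m : ℕ) (s : ℕ) (hs : N * m < s + N) (hs2 : s ≤ N * m) : (cA a r N m).eval (s:ℂ) = 0 := by
  unfold cA
  have : (R ((-(N * m) : ℤ):ℂ) N).eval (s:ℂ) = 0 := by
    rw [R_eval, Finset.prod_eq_zero (i := N * m - s) (Finset.mem_range.2 (by omega))]
    rw [Nat.cast_sub (by omega)]; push_cast; ring
  rw [eval_mul, eval_mul, this]; ring

noncomputable def cD0 (a N m : ℕ) : ℂ[X] := ∏ h ∈ Finset.range (m + 1), (X - C ((N:ℂ) * h)) ^ a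

theorem c_recF (a r N m : ℕ) : (cA a r N m).comp (X - C (N:ℂ)) * (cNm r N m).comp (X - C (N:ℂ)) * cD0 a N m =
    cB a r N m * cNm r N m * (cD0 a N m).comp (X - C (N:ℂ)) := by
  have hD : (X - C ((N:ℂ) * (m + 1 : ℕ))) ^ a * cD0 a N m = X ^ a * (cD0 a N m).comp (X - C (N:ℂ)) := by
    unfold cD0
    rw [Polynomial.prod_comp]
    have h1 := Finset.prod_range_succ (fun h : ℕ => (X - C ((N:ℂ) * h)) ^ a) (m + 1)
    have h2 := Finset.prod_range_succ' (fun h : ℕ => (X - C ((N:ℂ) * h)) ^ a) (m + 1)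
    rw [mul_comm, ← h1, h2, mul_comm]
    congr 1
    · simp
    · apply Finset.prod_congr rfl; intro h _
      rw [pow_comp, sub_comp, X_comp, C_comp]; congr 1
      push_cast; rw [mul_add, mul_one, C_add]; ring
  have n1 : (((r * (N * m) : ℕ)) : ℂ) = r * (N * m) := by push_cast; ring
  have r1 : R ((1:ℤ) - (N:ℂ)) (r * (N * m)) * R ((r * (N * m) + 1 : ℤ) - (N:ℂ)) N =
      R ((1 - N : ℤ) : ℂ) N * R ((1:ℤ):ℂ) (r * (N * m)) := by
    have h1 := R_add ((1 - N : ℤ) : ℂ) (r * (N * m)) N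
    have h2 := R_add ((1 - N : ℤ) : ℂ) N (r * (N * m))
    rw [add_comm N (r * (N * m)), h1] at h2
    convert h2 using 3 <;> (push_cast; ring)
  have r2 : R ((-(N * m) - r * (N * m) : ℤ) - (N:ℂ)) (r * (N * m)) * R ((-(N * m) : ℤ) - (N:ℂ)) N =
      R ((-((r + 1) * (N * m)) - N : ℤ) : ℂ) N * R ((-(N * m) - r * (N * m) : ℤ) : ℂ) (r * (N * m)) := by
    have h1 := R_add ((-((r + 1) * (N * m)) - N : ℤ) : ℂ) (r * (N * m)) N
    have h2 := R_add ((-((r + 1) * (N * m)) - N : ℤ) : ℂ) N (r * (N * m))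
    rw [add_comm N (r * (N * m)), h1] at h2
    convert h2 using 3 <;> (push_cast; ring)
  have hA : (cA a r N m).comp (X - C (N:ℂ)) = (X - C ((N:ℂ) * (m + 1 : ℕ))) ^ a *
      (R ((r * (N * m) + 1 : ℤ) - (N:ℂ)) N * R ((-(N * m) : ℤ) - (N:ℂ)) N) := by
    unfold cA
    rw [mul_comp, mul_comp, R_comp, R_comp, pow_comp, sub_comp, X_comp, C_comp]; congr 2
    push_cast; rw [mul_add, mul_one, C_add]; ring
  have hNm : (cNm r N m).comp (X - C (N:ℂ)) = R ((1:ℤ) - (N:ℂ)) (r * (N * m)) *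
      R ((-(N * m) - r * (N * m) : ℤ) - (N:ℂ)) (r * (N * m)) := by
    unfold cNm
    rw [mul_comp, R_comp, R_comp]
  rw [hA, hNm]
  unfold cB cNm
  linear_combination (R ((1:ℤ) - (N:ℂ)) (r * (N * m)) * R ((r * (N * m) + 1 : ℤ) - (N:ℂ)) N) *
    (R ((-(N * m) - r * (N * m) : ℤ) - (N:ℂ)) (r * (N * m)) * R ((-(N * m) : ℤ) - (N:ℂ)) N) * hD +
    X ^ a * (cD0 a N m).comp (X - C (N:ℂ)) * (R ((-(N * m) - r * (N * m) : ℤ) - (N:ℂ)) (r * (N * m)) * R ((-(N * m) : ℤ) - (N:ℂ)) N) * r1 +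
    X ^ a * (cD0 a N m).comp (X - C (N:ℂ)) * (R ((1 - N : ℤ) : ℂ) N * R ((1:ℤ):ℂ) (r * (N * m))) * r2

end ZE
end


section
open Polynomial

namespace ZE

noncomputable def gQ (a m : ℕ) (p : ℕ → ℕ → ℚ) (h : ℤ) : ℚ[X] :=
  if 0 ≤ h ∧ h ≤ m then ∑ j ∈ Finset.Icc 1 a, C (p j h.toNat) * X ^ (a - j) else 0

noncomputable def cg (a m : ℕ) (p : ℕ → ℕ → ℚ) (h : ℤ) : ℂ[X] := (gQ a m p h).map (algebraMap ℚ ℂ)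

theorem cg_nat (a m : ℕ) (p : ℕ → ℕ → ℚ) (h : ℕ) (hh : h ≤ m) :
    cg a m p h = ∑ j ∈ Finset.Icc 1 a, C ((p j h : ℚ) : ℂ) * X ^ (a - j) := by
  unfold cg gQ
  rw [if_pos ⟨by omega, by omega⟩, Polynomial.map_sum]
  apply Finset.sum_congr rfl; intro j _
  rw [Polynomial.map_mul, map_C, Polynomial.map_pow, map_X]; simp

/-- cofactor -/
noncomputable def cof (a N m h : ℕ) : ℂ[X] := ∏ h' ∈ (Finset.range (m + 1)).erase h, (X + C ((N:ℂ) * h')) ^ a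

theorem asc_eval (k : ℕ) (x : ℂ) : (ascPochhammer ℂ k).eval x = ∏ i ∈ Finset.range k, (x + i) := by
  induction k with
  | zero => simp
  | succ k ih => rw [ascPochhammer_succ_eval, ih, Finset.prod_range_succ]

theorem asc_cast (k : ℕ) (x : ℚ) : (((ascPochhammer ℚ k).eval x : ℚ) : ℂ) = (ascPochhammer ℂ k).eval (x:ℂ) := by
  have := ascPochhammer_map (algebraMap ℚ ℂ) k
  rw [← this, eval_map_algebraMap]
  have h2 := Polynomial.aeval_algebraMap_apply ℂ x (ascPochhammer ℚ k)
  simpa using h2.symm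

theorem Nm_eval_neg (r N m : ℕ) (t : ℂ) : (cNm r N m).eval (-t) =
    (ascPochhammer ℂ (r * (N * m))).eval (t - r * (N * m)) * (ascPochhammer ℂ (r * (N * m))).eval (t + N * m + 1) := by
  unfold cNm
  rw [eval_mul, R_eval, R_eval, asc_eval, asc_eval]
  set k := r * (N * m) with hk
  have e1 : ∏ i ∈ Finset.range k, (-t + (((1:ℤ):ℂ) + i)) = ∏ i ∈ Finset.range k, (-(t - r * (N * m) + i)) := by
    rw [← Finset.prod_range_reflect]
    apply Finset.prod_congr rfl; intro i hi
    have := Finset.mem_range.1 hi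
    rw [Nat.sub_sub, Nat.cast_sub (by omega), hk]; push_cast; ring
  have e2 : ∏ i ∈ Finset.range k, (-t + (((-(N * m) - r * (N * m) : ℤ):ℂ) + i)) = ∏ i ∈ Finset.range k, (-(t + N * m + 1 + i)) := by
    rw [← Finset.prod_range_reflect]
    apply Finset.prod_congr rfl; intro i hi
    have := Finset.mem_range.1 hi
    rw [Nat.sub_sub, Nat.cast_sub (by omega), hk]; push_cast; ring
  rw [e1, e2, Finset.prod_neg, Finset.prod_neg, Finset.card_range]
  have : ((-1:ℂ) ^ k) * (-1) ^ k = 1 := by rw [← mul_pow]; norm_num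
  linear_combination (∏ i ∈ Finset.range k, (t - r * (N * m) + i)) * (∏ i ∈ Finset.range k, (t + N * m + 1 + (i:ℂ))) * this

theorem PF_poly (a r N m : ℕ) (hN : 0 < N) (p : ℕ → ℕ → ℚ) (hp : IsPartialFractionCoeffs a r N (N * m) p) :
    C ((m.factorial : ℂ) ^ (a - 2 * r * N)) * (cNm r N m).comp (-X) =
      ∑ h ∈ Finset.range (m + 1), (cg a m p h).comp (X + C ((N:ℂ) * h)) * cof a N m h := by
  apply Polynomial.eq_of_infinite_eval_eq
  apply Set.infinite_of_injective_forall_mem (f := fun t : ℕ => ((t + 1 : ℕ) : ℂ))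
  · intro x y h
    have := Nat.cast_injective h
    omega
  intro t
  have hne : ∀ h : ℕ, (((t + 1 : ℕ) : ℚ) + N * h) ≠ 0 := by intro h; positivity
  have h1 := hp ((t + 1 : ℕ) : ℚ) (fun h _ => hne h)
  unfold Frat at h1
  rw [Nat.mul_div_cancel_left _ hN] at h1
  have h2 := congrArg (fun x : ℚ => (x : ℂ)) h1
  rw [Rat.cast_div, Rat.cast_mul, Rat.cast_mul, asc_cast, asc_cast] at h2
  push_cast at h2
  have hne' : ∀ h : ℕ, ((t:ℂ) + 1 + N * h) ≠ 0 := by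
    intro h; have : ((t + 1 + N * h : ℕ) : ℂ) ≠ 0 := Nat.cast_ne_zero.2 (by omega)
    push_cast at this; exact this
  have hD : ∏ x ∈ Finset.range (m + 1), ((t:ℂ) + 1 + N * x) ^ a ≠ 0 :=
    Finset.prod_ne_zero_iff.2 (fun h _ => pow_ne_zero _ (hne' h))
  rw [div_eq_iff hD, Finset.sum_mul] at h2
  simp only [Set.mem_ofPred_eq]
  rw [eval_mul, eval_C, eval_comp, eval_neg, eval_X, Nm_eval_neg, eval_finsetSum]
  push_cast
  rw [← mul_assoc, h2]
  apply Finset.sum_congr rfl; intro h hh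
  have hm := Finset.mem_range.1 hh
  rw [← Finset.mul_prod_erase _ _ hh, ← mul_assoc, eval_mul]
  congr 1
  · rw [cg_nat a m p h (by omega), Polynomial.sum_comp, eval_finsetSum, Finset.sum_mul]
    apply Finset.sum_congr rfl; intro j hj
    have hj := Finset.mem_Icc.1 hj
    rw [mul_comp, C_comp, X_pow_comp, eval_mul, eval_C, eval_pow, eval_add, eval_X, eval_C, div_mul_eq_mul_div, div_eq_iff (pow_ne_zero _ (hne' h)),
      mul_assoc, ← pow_add, Nat.sub_add_cancel hj.2]
  · unfold cof
    rw [eval_prod]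
    apply Finset.prod_congr rfl; intro h' _
    simp

noncomputable def Dh (a N m h : ℕ) : ℂ[X] := ∏ h' ∈ (Finset.range (m + 1)).erase h, (X + C ((N:ℂ) * h' - N * h)) ^ a

theorem PF_dvd (a r N m : ℕ) (hN : 0 < N) (p : ℕ → ℕ → ℚ) (hp : IsPartialFractionCoeffs a r N (N * m) p) (h : ℕ) (hh : h ≤ m) :
    X ^ a ∣ Dh a N m h * cg a m p h - C ((m.factorial : ℂ) ^ (a - 2 * r * N)) * (cNm r N m).comp (C ((N:ℂ) * h) - X) := by
  have h1 := congrArg (fun f : ℂ[X] => f.comp (X - C ((N:ℂ) * h))) (PF_poly a r N m hN p hp)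
  have hmem : h ∈ Finset.range (m + 1) := Finset.mem_range.2 (by omega)
  rw [mul_comp, C_comp, comp_assoc, Polynomial.sum_comp, ← Finset.add_sum_erase _ _ hmem] at h1
  have e1 : (-X : ℂ[X]).comp (X - C ((N:ℂ) * h)) = C ((N:ℂ) * h) - X := by simp
  rw [e1] at h1
  rw [h1]
  have e2 : ((cg a m p h).comp (X + C ((N:ℂ) * h)) * cof a N m h).comp (X - C ((N:ℂ) * h)) = Dh a N m h * cg a m p h := by
    rw [mul_comp, comp_assoc]
    have : (X + C ((N:ℂ) * h)).comp (X - C ((N:ℂ) * h)) = X := by rw [add_comp, X_comp, C_comp]; ring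
    rw [this, comp_X, mul_comm]; congr 1
    unfold cof Dh
    rw [Polynomial.prod_comp]; apply Finset.prod_congr rfl; intro h' _
    rw [pow_comp, add_comp, X_comp, C_comp, C_sub]; congr 1; ring
  rw [e2, sub_add_cancel_left]
  rw [dvd_neg]
  apply Finset.dvd_sum
  intro h' hh'
  have hh' := Finset.mem_erase.1 hh'
  rw [mul_comp]
  apply Dvd.dvd.mul_left
  unfold cof
  rw [Polynomial.prod_comp]
  have := Finset.dvd_prod_of_mem (fun h' : ℕ => ((X + C ((N:ℂ) * h')) ^ a).comp (X - C ((N:ℂ) * h)))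
    (show h ∈ (Finset.range (m + 1)).erase h' from Finset.mem_erase.2 ⟨hh'.1.symm, hmem⟩)
  refine Dvd.dvd.trans ?_ this
  rw [pow_comp, add_comp, X_comp, C_comp, sub_add_cancel]

theorem Dh_zero (a N m h : ℕ) (hN : 0 < N) : (Dh a N m h).eval 0 ≠ 0 := by
  unfold Dh
  rw [eval_prod, Finset.prod_ne_zero_iff]
  intro h' hh'
  have hh' := (Finset.mem_erase.1 hh').1
  rw [eval_pow, eval_add, eval_X, eval_C, zero_add]
  apply pow_ne_zero
  rw [← mul_sub]
  refine mul_ne_zero (Nat.cast_ne_zero.2 hN.ne') (sub_ne_zero.2 ?_)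
  exact_mod_cast hh'

theorem D0_comp (a N m h : ℕ) (hh : h ≤ m) : (cD0 a N m).comp (C ((N:ℂ) * h) - X) =
    C ((-1) ^ (a * (m + 1))) * (X ^ a * Dh a N m h) := by
  unfold cD0 Dh
  have hmem : h ∈ Finset.range (m + 1) := Finset.mem_range.2 (by omega)
  have e : (X:ℂ[X]) ^ a = (X + C ((N:ℂ) * h - N * h)) ^ a := by simp
  rw [e, Finset.mul_prod_erase (Finset.range (m + 1)) (fun h' : ℕ => (X + C ((N:ℂ) * h' - N * h)) ^ a) hmem, Polynomial.prod_comp,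
    pow_mul, C_pow]
  have : (C ((-1:ℂ) ^ a)) ^ (m + 1) = ∏ _x ∈ Finset.range (m + 1), C ((-1:ℂ) ^ a) := by
    rw [Finset.prod_const, Finset.card_range]
  rw [this, ← Finset.prod_mul_distrib]
  apply Finset.prod_congr rfl; intro h' _
  rw [pow_comp, sub_comp, X_comp, C_comp, C_pow, ← mul_pow]
  congr 1
  rw [C_sub, C_neg, C_1]; ring

theorem c_P1 (a r N m : ℕ) (hN : 0 < N) (p : ℕ → ℕ → ℚ) (hp : IsPartialFractionCoeffs a r N (N * m) p) (h : ℤ) :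
    X ^ a ∣ (cA a r N m).comp (C ((N:ℂ) * (h - 1 : ℤ)) - X) * cg a m p (h - 1) - (cB a r N m).comp (C ((N:ℂ) * h) - X) * cg a m p h := by
  have g0 : ∀ k : ℤ, (k < 0 ∨ (m:ℤ) < k) → cg a m p k = 0 := by
    intro k hk; unfold cg gQ; rw [if_neg (by omega), Polynomial.map_zero]
  rcases lt_trichotomy h 0 with h1 | h1 | h1
  · rw [g0 _ (Or.inl (by omega)), g0 h (Or.inl h1)]; simp
  · rw [h1, g0 (0 - 1) (Or.inl (by omega)), mul_zero, zero_sub, dvd_neg]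
    apply Dvd.dvd.mul_right
    unfold cB
    rw [mul_comp, X_pow_comp]
    apply Dvd.dvd.mul_right
    rw [Int.cast_zero, mul_zero, C_0, zero_sub]
    exact pow_dvd_pow_of_dvd (dvd_neg.2 dvd_rfl) a
  rcases lt_trichotomy h (m + 1) with h2 | h2 | h2
  · obtain ⟨k, rfl⟩ : ∃ k : ℕ, h = ((k + 1 : ℕ) : ℤ) := ⟨(h - 1).toNat, by omega⟩
    have ek : ((k + 1 : ℕ) : ℤ) - 1 = (k:ℤ) := by omega
    rw [ek]
    have p1 := PF_dvd a r N m hN p hp k (by omega)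
    have p2 := PF_dvd a r N m hN p hp (k + 1) (by omega)
    have hr := congrArg (fun f : ℂ[X] => f.comp (C ((N:ℂ) * (k + 1 : ℕ)) - X)) (c_recF a r N m)
    have es : (X - C (N:ℂ)).comp (C ((N:ℂ) * (k + 1 : ℕ)) - X) = C ((N:ℂ) * k) - X := by
      rw [sub_comp, X_comp, C_comp]; push_cast; rw [mul_add, mul_one, C_add]; ring
    rw [mul_comp, mul_comp, mul_comp, mul_comp, comp_assoc, comp_assoc, comp_assoc, es, D0_comp a N m (k + 1) (by omega),
      D0_comp a N m k (by omega)] at hr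
    set A' := (cA a r N m).comp (C ((N:ℂ) * k) - X) with hA'
    set B' := (cB a r N m).comp (C ((N:ℂ) * (k + 1 : ℕ)) - X) with hB'
    set N1 := (cNm r N m).comp (C ((N:ℂ) * k) - X)
    set N2 := (cNm r N m).comp (C ((N:ℂ) * (k + 1 : ℕ)) - X)
    have hr2 : A' * N1 * Dh a N m (k + 1) = B' * N2 * Dh a N m k := by
      have hz : C ((-1:ℂ) ^ (a * (m + 1))) * X ^ a ≠ 0 := by
        apply mul_ne_zero _ (pow_ne_zero _ X_ne_zero)
        rw [Ne, C_eq_zero]; exact pow_ne_zero _ (by norm_num)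
      apply mul_left_cancel₀ hz
      linear_combination hr
    have hc : IsCoprime ((X:ℂ[X]) ^ a) (Dh a N m k * Dh a N m (k + 1)) := by
      apply IsCoprime.pow_left
      rw [← sub_zero X, ← C_0]
      rw [Irreducible.coprime_iff_not_dvd (irreducible_X_sub_C 0), dvd_iff_isRoot, IsRoot, eval_mul]
      exact mul_ne_zero (Dh_zero a N m k hN) (Dh_zero a N m (k+1) hN)
    simp only [Int.cast_natCast]
    apply hc.dvd_of_dvd_mul_left
    obtain ⟨Q1, hQ1⟩ := p1
    obtain ⟨Q2, hQ2⟩ := p2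
    refine ⟨Dh a N m (k + 1) * A' * Q1 - Dh a N m k * B' * Q2, ?_⟩
    linear_combination Dh a N m (k + 1) * A' * hQ1 - Dh a N m k * B' * hQ2 + C ((m.factorial : ℂ) ^ (a - 2 * r * N)) * hr2
  · rw [g0 h (Or.inr (by omega)), mul_zero, sub_zero, h2]
    apply Dvd.dvd.mul_right
    unfold cA
    rw [mul_comp, pow_comp]
    apply Dvd.dvd.mul_right
    rw [sub_comp, X_comp, C_comp]
    apply pow_dvd_pow_of_dvd
    push_cast; rw [add_sub_cancel_right]
    have : C ((N:ℂ) * m) - X - C ((N:ℂ) * m) = -X := by ring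
    rw [this]
    exact dvd_neg.2 dvd_rfl
  · rw [g0 _ (Or.inr (by omega)), g0 h (Or.inr (by omega))]; simp

theorem mkSetup (a r N m Kb : ℕ) (hN : 0 < N) (hr : 0 < r) (ha : 2 * r * N < a) (hm : Kb + 1 ≤ m) (p : ℕ → ℕ → ℚ)
    (hp : IsPartialFractionCoeffs a r N (N * m) p) :
    Setup a N m (a + 2 * N) Kb (cA a r N m) (cB a r N m) (cNm r N m) (cg a m p) where
  ha := by omega
  hN := hN
  degA := (cA_deg a r N m).le
  degB := (cB_deg a r N m).le
  hA0 := (cA_monic a r N m).ne_zero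
  hB0 := (cB_monic a r N m).ne_zero
  hKm := by omega
  g_deg h := by
    unfold cg gQ
    refine lt_of_le_of_lt natDegree_map_le ?_
    split_ifs
    · have : (∑ j ∈ Finset.Icc 1 a, C (p j h.toNat) * X ^ (a - j)).natDegree ≤ a - 1 := by
        apply natDegree_sum_le_of_forall_le
        intro j hj
        have hj := Finset.mem_Icc.1 hj
        exact (natDegree_C_mul_X_pow_le _ _).trans (by omega)
      omega
    · simp; omega
  g_neg h hh := by unfold cg gQ; rw [if_neg (by omega), Polynomial.map_zero]
  g_big h hh := by unfold cg gQ; rw [if_neg (by omega), Polynomial.map_zero]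
  g_ne h h1 h2 := by
    obtain ⟨k, rfl⟩ : ∃ k : ℕ, h = k := ⟨h.toNat, by omega⟩
    obtain ⟨Q, hQ⟩ := PF_dvd a r N m hN p hp k (by omega)
    have h3 := congrArg (fun f : ℂ[X] => f.eval 0) hQ
    simp only [eval_sub, eval_mul, eval_C, eval_comp, eval_pow, eval_X, sub_zero] at h3
    rw [zero_pow (by omega), zero_mul] at h3
    rw [coeff_zero_eq_eval_zero]
    intro hz
    rw [hz, mul_zero, zero_sub, neg_eq_zero] at h3
    refine mul_ne_zero (pow_ne_zero _ (Nat.cast_ne_zero.2 (Nat.factorial_ne_zero m))) (c_Nm_ne r N m k hN (by omega)) h3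
  P1 h := c_P1 a r N m hN p hp h
  A_ne k h1 h2 := by
    have e0 : (N:ℂ) * k = ((N * k : ℤ) : ℂ) := by push_cast; ring
    rw [e0]
    apply c_hAZ a r N m Kb hN hr hm
    · have : (0:ℤ) < N := by omega
      nlinarith
    · have : (0:ℤ) < N := by omega
      nlinarith
  B_ne k h1 h2 := c_BZ a r N m Kb hN hr hm k h1 h2
  recF := c_recF a r N m
  Nm_ne h hh := c_Nm_ne r N m h hN hh

end ZE
end


section
open Polynomial

namespace ZE

noncomputable abbrev al : ℚ[X] →+* RatFunc ℚ := algebraMap ℚ[X] (RatFunc ℚ)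

theorem al_inj : Function.Injective al := RatFunc.algebraMap_injective ℚ

theorem al_X : al X = RatFunc.X := RatFunc.algebraMap_X

theorem ratDeriv_mul (k : ℕ) (f : RatFunc ℚ) (P : ℚ[X]) (h : RatFunc.X ^ k * f = al P) :
    RatFunc.X ^ (k + 1) * ratDeriv f = al (X * derivative P - C (k:ℚ) * P) := by
  have hd : al f.denom ≠ 0 := by
    rw [Ne, map_eq_zero_iff _ al_inj]; exact f.denom_ne_zero
  have hf : f * al f.denom = al f.num := by
    exact ((div_eq_iff hd).1 (RatFunc.num_div_denom f)).symm
  have h1 : P * f.denom = X ^ k * f.num := by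
    apply al_inj
    rw [map_mul, ← h, map_mul, map_pow, al_X, ← hf]; ring
  have h2 : derivative (P * f.denom) = derivative (X ^ k * f.num) := by rw [h1]
  rw [derivative_mul, derivative_mul] at h2
  have h3 : X * derivative (X ^ k : ℚ[X]) = C (k:ℚ) * X ^ k := by
    cases k with
    | zero => simp
    | succ k => rw [derivative_X_pow]; simp; ring
  have h4 : X ^ (k + 1) * (derivative f.num * f.denom - f.num * derivative f.denom) =
      (X * derivative P - C (k:ℚ) * P) * f.denom ^ 2 := by
    linear_combination -(X * f.denom) * h2 - f.num * f.denom * h3 + (X * derivative f.denom + C (k:ℚ) * f.denom) * h1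
  have hd2 : al (f.denom ^ 2) ≠ 0 := by rw [map_pow]; exact pow_ne_zero _ hd
  unfold ratDeriv
  rw [RatFunc.mk_eq_div, ← mul_div_assoc, div_eq_iff hd2, ← al_X, ← map_pow, ← map_mul, h4, map_mul]

noncomputable def ph {K : Type} [Field K] (k : ℕ) : K[X] := ∏ i ∈ Finset.range k, (X - C (i:K))

theorem ph_succ {K : Type} [Field K] (k : ℕ) : (ph (k + 1) : K[X]) = (X - C (k:K)) * ph k := by
  unfold ph; rw [Finset.prod_range_succ, mul_comm]

theorem X_ne : (RatFunc.X : RatFunc ℚ) ≠ 0 := RatFunc.X_ne_zero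

theorem ratDeriv_zero : ratDeriv 0 = 0 := by
  have := ratDeriv_mul 0 0 0 (by simp)
  simpa [X_ne] using this

noncomputable def Pk (a N m : ℕ) (p : ℕ → ℕ → ℚ) (k e : ℕ) : ℚ[X] :=
  ∑ h ∈ Finset.range (m + 1), C (qe N (gQ a m p) (ph k) h e) * X ^ (N * h)

theorem PPk_big (a N n : ℕ) (p : ℕ → ℕ → ℚ) (k j : ℕ) (hj : a < j) : PPk a N n p k j = 0 := by
  induction k generalizing j with
  | zero => unfold PPk Ppoly; rw [if_neg (by omega), map_zero]
  | succ k ih => unfold PPk; rw [ih j hj, ih (j+1) (by omega), ratDeriv_zero]; simp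

theorem theta (c : ℚ) (e : ℕ) : X * derivative (C c * X ^ e) = C (e * c) * X ^ e := by
  cases e with
  | zero => simp
  | succ k => rw [derivative_C_mul_X_pow]; simp; ring

theorem qe_zero_ph (a N m : ℕ) (p : ℕ → ℕ → ℚ) (h j : ℕ) (hh : h ≤ m) (h1 : 1 ≤ j) (h2 : j ≤ a) :
    qe N (gQ a m p) (ph 0) h (a - j) = p j h := by
  unfold qe ph gQ
  rw [if_pos ⟨by omega, by omega⟩, Finset.prod_range_zero, one_comp, one_mul, finsetSum_coeff, Finset.sum_eq_single j]
  · simp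
  · intro b hb hne
    have hb := Finset.mem_Icc.1 hb
    rw [coeff_C_mul_X_pow, if_neg (by omega)]
  · intro hn; exact absurd (Finset.mem_Icc.2 ⟨h1, h2⟩) hn

theorem PPk_eq (a N m : ℕ) (hN : 0 < N) (p : ℕ → ℕ → ℚ) (k j : ℕ) (h1 : 1 ≤ j) (h2 : j ≤ a) :
    RatFunc.X ^ k * PPk a N (N * m) p k j = al (Pk a N m p k (a - j)) := by
  induction k generalizing j with
  | zero =>
    unfold PPk Ppoly Pk
    rw [if_pos ⟨h1, h2⟩, pow_zero, one_mul, Nat.mul_div_cancel_left _ hN]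
    congr 1
    apply Finset.sum_congr rfl; intro h hh
    rw [qe_zero_ph a N m p h j (by have := Finset.mem_range.1 hh; omega) h1 h2]
  | succ k ih =>
    have e1 := ratDeriv_mul k _ _ (ih j h1 h2)
    have e3 : X * derivative (Pk a N m p k (a - j)) = ∑ h ∈ Finset.range (m + 1), C ((N * h : ℕ) * qe N (gQ a m p) (ph k) h (a - j)) * X ^ (N * h) := by
      unfold Pk
      rw [derivative_sum, Finset.mul_sum]
      apply Finset.sum_congr rfl; intro h _; rw [theta]
    have e4 : RatFunc.X ^ (k + 1) * (1 / RatFunc.X * PPk a N (N * m) p k (j + 1)) = RatFunc.X ^ k * PPk a N (N * m) p k (j + 1) := by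
      rw [pow_succ]; field_simp [X_ne]
    rw [PPk, mul_sub, e1, e4, e3]
    rcases Nat.lt_or_ge j a with hja | hja
    · rw [ih (j + 1) (by omega) (by omega), ← map_sub]
      congr 1
      unfold Pk
      rw [Finset.mul_sum, ← Finset.sum_sub_distrib, ← Finset.sum_sub_distrib]
      apply Finset.sum_congr rfl; intro h _
      have := qe_rec N (gQ a m p) (k:ℚ) (ph k) h (a - (j + 1))
      rw [show a - (j + 1) + 1 = a - j by omega] at this
      rw [ph_succ, this]; simp; ring
    · rw [PPk_big a N (N * m) p k (j + 1) (by omega), mul_zero, sub_zero]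
      congr 1
      unfold Pk
      rw [Finset.mul_sum, ← Finset.sum_sub_distrib]
      apply Finset.sum_congr rfl; intro h _
      rw [show a - j = 0 by omega, ph_succ, qe_rec_zero]; simp; ring

end ZE
end


section
open Polynomial

namespace ZE

theorem telA (b n : ℕ) (hb : b ≤ n) : (1 - X : ℚ[X]) * ∑ t ∈ Finset.range n, (if b < t + 1 then X ^ (t + 1) else 0) = X ^ (b + 1) - X ^ (n + 1) := by
  induction n with
  | zero => have : b = 0 := by omega
            subst this; simp
  | succ n ih =>
    rw [Finset.sum_range_succ, mul_add]
    rcases Nat.lt_or_ge n b with h | h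
    · rw [if_neg (by omega), Finset.sum_eq_zero]
      · have : b = n + 1 := by omega
        rw [this]; simp
      · intro t ht; have := Finset.mem_range.1 ht; rw [if_neg (by omega)]
    · rw [ih h, if_pos (by omega)]; ring

theorem telB (b n : ℕ) (hb : b ≤ n) : (1 - X : ℚ[X]) * ∑ t ∈ Finset.range n, (if t < b then X ^ t else 0) = 1 - X ^ b := by
  induction n with
  | zero => have : b = 0 := by omega
            subst this; simp
  | succ n ih =>
    rw [Finset.sum_range_succ, mul_add]
    rcases Nat.lt_or_ge n b with h | h
    · have : b = n + 1 := by omega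
      subst this
      rw [if_pos (by omega), Finset.sum_congr rfl (g := fun t => (X:ℚ[X]) ^ t)]
      · rw [mul_neg_geom_sum]; ring
      · intro t ht; have := Finset.mem_range.1 ht; rw [if_pos (by omega)]
    · rw [ih h, if_neg (by omega)]; ring

theorem telU (N m : ℕ) (q : ℕ → ℚ) (hq : ∑ h ∈ Finset.range (m + 1), q h = 0) :
    (1 - X : ℚ[X]) * ∑ t ∈ Finset.range (N * m), C (∑ h ∈ Finset.range (m + 1), if N * h < t + 1 then q h else 0) * X ^ (t + 1) =
      X * ∑ h ∈ Finset.range (m + 1), C (q h) * X ^ (N * h) := by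
  have e : ∑ t ∈ Finset.range (N * m), C (∑ h ∈ Finset.range (m + 1), if N * h < t + 1 then q h else 0) * (X:ℚ[X]) ^ (t + 1) =
      ∑ h ∈ Finset.range (m + 1), C (q h) * ∑ t ∈ Finset.range (N * m), if N * h < t + 1 then X ^ (t + 1) else 0 := by
    simp_rw [map_sum, Finset.sum_mul, Finset.mul_sum]
    rw [Finset.sum_comm]
    apply Finset.sum_congr rfl; intro h _
    apply Finset.sum_congr rfl; intro t _
    split_ifs <;> simp
  rw [e, Finset.mul_sum, Finset.mul_sum]
  have e2 : ∑ h ∈ Finset.range (m + 1), C (q h) * (X:ℚ[X]) ^ (N * m + 1) = 0 := by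
    rw [← Finset.sum_mul, ← map_sum, hq]; simp
  refine Eq.trans (b := ∑ h ∈ Finset.range (m + 1), X * (C (q h) * X ^ (N * h)) - ∑ h ∈ Finset.range (m + 1), C (q h) * (X:ℚ[X]) ^ (N * m + 1)) ?_
    (by rw [e2, sub_zero])
  rw [← Finset.sum_sub_distrib]
  apply Finset.sum_congr rfl; intro h hh
  have := telA (N * h) (N * m) (Nat.mul_le_mul_left _ (by have := Finset.mem_range.1 hh; omega))
  linear_combination C (q h) * this

theorem telV (N m : ℕ) (q : ℕ → ℚ) (hq : ∑ h ∈ Finset.range (m + 1), q h = 0) :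
    (1 - X : ℚ[X]) * ∑ t ∈ Finset.range (N * m), C (∑ h ∈ Finset.range (m + 1), if t < N * h then q h else 0) * X ^ t =
      -∑ h ∈ Finset.range (m + 1), C (q h) * X ^ (N * h) := by
  have e : ∑ t ∈ Finset.range (N * m), C (∑ h ∈ Finset.range (m + 1), if t < N * h then q h else 0) * (X:ℚ[X]) ^ t =
      ∑ h ∈ Finset.range (m + 1), C (q h) * ∑ t ∈ Finset.range (N * m), if t < N * h then X ^ t else 0 := by
    simp_rw [map_sum, Finset.sum_mul, Finset.mul_sum]
    rw [Finset.sum_comm]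
    apply Finset.sum_congr rfl; intro h _
    apply Finset.sum_congr rfl; intro t _
    split_ifs <;> simp
  rw [e, Finset.mul_sum]
  have e2 : ∑ h ∈ Finset.range (m + 1), C (q h) = (0 : ℚ[X]) := by
    rw [← map_sum, hq]; simp
  refine Eq.trans (b := ∑ h ∈ Finset.range (m + 1), C (q h) - ∑ h ∈ Finset.range (m + 1), C (q h) * (X:ℚ[X]) ^ (N * h)) ?_
    (by rw [e2, zero_sub])
  rw [← Finset.sum_sub_distrib]
  apply Finset.sum_congr rfl; intro h hh
  have := telB (N * h) (N * m) (Nat.mul_le_mul_left _ (by have := Finset.mem_range.1 hh; omega))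
  linear_combination C (q h) * this

theorem gv_one (a N m : ℕ) (p : ℕ → ℕ → ℚ) (h : ℕ) (hh : h ≤ m) (y : ℚ) (hy : y ≠ 0) :
    gv a N (gQ a m p) (ph 0) h y = ∑ j ∈ Finset.Icc 1 a, p j h / y ^ j := by
  unfold gv
  symm
  refine Finset.sum_bij' (fun j _ => a - j) (fun e _ => a - e) ?_ ?_ ?_ ?_ ?_
  · intro j hj; have := Finset.mem_Icc.1 hj; exact Finset.mem_range.2 (by omega)
  · intro e he; have := Finset.mem_range.1 he; exact Finset.mem_Icc.2 (by omega)
  · intro j hj; have := Finset.mem_Icc.1 hj; omega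
  · intro j hj; have := Finset.mem_range.1 hj; omega
  · intro j hj
    have hj := Finset.mem_Icc.1 hj
    rw [qe_zero_ph a N m p h j hh hj.1 hj.2, div_eq_mul_inv]
    congr 1
    have : y ^ a = y ^ (a - j) * y ^ j := by rw [← pow_add]; congr 1; omega
    rw [this]; field_simp

theorem ph_zero {K : Type} [Field K] : (ph 0 : K[X]) = 1 := by unfold ph; simp

noncomputable def Uk (a N m : ℕ) (p : ℕ → ℕ → ℚ) (k : ℕ) : ℚ[X] :=
  ∑ t ∈ Finset.range (N * m), C (uu a N m (gQ a m p) (ph k) (t + 1)) * X ^ (t + 1)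

noncomputable def Vk (a N m : ℕ) (p : ℕ → ℕ → ℚ) (k : ℕ) : ℚ[X] :=
  ∑ t ∈ Finset.range (N * m), C (vv a N m (gQ a m p) (ph k) t) * X ^ t

theorem uu_ph0 (a N m : ℕ) (hN : 0 < N) (p : ℕ → ℕ → ℚ) (t : ℕ) (h1 : 1 ≤ t) (h2 : t ≤ N * m) : uu a N m (gQ a m p) (ph 0) t =
    -∑ j ∈ Finset.Icc 1 a, ∑ h ∈ Finset.range ((t - 1) / N + 1), p j h / ((t : ℚ) - N * h) ^ j := by
  unfold uu u0 dd
  rw [ph_zero, eval_one, one_mul, neg_add_eq_sub, ← Finset.sum_sub_distrib, Finset.sum_comm, ← Finset.sum_neg_distrib]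
  have hs : Finset.range ((t - 1) / N + 1) = (Finset.range (m + 1)).filter (fun h => N * h < t) := by
    ext h
    rw [Finset.mem_range, Finset.mem_filter, Finset.mem_range, Nat.lt_succ_iff, Nat.le_div_iff_mul_le hN, mul_comm h N]
    constructor
    · intro hh
      refine ⟨?_, by omega⟩
      by_contra hc
      have := Nat.mul_le_mul_left N (show m + 1 ≤ h by omega)
      rw [mul_add] at this
      omega
    · rintro ⟨_, h4⟩; omega
  rw [hs, Finset.sum_filter]
  apply Finset.sum_congr rfl; intro h hh
  have hhm := Finset.mem_range.1 hh
  split_ifs with hc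
  · rw [sub_sub_cancel_left, ← ph_zero, gv_one a N m p h (by omega)]
    have : ((N * h : ℕ) : ℚ) < t := by exact_mod_cast hc
    push_cast at this
    linarith
  · simp

theorem vv_ph0 (a N m : ℕ) (hN : 0 < N) (p : ℕ → ℕ → ℚ) (t : ℕ) : vv a N m (gQ a m p) (ph 0) t =
    -∑ j ∈ Finset.Icc 1 a, ∑ h ∈ Finset.Icc ((t + N) / N) m, p j h / ((N * h : ℚ) - t) ^ j := by
  unfold vv
  rw [Finset.sum_comm, ← Finset.sum_neg_distrib, ← Finset.sum_neg_distrib]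
  have hs : Finset.Icc ((t + N) / N) m = (Finset.range (m + 1)).filter (fun h => t < N * h) := by
    ext h
    rw [Finset.mem_Icc, Finset.mem_filter, Finset.mem_range, Nat.add_div_right _ hN, Nat.succ_le_iff, Nat.div_lt_iff_lt_mul hN, mul_comm h N]
    omega
  rw [hs, Finset.sum_filter]
  apply Finset.sum_congr rfl; intro h hh
  have hhm := Finset.mem_range.1 hh
  split_ifs with hc
  · rw [gv_one a N m p h (by omega)]
    have : (t:ℚ) < ((N * h : ℕ) : ℚ) := by exact_mod_cast hc
    push_cast at this
    linarith
  · simp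

theorem one_sub_X_ne : (1 - RatFunc.X : RatFunc ℚ) ≠ 0 := by
  rw [← al_X, ← map_one al, ← map_sub, Ne, map_eq_zero_iff _ al_inj]
  intro h
  have := congrArg (fun f : ℚ[X] => f.eval 0) h
  simp at this

theorem UkF_step (a N m : ℕ) (ha : 0 < a) (hN : 0 < N) (p : ℕ → ℕ → ℚ) (k : ℕ)
    (hU : RatFunc.X ^ k * UkF a N (N * m) p k = al (Uk a N m p k)) :
    RatFunc.X ^ (k + 1) * UkF a N (N * m) p (k + 1) * (1 - RatFunc.X) =
      al ((X * derivative (Uk a N m p k) - C (k:ℚ) * Uk a N m p k) * (1 - X) - X * Pk a N m p k (a - 1)) := by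
  have h1 := ratDeriv_mul k _ _ hU
  have h2 := PPk_eq a N m hN p k 1 le_rfl ha
  have := one_sub_X_ne
  generalize X * derivative (Uk a N m p k) - C (k:ℚ) * Uk a N m p k = W at h1 ⊢
  rw [UkF, mul_sub (RatFunc.X ^ (k+1)), h1, sub_mul (al W), map_sub al (W * _), map_mul al W]
  congr 1
  · rw [map_sub al 1, map_one, al_X]
  · rw [map_mul, ← h2, al_X]; field_simp; ring

theorem UkF_eq (a N m : ℕ) (ha : 0 < a) (hN : 0 < N) (p : ℕ → ℕ → ℚ) (k : ℕ)
    (hP : ∀ k' < k, ∑ h ∈ Finset.range (m + 1), qe N (gQ a m p) (ph k') h (a - 1) = 0) :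
    RatFunc.X ^ k * UkF a N (N * m) p k = al (Uk a N m p k) := by
  induction k with
  | zero =>
    rw [pow_zero, one_mul, UkF]
    congr 1
    unfold Upoly Uk
    rw [← Finset.sum_neg_distrib]
    rw [show Finset.Icc 1 (N * m) = Finset.Ico (0 + 1) (N * m + 1) by ext x; simp,
      ← Finset.sum_Ico_add', Nat.Ico_zero_eq_range]
    apply Finset.sum_congr rfl; intro t ht
    have ht := Finset.mem_range.1 ht
    rw [uu_ph0 a N m hN p (t + 1) (by omega) (by omega), C_neg, neg_mul]
  | succ k ih =>
    have hU := ih (fun k' hk' => hP k' (by omega))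
    have h1 := UkF_step a N m ha hN p k hU
    apply mul_right_cancel₀ one_sub_X_ne
    rw [h1]
    have h3 : (1 - RatFunc.X : RatFunc ℚ) = al (1 - X) := by rw [map_sub, map_one, al_X]
    rw [h3, ← map_mul]
    congr 1
    have h4 := telU N m (fun h => qe N (gQ a m p) (ph k) h (a - 1)) (hP k (by omega))
    unfold Pk
    rw [← h4, mul_comm (1 - X) (∑ t ∈ _, _), ← sub_mul]
    congr 1
    unfold Uk
    rw [derivative_sum, Finset.mul_sum, Finset.mul_sum, ← Finset.sum_sub_distrib, ← Finset.sum_sub_distrib]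
    apply Finset.sum_congr rfl; intro t _
    rw [theta, ph_succ, uu_rec a N m _ ha]
    simp; ring

theorem VkF_eq (a N m : ℕ) (ha : 0 < a) (hN : 0 < N) (p : ℕ → ℕ → ℚ) (k : ℕ)
    (hP : ∀ k' < k, ∑ h ∈ Finset.range (m + 1), qe N (gQ a m p) (ph k') h (a - 1) = 0) :
    RatFunc.X ^ k * VkF a N (N * m) p k = al (Vk a N m p k) := by
  induction k with
  | zero =>
    rw [pow_zero, one_mul, VkF]
    congr 1
    unfold Vpoly Vk
    rw [← Finset.sum_neg_distrib]
    apply Finset.sum_congr rfl; intro t _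
    rw [vv_ph0 a N m hN, Nat.mul_div_cancel_left _ hN, C_neg, neg_mul]
  | succ k ih =>
    have hU := ih (fun k' hk' => hP k' (by omega))
    have h1 := ratDeriv_mul k _ _ hU
    have h2 := PPk_eq a N m hN p k 1 le_rfl ha
    have hx := one_sub_X_ne
    have hX := X_ne
    apply mul_right_cancel₀ hx
    rw [VkF, mul_add, h1, add_mul]
    have h5 : RatFunc.X ^ (k + 1) * (1 / (RatFunc.X * (1 - RatFunc.X)) * PPk a N (N * m) p k 1) * (1 - RatFunc.X) = al (Pk a N m p k (a - 1)) := by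
      rw [← h2]; field_simp; ring
    rw [h5]
    have h3 : (1 - RatFunc.X : RatFunc ℚ) = al (1 - X) := by rw [map_sub, map_one, al_X]
    rw [h3, ← map_mul, ← map_mul, ← map_add]
    congr 1
    have h4 := telV N m (fun h => qe N (gQ a m p) (ph k) h (a - 1)) (hP k (by omega))
    unfold Pk
    rw [← neg_neg (∑ h ∈ Finset.range (m+1), _), ← h4, mul_comm (1 - X) (∑ t ∈ _, _), ← neg_mul, ← add_mul]
    congr 1
    unfold Vk
    rw [derivative_sum, Finset.mul_sum, Finset.mul_sum, ← Finset.sum_sub_distrib, ← Finset.sum_neg_distrib, ← Finset.sum_add_distrib]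
    apply Finset.sum_congr rfl; intro t _
    rw [theta, ph_succ, vv_rec a N m _ ha]
    simp; ring

end ZE
end


section
open Polynomial

namespace ZE

def LN (N : ℕ) (f : RatFunc ℚ) : Prop := ∃ (M : ℕ) (P : ℚ[X]), RatFunc.X ^ (N * M) * f = al (expand ℚ N P)

theorem LN_lift {N : ℕ} {f : RatFunc ℚ} {M : ℕ} {P : ℚ[X]} (h : RatFunc.X ^ (N * M) * f = al (expand ℚ N P)) (L : ℕ) :
    RatFunc.X ^ (N * (M + L)) * f = al (expand ℚ N (X ^ L * P)) := by
  rw [map_mul, map_mul, ← h, map_pow, expand_X, map_pow, map_pow, al_X]; ring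

theorem LN_add {N : ℕ} {f g : RatFunc ℚ} (hf : LN N f) (hg : LN N g) : LN N (f + g) := by
  obtain ⟨M, P, h⟩ := hf
  obtain ⟨M', P', h'⟩ := hg
  refine ⟨M + M', X ^ M' * P + X ^ M * P', ?_⟩
  rw [mul_add, LN_lift h, add_comm M M', LN_lift h', map_add, map_add]

theorem LN_sub {N : ℕ} {f g : RatFunc ℚ} (hf : LN N f) (hg : LN N g) : LN N (f - g) := by
  obtain ⟨M, P, h⟩ := hf
  obtain ⟨M', P', h'⟩ := hg
  refine ⟨M + M', X ^ M' * P - X ^ M * P', ?_⟩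
  rw [mul_sub, LN_lift h, add_comm M M', LN_lift h', map_sub, map_sub]

theorem LN_al {N : ℕ} (P : ℚ[X]) : LN N (al (expand ℚ N P)) := ⟨0, P, by simp⟩

theorem LN_of {N : ℕ} {f : RatFunc ℚ} (h : InLaurentN N f) : LN N f := by
  obtain ⟨s, c, rfl⟩ := h
  apply Finset.sum_induction _ (LN N)
  · intro f g; exact LN_add
  · exact ⟨0, 0, by simp⟩
  · intro i _
    refine ⟨i.natAbs, C (c i) * X ^ (i + i.natAbs).toNat, ?_⟩
    rw [map_mul, map_mul, expand_C, map_pow, expand_X, map_pow, map_pow, al_X, RatFunc.algebraMap_C]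
    have e : ((RatFunc.X : RatFunc ℚ) ^ N) ^ (i + i.natAbs).toNat = RatFunc.X ^ ((N:ℤ) * (i + i.natAbs)) := by
      rw [← pow_mul, ← zpow_natCast]; congr 1; push_cast
      rw [Int.toNat_of_nonneg (by linarith [neg_abs_le i])]
    have e2 : (RatFunc.X : RatFunc ℚ) ^ (N * i.natAbs) = RatFunc.X ^ ((N:ℤ) * (i.natAbs : ℤ)) := by
      rw [← zpow_natCast]; congr 1
    rw [e, e2, mul_add, zpow_add₀ X_ne]; ring

theorem LN_uniq {N : ℕ} (hN : 0 < N) (f : ℕ → RatFunc ℚ) (hf : ∀ l < N, LN N (f l))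
    (h0 : ∑ l ∈ Finset.range N, RatFunc.X ^ l * f l = 0) : ∀ l < N, f l = 0 := by
  have hf' : ∀ l, ∃ (M : ℕ) (P : ℚ[X]), l < N → RatFunc.X ^ (N * M) * f l = al (expand ℚ N P) := by
    intro l
    by_cases h : l < N
    · obtain ⟨M, P, h⟩ := hf l h; exact ⟨M, P, fun _ => h⟩
    · exact ⟨0, 0, fun h' => absurd h' h⟩
  choose M P hMP using hf'
  set T := ∑ l ∈ Finset.range N, M l with hT
  have hle : ∀ l < N, M l ≤ T := fun l hl => Finset.single_le_sum (fun i _ => Nat.zero_le _) (Finset.mem_range.2 hl)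
  set Q : ℕ → ℚ[X] := fun l => X ^ (T - M l) * P l with hQ
  have hQ2 : ∀ l < N, RatFunc.X ^ (N * T) * f l = al (expand ℚ N (Q l)) := by
    intro l hl
    have := LN_lift (hMP l hl) (T - M l)
    rwa [Nat.add_sub_cancel' (hle l hl)] at this
  have h1 : ∑ l ∈ Finset.range N, X ^ l * expand ℚ N (Q l) = 0 := by
    apply al_inj
    rw [map_sum, map_zero]
    have := congrArg (fun x => RatFunc.X ^ (N * T) * x) h0
    rw [mul_zero, Finset.mul_sum] at this
    rw [← this]
    apply Finset.sum_congr rfl; intro l hl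
    rw [map_mul, map_pow, al_X, ← hQ2 l (Finset.mem_range.1 hl)]; ring
  intro l hl
  have h2 : Q l = 0 := by
    ext i
    have h3 := congrArg (fun f : ℚ[X] => f.coeff (N * i + l)) h1
    rw [finsetSum_coeff, Finset.sum_eq_single l] at h3
    · rw [coeff_X_pow_mul, mul_comm, coeff_expand_mul hN] at h3
      simpa using h3
    · intro l' hl' hne
      have hl' := Finset.mem_range.1 hl'
      rw [coeff_X_pow_mul', coeff_expand hN]
      split_ifs with c1 c2
      · exfalso
        apply hne
        have : (N * i + l) % N = l' % N := by
          have e : N * i + l = (N * i + l - l') + l' := by omega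
          rw [e, Nat.add_mod, Nat.mod_eq_zero_of_dvd c2]; simp
        rw [Nat.mul_add_mod, Nat.mod_eq_of_lt hl, Nat.mod_eq_of_lt hl'] at this
        exact this.symm
      · rfl
      · rfl
    · intro hn; exact absurd (Finset.mem_range.2 hl) hn
  have h4 := hQ2 l hl
  rw [h2, map_zero, map_zero] at h4
  exact (mul_eq_zero.1 h4).resolve_left (pow_ne_zero _ X_ne)

theorem class_eq {N : ℕ} (hN : 0 < N) (m : ℕ) (c : ℕ → ℚ) (f : ℕ → RatFunc ℚ) (hf : ∀ l < N, LN N (f l))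
    (h : al (∑ t ∈ Finset.range (N * m), C (c t) * X ^ t) = ∑ l ∈ Finset.range N, RatFunc.X ^ l * f l) :
    ∀ l < N, f l = al (expand ℚ N (∑ M ∈ Finset.range m, C (c (N * M + l)) * X ^ M)) := by
  intro l hl
  have := LN_uniq hN (fun l => f l - al (expand ℚ N (∑ M ∈ Finset.range m, C (c (N * M + l)) * X ^ M)))
    (fun l hl => LN_sub (hf l hl) (LN_al _)) ?_ l hl
  · exact sub_eq_zero.1 this
  simp_rw [mul_sub]
  rw [Finset.sum_sub_distrib, ← h, sum_residues, map_sum, ← Finset.sum_sub_distrib]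
  apply Finset.sum_eq_zero
  intro l _
  rw [← al_X, ← map_pow, ← map_mul, ← map_sub, map_eq_zero_iff _ al_inj, sub_eq_zero, map_sum, Finset.mul_sum]
  apply Finset.sum_congr rfl; intro M _
  rw [map_mul, expand_C, map_pow, expand_X]; ring

theorem class_eval {N : ℕ} (m : ℕ) (c : ℕ → ℚ) (l : ℕ) (z : ℂ) :
    RatFunc.eval (algebraMap ℚ ℂ) z (al (expand ℚ N (∑ M ∈ Finset.range m, C (c (N * M + l)) * X ^ M))) =
      ∑ M ∈ Finset.range m, (c (N * M + l) : ℂ) * (z ^ N) ^ M := by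
  rw [RatFunc.eval_algebraMap, Algebra.algebraMap_self, RingHom.id_apply, map_sum, eval₂_finsetSum]
  apply Finset.sum_congr rfl; intro M _
  simp [eval₂_mul]

theorem P3k (a N m : ℕ) (ha : 0 < a) (hN : 0 < N) (p : ℕ → ℕ → ℚ) (d : ℕ) (Uc : ℕ → ℕ → RatFunc ℚ)
    (HU : ∀ k : ℕ, 1 ≤ k → k + 1 ≤ d →
          RatFunc.X ^ (k - 1) * UkF a N (N * m) p (k - 1) = ∑ l ∈ Finset.range N, RatFunc.X ^ l * Uc k l ∧
          ∀ l ∈ Finset.range N, InLaurentN N (Uc k l)) (k : ℕ) (hk : k + 3 ≤ d) :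
    ∑ h ∈ Finset.range (m + 1), qe N (gQ a m p) (ph k) h (a - 1) = 0 := by
  induction k using Nat.strong_induction_on with
  | _ k ih =>
    have hU := UkF_eq a N m ha hN p k (fun k' hk' => ih k' hk' (by omega))
    have h1 := UkF_step a N m ha hN p k hU
    obtain ⟨h2, h3⟩ := HU (k + 2) (by omega) (by omega)
    rw [show k + 2 - 1 = k + 1 by omega] at h2
    have h4 : ∃ (M : ℕ) (Q : ℚ[X]), RatFunc.X ^ M * (∑ l ∈ Finset.range N, RatFunc.X ^ l * Uc (k + 2) l) = al Q := by
      apply Finset.sum_induction _ (fun f => ∃ (M : ℕ) (Q : ℚ[X]), RatFunc.X ^ M * f = al Q)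
      · rintro f g ⟨M, P, hf⟩ ⟨M', P', hg⟩
        refine ⟨M + M', X ^ M' * P + X ^ M * P', ?_⟩
        rw [map_add, map_mul, map_mul, ← hf, ← hg, map_pow, map_pow, al_X]; ring
      · exact ⟨0, 0, by simp⟩
      · intro l hl
        obtain ⟨M, P, h⟩ := LN_of (h3 l hl)
        refine ⟨N * M, X ^ l * expand ℚ N P, ?_⟩
        rw [map_mul, ← h, map_pow, al_X]; ring
    obtain ⟨M, Q, h5⟩ := h4
    rw [← h2] at h5
    have h6 : X ^ M * ((X * derivative (Uk a N m p k) - C (k:ℚ) * Uk a N m p k) * (1 - X) - X * Pk a N m p k (a - 1)) = Q * (1 - X) := by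
      apply al_inj
      rw [map_mul, ← h1, map_mul, ← h5, map_pow, map_sub al 1, map_one, al_X]; ring
    have h7 := congrArg (fun f : ℚ[X] => f.eval 1) h6
    simp only [eval_mul, eval_sub, eval_one, eval_X, eval_pow, one_pow, sub_self, mul_zero, zero_sub, one_mul, neg_eq_zero] at h7
    unfold Pk at h7
    rw [eval_finsetSum] at h7
    rw [← h7]
    apply Finset.sum_congr rfl; intro h _
    simp

end ZE
end


section
open Polynomial

namespace ZE

theorem cast_qe (a N m : ℕ) (p : ℕ → ℕ → ℚ) (φ : ℚ[X]) (h : ℤ) (e : ℕ) :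
    qe N (cg a m p) (φ.map (algebraMap ℚ ℂ)) h e = (algebraMap ℚ ℂ) (qe N (gQ a m p) φ h e) := by
  unfold qe cg
  rw [← coeff_map, Polynomial.map_mul, Polynomial.map_comp]
  congr 3
  simp

theorem cast_gv (a N m : ℕ) (p : ℕ → ℕ → ℚ) (φ : ℚ[X]) (h : ℤ) (y : ℚ) :
    gv a N (cg a m p) (φ.map (algebraMap ℚ ℂ)) h ((algebraMap ℚ ℂ) y) = (algebraMap ℚ ℂ) (gv a N (gQ a m p) φ h y) := by
  unfold gv
  rw [map_sum]
  apply Finset.sum_congr rfl; intro e _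
  rw [cast_qe, map_mul, map_mul, map_pow, map_inv₀, map_pow]

theorem cast_vv (a N m : ℕ) (p : ℕ → ℕ → ℚ) (φ : ℚ[X]) (t : ℕ) :
    vv a N m (cg a m p) (φ.map (algebraMap ℚ ℂ)) t = (algebraMap ℚ ℂ) (vv a N m (gQ a m p) φ t) := by
  unfold vv
  rw [map_neg, map_sum]
  congr 1
  apply Finset.sum_congr rfl; intro h _
  split_ifs
  · rw [← cast_gv]; congr 1; simp
  · simp

theorem cast_uu (a N m : ℕ) (p : ℕ → ℕ → ℚ) (φ : ℚ[X]) (t : ℕ) :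
    uu a N m (cg a m p) (φ.map (algebraMap ℚ ℂ)) t = (algebraMap ℚ ℂ) (uu a N m (gQ a m p) φ t) := by
  unfold uu u0 dd
  rw [map_add, map_mul, map_neg, map_sum, map_sum]
  have e0 : (1:ℂ[X]) = (1:ℚ[X]).map (algebraMap ℚ ℂ) := by simp
  congr 1
  · congr 1
    apply Finset.sum_congr rfl; intro h _
    split_ifs
    · rw [← cast_gv]; congr 1; simp
    · simp
  · congr 1
    · have := Polynomial.eval_map_apply (f := (algebraMap ℚ ℂ)) (p := φ) (t:ℚ)
      simpa using this
    · apply Finset.sum_congr rfl; intro h _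
      split_ifs
      · rw [map_sub, ← cast_gv, ← cast_gv, e0]; congr 2 <;> simp
      · simp

theorem ph_map (k : ℕ) : (ph k : ℚ[X]).map (algebraMap ℚ ℂ) = ph k := by
  unfold ph
  rw [Polynomial.map_prod]
  apply Finset.prod_congr rfl; intro i _
  simp

theorem eval_of_mul (k : ℕ) (f : RatFunc ℚ) (P : ℚ[X]) (z : ℂ) (hz : z ≠ 0) (h : RatFunc.X ^ k * f = al P) :
    z ^ k * RatFunc.eval (algebraMap ℚ ℂ) z f = P.eval₂ (algebraMap ℚ ℂ) z := by
  have hf : f = al P / al (X ^ k) := by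
    rw [eq_div_iff (by rw [map_pow, al_X]; exact pow_ne_zero _ X_ne), ← h, map_pow, al_X]; ring
  have hd : f.denom ∣ X ^ k := by rw [hf]; exact RatFunc.denom_div_dvd _ _
  have hd2 : f.denom.eval₂ (algebraMap ℚ ℂ) z ≠ 0 := by
    obtain ⟨Q, hQ⟩ := hd
    intro h0
    have := congrArg (fun f : ℚ[X] => f.eval₂ (algebraMap ℚ ℂ) z) hQ
    simp only [eval₂_mul, h0, zero_mul, eval₂_X_pow] at this
    exact pow_ne_zero _ hz this
  have h2 := congrArg (RatFunc.eval (algebraMap ℚ ℂ) z) h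
  have e1 : (RatFunc.X ^ k : RatFunc ℚ) = al (X ^ k) := by rw [map_pow, al_X]
  rw [RatFunc.eval_mul _ _ ?_ hd2, e1, RatFunc.eval_algebraMap, RatFunc.eval_algebraMap] at h2
  · simpa using h2
  · rw [e1, RatFunc.denom_algebraMap]; simp

theorem sum_c {K : Type} [AddCommMonoid K] (N m : ℕ) (hN : 0 < N) (G : ℕ → K) (h0 : G 0 = 0) (hG : ∀ t, N * m < t → G t = 0) :
    ∑ t ∈ Finset.range (N * (m + 1)), G t = ∑ t ∈ Finset.range (N * m), G (t + 1) := by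
  have : ∑ t ∈ Finset.range (N * m + 1), G t = ∑ t ∈ Finset.range (N * (m + 1)), G t := by
    apply Finset.sum_subset
    · apply Finset.range_subset_range.2; rw [mul_add]; omega
    · intro t _ ht
      apply hG; rw [Finset.mem_range] at ht; omega
  rw [← this, Finset.sum_range_succ', h0, add_zero]

noncomputable def FFn (a N m : ℕ) (p : ℕ → ℕ → ℚ) (w : ℂ) (ce γ γ' : ℕ → ℂ) (φ : ℂ[X]) : ℂ :=
  ∑ e ∈ Finset.range a, ce e * ∑ h ∈ Finset.range (m + 1), w ^ h * qe N (cg a m p) φ h e +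
  ∑ t ∈ Finset.range (N * m), γ (t + 1) * uu a N m (cg a m p) φ (t + 1) +
  ∑ t ∈ Finset.range (N * m), γ' t * vv a N m (cg a m p) φ t

theorem FFn_eq (a N m : ℕ) (ha : 0 < a) (hN : 0 < N) (p : ℕ → ℕ → ℚ) (d : ℕ) (Uc Vc : ℕ → ℕ → RatFunc ℚ)
    (HU : ∀ k : ℕ, 1 ≤ k → k + 1 ≤ d →
          RatFunc.X ^ (k - 1) * UkF a N (N * m) p (k - 1) = ∑ l ∈ Finset.range N, RatFunc.X ^ l * Uc k l ∧
          ∀ l ∈ Finset.range N, InLaurentN N (Uc k l))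
    (HV : ∀ k : ℕ, 1 ≤ k → k + 1 ≤ d →
          RatFunc.X ^ (k - 1) * VkF a N (N * m) p (k - 1) = ∑ l ∈ Finset.range N, RatFunc.X ^ l * Vc k l ∧
          ∀ l ∈ Finset.range N, InLaurentN N (Vc k l)) (k : ℕ) (hk : k + 3 ≤ d)
    (z : ℂ) (hz : z ≠ 0) (ce C1 : ℕ → ℂ) (sg : ℂ) :
    FFn a N m p (z ^ N) ce (fun t => C1 (t % N) * (z ^ N) ^ (t / N)) (fun t => sg * C1 ((N - t % N) % N) * (z ^ N) ^ (t / N)) (ph k) =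
      ∑ e ∈ Finset.range a, ce e * (z ^ k * RatFunc.eval (algebraMap ℚ ℂ) z (PPk a N (N * m) p k (a - e))) +
      ∑ l ∈ Finset.range N, C1 l * (RatFunc.eval (algebraMap ℚ ℂ) z (Uc (k + 1) l) + sg * RatFunc.eval (algebraMap ℚ ℂ) z (Vc (k + 1) ((N - l) % N))) := by
  have hP : ∀ k' < k, ∑ h ∈ Finset.range (m + 1), qe N (gQ a m p) (ph k') h (a - 1) = 0 :=
    fun k' hk' => P3k a N m ha hN p d Uc HU k' (by omega)
  have hU := UkF_eq a N m ha hN p k hP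
  have hV := VkF_eq a N m ha hN p k hP
  obtain ⟨hU1, hU2⟩ := HU (k + 1) (by omega) (by omega)
  obtain ⟨hV1, hV2⟩ := HV (k + 1) (by omega) (by omega)
  rw [Nat.add_sub_cancel, hU] at hU1
  rw [Nat.add_sub_cancel, hV] at hV1
  set c : ℕ → ℚ := fun t => if t = 0 then 0 else if t ≤ N * m then uu a N m (gQ a m p) (ph k) t else 0 with hc
  have hUk : Uk a N m p k = ∑ t ∈ Finset.range (N * (m + 1)), C (c t) * X ^ t := by
    rw [sum_c N m hN]
    · unfold Uk
      apply Finset.sum_congr rfl; intro t ht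
      have ht := Finset.mem_range.1 ht
      simp only [hc]
      rw [if_neg (by omega), if_pos (by omega)]
    · simp [hc]
    · intro t ht
      simp only [hc]
      rw [if_neg (by omega), if_neg (by omega)]; simp
  rw [hUk] at hU1
  have hUe := class_eq hN (m + 1) c (Uc (k + 1)) (fun l hl => LN_of (hU2 l (Finset.mem_range.2 hl))) hU1
  unfold Vk at hV1
  have hVe := class_eq hN m _ (Vc (k + 1)) (fun l hl => LN_of (hV2 l (Finset.mem_range.2 hl))) hV1
  have eU : ∑ l ∈ Finset.range N, C1 l * RatFunc.eval (algebraMap ℚ ℂ) z (Uc (k + 1) l) =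
      ∑ t ∈ Finset.range (N * m), C1 ((t + 1) % N) * (z ^ N) ^ ((t + 1) / N) * uu a N m (cg a m p) (ph k) (t + 1) := by
    have e1 : ∑ t ∈ Finset.range (N * m), C1 ((t + 1) % N) * (z ^ N) ^ ((t + 1) / N) * uu a N m (cg a m p) (ph k) (t + 1) =
        ∑ t ∈ Finset.range (N * (m + 1)), C1 (t % N) * (z ^ N) ^ (t / N) * (algebraMap ℚ ℂ) (c t) := by
      rw [sum_c N m hN]
      · apply Finset.sum_congr rfl; intro t ht
        have ht := Finset.mem_range.1 ht
        simp only [hc]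
        rw [if_neg (by omega), if_pos (by omega), ← ph_map, cast_uu]
      · simp [hc]
      · intro t ht
        simp only [hc]
        rw [if_neg (by omega), if_neg (by omega)]; simp
    rw [e1, sum_residues]
    apply Finset.sum_congr rfl; intro l hl
    have hl := Finset.mem_range.1 hl
    rw [hUe l hl, class_eval, Finset.mul_sum]
    apply Finset.sum_congr rfl; intro M _
    rw [Nat.mul_add_mod, Nat.mod_eq_of_lt hl, Nat.mul_add_div hN, Nat.div_eq_of_lt hl, add_zero]
    simp; ring
  have eV : ∑ l ∈ Finset.range N, C1 l * (sg * RatFunc.eval (algebraMap ℚ ℂ) z (Vc (k + 1) ((N - l) % N))) =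
      ∑ t ∈ Finset.range (N * m), sg * C1 ((N - t % N) % N) * (z ^ N) ^ (t / N) * vv a N m (cg a m p) (ph k) t := by
    have inv : ∀ l < N, (N - (N - l) % N) % N = l := by
      intro l hl
      rcases Nat.eq_zero_or_pos l with rfl | h
      · simp
      · rw [Nat.mod_eq_of_lt (show N - l < N by omega), show N - (N - l) = l by omega, Nat.mod_eq_of_lt hl]
    have e1 : ∑ l ∈ Finset.range N, C1 l * (sg * RatFunc.eval (algebraMap ℚ ℂ) z (Vc (k + 1) ((N - l) % N))) =
        ∑ l ∈ Finset.range N, C1 ((N - l) % N) * (sg * RatFunc.eval (algebraMap ℚ ℂ) z (Vc (k + 1) l)) := by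
      refine Finset.sum_bij' (fun l _ => (N - l) % N) (fun l _ => (N - l) % N) ?_ ?_ ?_ ?_ ?_
      · intro l _; exact Finset.mem_range.2 (Nat.mod_lt _ hN)
      · intro l _; exact Finset.mem_range.2 (Nat.mod_lt _ hN)
      · intro l hl; exact inv l (Finset.mem_range.1 hl)
      · intro l hl; exact inv l (Finset.mem_range.1 hl)
      · intro l hl; rw [inv l (Finset.mem_range.1 hl)]
    rw [e1, sum_residues]
    apply Finset.sum_congr rfl; intro l hl
    have hl := Finset.mem_range.1 hl
    rw [hVe l hl, class_eval, Finset.mul_sum, Finset.mul_sum]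
    apply Finset.sum_congr rfl; intro M _
    rw [Nat.mul_add_mod, Nat.mod_eq_of_lt hl, Nat.mul_add_div hN, Nat.div_eq_of_lt hl, add_zero, ← ph_map, cast_vv]
    simp; ring
  simp_rw [mul_add, Finset.sum_add_distrib]
  rw [eU, eV]
  unfold FFn
  rw [add_assoc]
  congr 1
  apply Finset.sum_congr rfl; intro e he
  have he := Finset.mem_range.1 he
  rw [eval_of_mul k _ _ z hz (PPk_eq a N m hN p k (a - e) (by omega) (by omega))]
  unfold Pk
  rw [eval₂_finsetSum, show a - (a - e) = e by omega]
  congr 1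
  apply Finset.sum_congr rfl; intro h _
  rw [← ph_map, cast_qe, eval₂_mul, eval₂_C, eval₂_X_pow, pow_mul]; ring

end ZE
end


section
open Polynomial

namespace ZE

theorem ph_coeff (c i : ℕ) (h : c ≤ i) : (ph c : ℂ[X]).coeff i = if i = c then 1 else 0 := by
  have hm : (ph c : ℂ[X]).Monic := monic_prod_of_monic _ _ (fun i _ => monic_X_sub_C _)
  have hd : (ph c : ℂ[X]).natDegree = c := by
    unfold ph
    rw [natDegree_prod _ _ (fun i _ => X_sub_C_ne_zero _)]
    simp only [natDegree_X_sub_C]; simp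
  split_ifs with h1
  · rw [h1]
    have := hm.coeff_natDegree
    rwa [hd] at this
  · exact coeff_eq_zero_of_natDegree_lt (by omega)

theorem van (Λ : ℂ[X] →ₗ[ℂ] ℂ) (c : ℕ) (h : ∀ k < c, Λ (ph k) = 0) (φ : ℂ[X]) (hφ : φ.natDegree < c) : Λ φ = 0 := by
  have key : ∀ c' ≤ c, ∀ φ : ℂ[X], (∀ i, c' ≤ i → φ.coeff i = 0) → Λ φ = 0 := by
    intro c'
    induction c' with
    | zero =>
      intro _ φ h0
      have : φ = 0 := by ext i; rw [h0 i (by omega)]; simp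
      rw [this, map_zero]
    | succ c' ih =>
      intro hc φ h0
      have h1 := ih (by omega) (φ - φ.coeff c' • ph c') (by
        intro i hi
        rw [coeff_sub, coeff_smul, ph_coeff c' i hi]
        split_ifs with h
        · rw [h]; simp
        · rw [h0 i (by omega)]; simp)
      rw [map_sub, map_smul, h c' (by omega), smul_zero, sub_zero] at h1
      exact h1
  exact key c le_rfl φ (fun i hi => coeff_eq_zero_of_natDegree_lt (by omega))

noncomputable def FL (a N m : ℕ) (p : ℕ → ℕ → ℚ) (w : ℂ) (ce γ γ' : ℕ → ℂ) : ℂ[X] →ₗ[ℂ] ℂ where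
  toFun φ := FFn a N m p w ce γ γ' φ
  map_add' φ ψ := by
    unfold FFn
    simp only [qe_add, uu_add, vv_add, mul_add, Finset.sum_add_distrib]; ring
  map_smul' c φ := by
    unfold FFn
    simp only [smul_eq_C_mul, qe_Cmul, uu_Cmul, vv_Cmul, RingHom.id_apply, smul_eq_mul, mul_add, Finset.mul_sum]
    congr 1
    · congr 1
      · apply Finset.sum_congr rfl; intro e _; apply Finset.sum_congr rfl; intro h _; ring
      · apply Finset.sum_congr rfl; intro e _; ring
    · apply Finset.sum_congr rfl; intro e _; ring

noncomputable def PL (a N m : ℕ) (p : ℕ → ℕ → ℚ) : ℂ[X] →ₗ[ℂ] ℂ where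
  toFun φ := ∑ h ∈ Finset.range (m + 1), qe N (cg a m p) φ h (a - 1)
  map_add' φ ψ := by
    simp only [qe_add, Finset.sum_add_distrib]
  map_smul' c φ := by
    simp only [smul_eq_C_mul, qe_Cmul, RingHom.id_apply, smul_eq_mul, Finset.mul_sum]

noncomputable def cc2 (a N : ℕ) : ℕ := cC0 a N (a + 2 * N) (cC2 (ck a N (a + 2 * N)) (a + 2 * N)) + (a + 2 * N)

noncomputable def KKb (a N : ℕ) : ℕ := cK a N (a + 2 * N) + 1 + ck a N (a + 2 * N)

noncomputable def mm0 (a N : ℕ) : ℕ := (cD a (a + 2 * N) + (a + cD a (a + 2 * N)) * (a + 2 * N) + 1) + (2 * KKb a N + 1) + 2 * N + cc2 a N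

theorem d_eq (a r N m : ℕ) (ha : 2 * r * N < a) : a * (m + 1) - 2 * r * (N * m) = m * (a - 2 * r * N) + a := by
  obtain ⟨b, rfl⟩ : ∃ b, a = 2 * r * N + b := ⟨a - 2 * r * N, by omega⟩
  rw [Nat.add_sub_cancel_left]
  have : (2 * r * N + b) * (m + 1) = m * b + (2 * r * N + b) + 2 * r * (N * m) := by ring
  rw [this, Nat.add_sub_cancel]

theorem nondeg (a r N m : ℕ) (hN : 0 < N) (hr : 0 < r) (ha : 2 * r * N < a) (hm : mm0 a N ≤ m) (p : ℕ → ℕ → ℚ)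
    (hp : IsPartialFractionCoeffs a r N (N * m) p) (Uc Vc : ℕ → ℕ → RatFunc ℚ)
    (HU : ∀ k : ℕ, 1 ≤ k → k + 1 ≤ a * (m + 1) - 2 * r * (N * m) →
          RatFunc.X ^ (k - 1) * UkF a N (N * m) p (k - 1) = ∑ l ∈ Finset.range N, RatFunc.X ^ l * Uc k l ∧
          ∀ l ∈ Finset.range N, InLaurentN N (Uc k l))
    (HV : ∀ k : ℕ, 1 ≤ k → k + 1 ≤ a * (m + 1) - 2 * r * (N * m) →
          RatFunc.X ^ (k - 1) * VkF a N (N * m) p (k - 1) = ∑ l ∈ Finset.range N, RatFunc.X ^ l * Vc k l ∧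
          ∀ l ∈ Finset.range N, InLaurentN N (Vc k l))
    (z : ℂ) (hz : z ≠ 0) (hw : z ^ N = 1 ∨ z ^ N = -1) (ce C1 : ℕ → ℂ) (sg : ℂ) (hce : z ^ N = 1 → ce (a - 1) = 0)
    (hrel : ∀ k < cc2 a N, ∑ e ∈ Finset.range a, ce e * (z ^ k * RatFunc.eval (algebraMap ℚ ℂ) z (PPk a N (N * m) p k (a - e))) +
      ∑ l ∈ Finset.range N, C1 l * (RatFunc.eval (algebraMap ℚ ℂ) z (Uc (k + 1) l) +
        sg * RatFunc.eval (algebraMap ℚ ℂ) z (Vc (k + 1) ((N - l) % N))) = 0) :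
    (∀ e < a, ce e = 0) ∧ (∀ l < N, C1 l = 0) := by
  have ha3 : 3 ≤ a := by
    have : 1 ≤ r * N := Nat.mul_pos hr hN
    have e : 2 * r * N = 2 * (r * N) := by ring
    omega
  have hd := d_eq a r N m ha
  have hdm : m ≤ m * (a - 2 * r * N) := Nat.le_mul_of_pos_right _ (by omega)
  have hc2q : a + 2 * N ≤ cc2 a N := by unfold cc2; omega
  unfold mm0 at hm
  have hKb1 : cK a N (a + 2 * N) + 1 ≤ KKb a N := by unfold KKb; omega
  have hKb2 : ck a N (a + 2 * N) ≤ KKb a N := by unfold KKb; omega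
  have hS := mkSetup a r N m (KKb a N) hN hr ha (by omega) p hp
  set w := z ^ N with hwdef
  set γ : ℕ → ℂ := fun t => C1 (t % N) * w ^ (t / N) with hγ
  set γ' : ℕ → ℂ := fun t => sg * C1 ((N - t % N) % N) * w ^ (t / N) with hγ'
  have hw0 : w ≠ 0 := pow_ne_zero _ hz
  have hP3 : ∀ φ : ℂ[X], φ.natDegree < m * (a - 2 * r * N) + a - 2 → ∑ h ∈ Finset.range (m + 1), qe N (cg a m p) φ h (a - 1) = 0 := by
    intro φ hφ
    refine van (PL a N m p) _ ?_ φ hφ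
    intro k hk
    have h1 := P3k a N m (by omega) hN p _ Uc HU k (by omega)
    have h2 := congrArg (algebraMap ℚ ℂ) h1
    rw [map_zero, map_sum] at h2
    refine Eq.trans ?_ h2
    show ∑ h ∈ Finset.range (m + 1), qe N (cg a m p) (ph k) h (a - 1) = _
    apply Finset.sum_congr rfl; intro h _
    rw [← ph_map, cast_qe]
  have hF : ∀ φ : ℂ[X], φ.natDegree < cc2 a N → FFn a N m p w ce γ γ' φ = 0 := by
    intro φ hφ
    refine van (FL a N m p w ce γ γ') _ ?_ φ hφ
    intro k hk
    refine Eq.trans (FFn_eq a N m (by omega) hN p _ Uc Vc HU HV k (by omega) z hz ce C1 sg) (hrel k hk)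
  have hγs : ∀ t, γ (t + N) = w * γ t := by
    intro t; simp only [hγ]; rw [Nat.add_mod_right, Nat.add_div_right _ hN, pow_succ]; ring
  have hγs' : ∀ t, γ' (t + N) = w * γ' t := by
    intro t; simp only [hγ']; rw [Nat.add_mod_right, Nat.add_div_right _ hN, pow_succ]; ring
  have hMom := middle hS (by omega) (cB_dvd a r N m hN) (cA_dvd a r N m hN) (cB_zero a r N m) (cA_zero a r N m)
    (m * (a - 2 * r * N) + a - 2) hP3 w γ γ' hγs hγs' ce (cc2 a N) (by omega) hF
    (cC0 a N (a + 2 * N) (cC2 (ck a N (a + 2 * N)) (a + 2 * N))) le_rfl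
  have hl0 : (cA a r N m).coeff (a + 2 * N) ≠ 0 := by rw [c_hl1]; exact one_ne_zero
  have hnx := c_hnext a r N m hN ha (by omega)
  have hcore := core hS (by omega) (by omega) (c_hAZ a r N m _ hN hr (by omega)) hKb1 hKb2 (by omega)
    (c_sep a r N m _ hN hr (by omega)) (c_hl a r N m) hl0 (m * (a - 2 * r * N) + a) (by omega)
    (fun i hi => hnx i (by omega)) w hw (fun l => γ (l + 1)) hMom
  have hC1 : ∀ l < N, C1 l = 0 := by
    intro l hl
    rcases Nat.eq_zero_or_pos l with rfl | h
    · have := hcore (N - 1) (by omega)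
      simp only [hγ] at this
      rw [Nat.sub_add_cancel hN, Nat.mod_self] at this
      exact (mul_eq_zero.1 this).resolve_right (pow_ne_zero _ hw0)
    · have := hcore (l - 1) (by omega)
      simp only [hγ] at this
      rw [Nat.sub_add_cancel h, Nat.mod_eq_of_lt hl] at this
      exact (mul_eq_zero.1 this).resolve_right (pow_ne_zero _ hw0)
  refine ⟨?_, hC1⟩
  apply stage2 hS (cB_dvd a r N m hN) (by omega) (c_hl a r N m) hl0 (m * (a - 2 * r * N) + a) (by omega) hnx w hw ce hce
  · intro φ hφ; exact hP3 φ (by omega)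
  · intro φ hφ
    have := hF φ (by omega)
    unfold FFn at this
    rw [Finset.sum_eq_zero (s := Finset.range (N * m)), Finset.sum_eq_zero (s := Finset.range (N * m)), add_zero, add_zero] at this
    · exact this
    · intro t _; simp only [hγ']; rw [hC1 _ (Nat.mod_lt _ hN)]; simp
    · intro t _; simp only [hγ]; rw [hC1 _ (Nat.mod_lt _ hN)]; simp

theorem choose_k (D c : ℕ) (v : ℕ → Fin D → ℂ)
    (h : ∀ x : Fin D → ℂ, (∀ k, 1 ≤ k → k ≤ c → ∑ i, x i * v k i = 0) → x = 0) :
    ∃ kk : Fin D → ℕ, StrictMono kk ∧ (∀ j, 1 ≤ kk j ∧ kk j ≤ c) ∧ (Matrix.of fun i j : Fin D => v (kk j) i).det ≠ 0 := by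
  set V : Finset.Icc 1 c → Fin D → ℂ := fun k => v k with hV
  have hspan : Submodule.span ℂ (Set.range V) = ⊤ := by
    by_contra hne
    obtain ⟨f, hf0, hf⟩ := Submodule.exists_le_ker_of_lt_top _ (lt_top_iff_ne_top.2 hne)
    apply hf0
    have hx := h (fun i => f (Pi.single i 1)) (by
      intro k h1 h2
      have : V ⟨k, Finset.mem_Icc.2 ⟨h1, h2⟩⟩ ∈ LinearMap.ker f := hf (Submodule.subset_span ⟨_, rfl⟩)
      rw [LinearMap.mem_ker, LinearMap.pi_apply_eq_sum_univ] at this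
      refine Eq.trans ?_ this
      apply Finset.sum_congr rfl; intro i _
      rw [smul_eq_mul, mul_comm]; congr 2
      ext j; simp [Pi.single_apply, eq_comm]
      )
    apply LinearMap.pi_ext'
    intro i
    ext
    simpa using congrFun hx i
  obtain ⟨κ, al, hinj, hsp, hli⟩ := exists_linearIndependent' ℂ V
  rw [hspan] at hsp
  have : Fintype κ := Fintype.ofInjective al hinj
  have hcard : Fintype.card κ = D := by
    have b := Module.Basis.mk hli hsp.ge
    have := Module.finrank_eq_card_basis b
    simpa using this.symm
  set T : Finset ℕ := Finset.univ.image (fun x => ((al x : Finset.Icc 1 c) : ℕ)) with hT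
  have hinj2 : Function.Injective (fun x => ((al x : Finset.Icc 1 c) : ℕ)) := Subtype.val_injective.comp hinj
  have hTc : T.card = D := by rw [hT, Finset.card_image_of_injective _ hinj2, Finset.card_univ, hcard]
  set kk := T.orderEmbOfFin hTc with hkk
  have hmem : ∀ j, ∃ x, ((al x : Finset.Icc 1 c) : ℕ) = kk j := by
    intro j
    obtain ⟨x, _, hx⟩ := Finset.mem_image.1 (T.orderEmbOfFin_mem hTc j)
    exact ⟨x, hx⟩
  choose g hg using hmem
  refine ⟨kk, (T.orderEmbOfFin hTc).strictMono, ?_, ?_⟩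
  · intro j; rw [← hg j]; exact Finset.mem_Icc.1 (al (g j)).2
  · have hgi : Function.Injective g := by
      intro i j hij
      apply (T.orderEmbOfFin hTc).injective
      rw [← hkk, ← hg i, ← hg j, hij]
    have hl2 := hli.comp g hgi
    have : LinearIndependent ℂ (Matrix.of fun i j : Fin D => v (kk j) i).col := by
      have he : (Matrix.of fun i j : Fin D => v (kk j) i).col = (V ∘ al) ∘ g := by
        ext j i
        simp [Matrix.col, hV, hg]
      rw [he]; exact hl2
    rw [Matrix.linearIndependent_cols_iff_isUnit, Matrix.isUnit_iff_isUnit_det] at this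
    exact this.ne_zero

end ZE
end

/-- **Application of the zero estimate.** There is a constant `c₂`, depending only on `a`
and `N`, such that for every sufficiently large multiple `n` of `N` there exist integers
`1 ≤ k_{i₀} < k_{i₀+1} < … < k_{a+N} ≤ c₂` for which the matrix
`[s_{k_j,i}]_{i₀ ≤ i,j ≤ a+N}` is invertible. -/
theorem invertible_matrix_of_linear_forms
    (a N : ℕ) (ha : 0 < a) (hN : 0 < N) :
    ∃ c₂ : ℕ, 0 < c₂ ∧
      ∀ r : ℕ, 0 < r → 2 * r * N < a →
      ∀ z₀ : ℂ, (z₀ = 1 ∨ z₀ = Complex.exp (Real.pi * Complex.I / N)) →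
      ∀ pp : ℕ, (pp = 0 ∨ pp = 1) →
      ∀ i₀ : ℕ, (z₀ = 1 → i₀ = 2) → (z₀ ≠ 1 → i₀ = 1) →
      ∀ p : ℕ → ℕ → ℕ → ℚ,
        (∀ n : ℕ, 0 < n → N ∣ n → IsPartialFractionCoeffs a r N n (p n)) →
      ∀ Uc Vc : ℕ → ℕ → ℕ → RatFunc ℚ,
        (∀ n : ℕ, 0 < n → N ∣ n → ∀ k : ℕ, 1 ≤ k → k + 1 ≤ a * (n / N + 1) - 2 * r * n →
          RatFunc.X ^ (k - 1) * UkF a N n (p n) (k - 1)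
            = ∑ l ∈ Finset.range N, RatFunc.X ^ l * Uc n k l ∧
          ∀ l ∈ Finset.range N, InLaurentN N (Uc n k l)) →
        (∀ n : ℕ, 0 < n → N ∣ n → ∀ k : ℕ, 1 ≤ k → k + 1 ≤ a * (n / N + 1) - 2 * r * n →
          RatFunc.X ^ (k - 1) * VkF a N n (p n) (k - 1)
            = ∑ l ∈ Finset.range N, RatFunc.X ^ l * Vc n k l ∧
          ∀ l ∈ Finset.range N, InLaurentN N (Vc n k l)) →
      ∀ s : ℕ → ℕ → ℕ → ℂ,
        (∀ n k i : ℕ, 1 ≤ i → i ≤ a →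
          s n k i = (deltan a N n : ℂ) * z₀ ^ (k - 1) *
            RatFunc.eval (algebraMap ℚ ℂ) z₀ (PPk a N n (p n) (k - 1) i)) →
        (∀ n k l : ℕ, l < N →
          s n k (a + 1 + l) = (deltan a N n : ℂ) *
            (RatFunc.eval (algebraMap ℚ ℂ) z₀ (Uc n k l) +
              (-1) ^ pp * RatFunc.eval (algebraMap ℚ ℂ) z₀ (Vc n k ((N - l) % N)))) →
      ∃ n₀ : ℕ, ∀ n : ℕ, n₀ ≤ n → N ∣ n →
        ∃ kk : Fin (a + N + 1 - i₀) → ℕ, StrictMono kk ∧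
          (∀ j, 1 ≤ kk j ∧ kk j ≤ c₂) ∧
          (Matrix.of fun ii jj : Fin (a + N + 1 - i₀) =>
            s n (kk jj) (i₀ + ii)).det ≠ 0 := by
  refine ⟨ZE.cc2 a N, by unfold ZE.cc2; omega, ?_⟩
  intro r hr hra z₀ hz pp _ i₀ hi2 hi1 p hp Uc Vc HU HV s hs1 hs2
  refine ⟨N * ZE.mm0 a N + N, ?_⟩
  rintro n hn ⟨m, rfl⟩
  have hm : ZE.mm0 a N ≤ m := by
    by_contra hlt
    have : N * m ≤ N * ZE.mm0 a N := Nat.mul_le_mul_left _ (by omega)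
    omega
  have hn0 : 0 < N * m := by omega
  have hdv : N ∣ N * m := ⟨m, rfl⟩
  have hnN : N * m / N = m := Nat.mul_div_cancel_left _ hN
  have hz0 : z₀ ≠ 0 := by
    rcases hz with h | h
    · rw [h]; exact one_ne_zero
    · rw [h]; exact Complex.exp_ne_zero _
  have hi : (z₀ = 1 ∧ i₀ = 2) ∨ (z₀ ≠ 1 ∧ i₀ = 1) := by
    by_cases h : z₀ = 1
    · exact Or.inl ⟨h, hi2 h⟩
    · exact Or.inr ⟨h, hi1 h⟩
  have hexp : Complex.exp (Real.pi * Complex.I / N) ^ N = -1 := by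
    rw [← Complex.exp_nat_mul, mul_div_cancel₀ _ (Nat.cast_ne_zero.2 hN.ne'), Complex.exp_pi_mul_I]
  have hw : z₀ ^ N = 1 ∨ z₀ ^ N = -1 := by
    rcases hz with h | h
    · left; rw [h, one_pow]
    · right; rw [h, hexp]
  have hw1 : z₀ ^ N = 1 → i₀ = 2 := by
    intro h1
    rcases hz with h | h
    · exact hi2 h
    · rw [h, hexp] at h1; norm_num at h1
  have hi01 : 1 ≤ i₀ := by rcases hi with h | h <;> omega
  have hi02 : i₀ ≤ a + N + 1 := by rcases hi with h | h <;> omega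
  have hdel : (deltan a N (N * m) : ℂ) ≠ 0 := by
    have h1 : dlcm (N * m) ≠ 0 := by
      unfold dlcm
      rw [Ne, Finset.lcm_eq_zero_iff]
      rintro ⟨x, hx, h0⟩
      have := (Finset.mem_Icc.1 (Finset.mem_coe.1 hx)).1
      simp only [id] at h0; omega
    have h2 : deltan a N (N * m) ≠ 0 := by
      unfold deltan
      exact mul_ne_zero (pow_ne_zero _ (mul_ne_zero hN.ne' h1)) (pow_ne_zero _ hN.ne')
    exact_mod_cast h2
  apply ZE.choose_k (a + N + 1 - i₀) (ZE.cc2 a N) (fun k ii => s (N * m) k (i₀ + ii))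
  intro x hx
  set c : ℕ → ℂ := fun i => if h : i₀ ≤ i ∧ i ≤ a + N then x ⟨i - i₀, by omega⟩ else 0 with hc
  have hcx : ∀ ii : Fin (a + N + 1 - i₀), c (i₀ + ii) = x ii := by
    intro ii
    have h2 := ii.2
    simp only [hc]
    rw [dif_pos ⟨by omega, by omega⟩]
    congr 1; ext; simp
  have hsum : ∀ f : ℕ → ℂ, ∑ ii : Fin (a + N + 1 - i₀), x ii * f (i₀ + ii) =
      ∑ e ∈ Finset.range a, c (a - e) * f (a - e) + ∑ l ∈ Finset.range N, c (a + 1 + l) * f (a + 1 + l) := by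
    intro f
    have e1 : ∑ ii : Fin (a + N + 1 - i₀), x ii * f (i₀ + ii) = ∑ i ∈ Finset.Ico i₀ (a + N + 1), c i * f i := by
      rw [Finset.sum_Ico_eq_sum_range, ← Fin.sum_univ_eq_sum_range (fun i => c (i₀ + i) * f (i₀ + i))]
      apply Finset.sum_congr rfl; intro ii _; rw [hcx]
    have e2 : ∑ i ∈ Finset.Ico i₀ (a + N + 1), c i * f i = ∑ i ∈ Finset.Ico 1 (a + N + 1), c i * f i := by
      apply Finset.sum_subset (Finset.Ico_subset_Ico hi01 le_rfl)
      intro i h1 h2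
      rw [Finset.mem_Ico] at h1 h2
      simp only [hc]
      rw [dif_neg (by omega), zero_mul]
    rw [e1, e2, ← Finset.sum_Ico_consecutive _ (show 1 ≤ a + 1 by omega) (show a + 1 ≤ a + N + 1 by omega)]
    congr 1
    · rw [Finset.sum_Ico_eq_sum_range, ← Finset.sum_range_reflect, Nat.add_sub_cancel]
      apply Finset.sum_congr rfl; intro e he
      rw [Finset.mem_range] at he
      rw [show 1 + (a - 1 - e) = a - e by omega]
    · rw [Finset.sum_Ico_eq_sum_range, show a + N + 1 - (a + 1) = N by omega]
  have hnd := ZE.nondeg a r N m hN hr hra hm (p (N * m)) (hp _ hn0 hdv) (Uc (N * m)) (Vc (N * m))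
    (by have h := HU _ hn0 hdv; rw [hnN] at h; exact h)
    (by have h := HV _ hn0 hdv; rw [hnN] at h; exact h) z₀ hz0 hw
    (fun e => c (a - e)) (fun l => c (a + 1 + l)) ((-1) ^ pp)
    (by
      intro h1
      have h2 := hw1 h1
      simp only [hc]
      rw [dif_neg (by omega)])
    (by
      intro k hk
      have h1 := hx (k + 1) (by omega) (by omega)
      rw [hsum (fun i => s (N * m) (k + 1) i)] at h1
      apply mul_left_cancel₀ hdel
      rw [mul_zero, ← h1, mul_add, Finset.mul_sum, Finset.mul_sum]
      congr 1
      · apply Finset.sum_congr rfl; intro e he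
        rw [Finset.mem_range] at he
        rw [hs1 _ _ _ (by omega) (by omega), Nat.add_sub_cancel]; ring
      · apply Finset.sum_congr rfl; intro l hl
        rw [hs2 _ _ _ (Finset.mem_range.1 hl)]; ring)
  obtain ⟨hA, hB⟩ := hnd
  ext ii
  rw [← hcx ii]
  have h2 := ii.2
  by_cases hle : i₀ + (ii : ℕ) ≤ a
  · have := hA (a - (i₀ + ii)) (by omega)
    rw [show a - (a - (i₀ + (ii : ℕ))) = i₀ + ii by omega] at this
    exact this
  · have := hB (i₀ + ii - (a + 1)) (by omega)
    rw [show a + 1 + (i₀ + (ii : ℕ) - (a + 1)) = i₀ + ii by omega] at this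
    exact this
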